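/- Let M be a matroid without large uniform minors and let r ≥ 2 be an even integer. Then M is representable over both the finite field 𝔽_{2^r} and 𝔽₃ if and only if M is representable over both 𝔽₄ and 𝔽₃. -/

import Mathlib

universe u v w

open Matroid Set

namespace Paper

/-- The deletion of the set `D` from the matroid `M`. -/
def delete {α : Type u} (M : Matroid α) (D : Set α) : Matroid α := M ↾ (M.E \ D)

/-- The contraction of the set `C` in the matroid `M`. -/
def contract {α : Type u} (M : Matroid α) (C : Set α) : Matroid α := (delete M✶ C)✶

/-- `N` is a minor of `M`: it is obtained from `M` by a sequence of deletions and
contractions, equivalently by a single contraction followed by a single deletion. -/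
def IsMinor {α : Type u} (N M : Matroid α) : Prop :=
  ∃ C D : Set α, N = delete (contract M C) D

/-- `M` is a copy of the uniform matroid `U(r,n)`: its ground set has `n` elements and its
independent sets are exactly the subsets of the ground set with at most `r` elements. -/
def IsUniform {α : Type u} (M : Matroid α) (r n : ℕ) : Prop :=
  M.E.Finite ∧ M.E.ncard = n ∧ ∀ I ⊆ M.E, (M.Indep I ↔ I.ncard ≤ r)

/-- `M` has a minor isomorphic to the uniform matroid `U(r,n)`. -/
def HasUniformMinor {α : Type u} (M : Matroid α) (r n : ℕ) : Prop :=
  ∃ N : Matroid α, IsMinor N M ∧ IsUniform N r n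

/-- `M` is without large uniform minors: no minor of `M` is isomorphic to `U(2,5)` or
`U(3,5)`. -/
def NoLargeUniformMinors {α : Type u} (M : Matroid α) : Prop :=
  ¬ HasUniformMinor M 2 5 ∧ ¬ HasUniformMinor M 3 5

/-- `M` is isomorphic to the Fano matroid `F₇`, the matroid on the seven nonzero vectors of
`(𝔽₂)³` whose independent sets are the `𝔽₂`-linearly independent subsets. -/
def IsFano {α : Type u} (M : Matroid α) : Prop :=
  ∃ f : α → (Fin 3 → ZMod 2),
    Set.BijOn f M.E {x | x ≠ 0} ∧
    ∀ I ⊆ M.E, (M.Indep I ↔ Set.InjOn f I ∧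
      LinearIndependent (ZMod 2) (fun x : (f '' I) => (x : Fin 3 → ZMod 2)))

/-- `M` has a minor isomorphic to the Fano matroid `F₇`. -/
def HasFanoMinor {α : Type u} (M : Matroid α) : Prop :=
  ∃ N : Matroid α, IsMinor N M ∧ IsFano N

/-- `M` has a minor isomorphic to the dual Fano matroid `F₇*`. -/
def HasFanoDualMinor {α : Type u} (M : Matroid α) : Prop :=
  ∃ N : Matroid α, IsMinor N M ∧ IsFano N✶

/-- `M` is representable over the field `K`: there are a `K`-vector space `V` and a map
`φ` from the ground type to `V` such that a set `I ⊆ M.E` is independent in `M` if and only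
if the family `φ` restricted to `I` is linearly independent over `K` (equivalently, `φ` is
injective on `I` and the image `φ '' I` is linearly independent). -/
def Representable {α : Type u} (M : Matroid α) (K : Type v) [Field K] : Prop :=
  ∃ (V : Type (max u v)) (_ : AddCommGroup V) (_ : Module K V) (φ : α → V),
    ∀ I ⊆ M.E, (M.Indep I ↔ LinearIndependent K (fun x : I => φ x))

end Paper

namespace CrossRatioLift

set_option linter.unusedSectionVars false

section Algebra

variable {α F K : Type*} [Field F] [Field K]

/-- The properties of a map between fields of characteristic two that allow it to be applied to
all cross ratios of a representation. -/
structure CrMap (f : F → K) : Prop where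
  map_zero : f 0 = 0
  map_one : f 1 = 1
  map_one_add : ∀ x, f (1 + x) = 1 + f x
  map_inv : ∀ x, f x⁻¹ = (f x)⁻¹
  eq_zero : ∀ x, f x = 0 → x = 0

/-- The cross ratio of four points with respect to an alternating form `q`. -/
def cr (q : α → α → K) (a b c d : α) : K := q a c * q b d / (q a d * q b c)

/-- Alternating forms of rank two in characteristic two. -/
structure Alt2 (q : α → α → K) : Prop where
  comm : ∀ a b, q a b = q b a
  self : ∀ a, q a a = 0
  three : ∀ a b c d, q a b * q c d = q a c * q b d + q a d * q b c

/-- Alternating forms of rank three in characteristic two. -/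
structure Alt3 (t : α → α → α → K) : Prop where
  alt : ∀ z, Alt2 (t z)
  comm : ∀ a b c, t a b c = t b a c

/-- The four points `a, b, c, d` are pairwise independent. -/
structure U24 (q : α → α → K) (a b c d : α) : Prop where
  ab : q a b ≠ 0
  ac : q a c ≠ 0
  ad : q a d ≠ 0
  bc : q b c ≠ 0
  bd : q b d ≠ 0
  cd : q c d ≠ 0

/-- The form `q'` has the cross ratio prescribed by `q` and `f`. -/
def Ok (f : F → K) (q : α → α → F) (q' : α → α → K) (a b c d : α) : Prop :=
  f (cr q a b c d) = cr q' a b c d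

variable {f : F → K} {q : α → α → F} {q' : α → α → K} {a b c d e : α}

lemma CrMap.map_mul (hf : CrMap f) {x y : F} (hx : x ≠ 0) (hy : y ≠ 0)
    (h : x = 1 ∨ y = 1 ∨ x * y = 1) : f (x * y) = f x * f y := by
  rcases h with rfl | rfl | h
  · simp [hf.map_one]
  · simp [hf.map_one]
  · have : y = x⁻¹ := by field_simp; linear_combination h
    subst this
    have : f x ≠ 0 := fun h => hx (hf.eq_zero _ h)
    rw [mul_inv_cancel₀ hx, hf.map_inv, hf.map_one, mul_inv_cancel₀ this]

lemma CrMap.eq_one [CharP F 2] (hf : CrMap f) (h2 : (2 : K) = 0) {x : F} (h : f x = 1) : x = 1 := by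
  have h1 := hf.map_one_add x
  rw [h] at h1
  have := hf.eq_zero _ (h1.trans (by linear_combination h2))
  have h3 : (2 : F) = 0 := CharTwo.two_eq_zero
  linear_combination this - h3

lemma cr_swap_left (q : α → α → K) (a b c d : α) : cr q b a c d = (cr q a b c d)⁻¹ := by
  simp only [cr, inv_div]; ring

lemma cr_swap_right (q : α → α → K) (a b c d : α) : cr q a b d c = (cr q a b c d)⁻¹ := by
  simp only [cr, inv_div]

lemma Ok.swap_left (hf : CrMap f) (h : Ok f q q' a b c d) : Ok f q q' b a c d := by
  unfold Ok at *; rw [cr_swap_left q, hf.map_inv, h, ← cr_swap_left]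

lemma Ok.swap_right (hf : CrMap f) (h : Ok f q q' a b c d) : Ok f q q' a b d c := by
  unfold Ok at *; rw [cr_swap_right q, hf.map_inv, h, ← cr_swap_right]

lemma Alt2.cr_swap_pairs (hq : Alt2 q) (a b c d : α) : cr q c d a b = cr q a b c d := by
  simp only [cr, hq.comm c a, hq.comm d b, hq.comm c b, hq.comm d a]; ring

lemma Alt2.cr_swap_mid (hq : Alt2 q) (had : q a d ≠ 0) (hbc : q b c ≠ 0) :
    cr q a c b d = 1 + cr q a b c d := by
  simp only [cr, hq.comm c b]
  field_simp
  linear_combination hq.three a b c d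

lemma Ok.swap_pairs (hq : Alt2 q) (hq' : Alt2 q') (h : Ok f q q' a b c d) : Ok f q q' c d a b := by
  unfold Ok at *; rw [hq.cr_swap_pairs, h, hq'.cr_swap_pairs]

lemma Ok.swap_mid (hf : CrMap f) (hq : Alt2 q) (hq' : Alt2 q') (had : q a d ≠ 0) (hbc : q b c ≠ 0)
    (had' : q' a d ≠ 0) (hbc' : q' b c ≠ 0) (h : Ok f q q' a b c d) : Ok f q q' a c b d := by
  unfold Ok at *
  rw [hq.cr_swap_mid had hbc, hf.map_one_add, h, hq'.cr_swap_mid had' hbc']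

lemma U24.swap_left (hq : Alt2 q) (h : U24 q a b c d) : U24 q b a c d :=
  ⟨hq.comm a b ▸ h.ab, h.bc, h.bd, h.ac, h.ad, h.cd⟩

lemma U24.swap_right (hq : Alt2 q) (h : U24 q a b c d) : U24 q a b d c :=
  ⟨h.ab, h.ad, h.ac, h.bd, h.bc, hq.comm c d ▸ h.cd⟩

lemma U24.swap_mid (hq : Alt2 q) (h : U24 q a b c d) : U24 q a c b d :=
  ⟨h.ac, h.ab, h.ad, hq.comm b c ▸ h.bc, h.cd, h.bd⟩

lemma U24.swap_pairs (hq : Alt2 q) (h : U24 q a b c d) : U24 q c d a b :=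
  ⟨h.cd, hq.comm a c ▸ h.ac, hq.comm b c ▸ h.bc, hq.comm a d ▸ h.ad, hq.comm b d ▸ h.bd, h.ab⟩

lemma U24.of_supp (hs : ∀ a b, q' a b = 0 ↔ q a b = 0) (h : U24 q a b c d) : U24 q' a b c d :=
  ⟨mt (hs _ _).1 h.ab, mt (hs _ _).1 h.ac, mt (hs _ _).1 h.ad, mt (hs _ _).1 h.bc,
    mt (hs _ _).1 h.bd, mt (hs _ _).1 h.cd⟩

lemma Alt2.cr_eq_one (hq : Alt2 q) (h : q a b * q c d = 0) (had : q a d ≠ 0) (hbc : q b c ≠ 0)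
    (h2 : (2 : F) = 0) : cr q a b c d = 1 := by
  have := hq.three a b c d
  simp only [cr]; field_simp
  linear_combination h - this - (q a d * q b c) * h2

/-- A cross ratio is as prescribed unless the four points are pairwise independent. -/
lemma ok_of_u24 [CharP F 2] [CharP K 2] (hf : CrMap f) (hq : Alt2 q) (hq' : Alt2 q')
    (hs : ∀ a b, q' a b = 0 ↔ q a b = 0) (h : U24 q a b c d → Ok f q q' a b c d) :
    Ok f q q' a b c d := by
  by_cases h1 : q a c = 0
  · simp [Ok, cr, h1, (hs _ _).2 h1, hf.map_zero]
  by_cases h2 : q a d = 0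
  · simp [Ok, cr, h2, (hs _ _).2 h2, hf.map_zero]
  by_cases h3 : q b c = 0
  · simp [Ok, cr, h3, (hs _ _).2 h3, hf.map_zero]
  by_cases h4 : q b d = 0
  · simp [Ok, cr, h4, (hs _ _).2 h4, hf.map_zero]
  by_cases h5 : q a b * q c d = 0
  · have h5' : q' a b * q' c d = 0 := by simpa [mul_eq_zero, hs] using h5
    unfold Ok
    rw [hq.cr_eq_one h5 h2 h3 CharTwo.two_eq_zero, hf.map_one, hq'.cr_eq_one h5'
      (mt (hs _ _).1 h2) (mt (hs _ _).1 h3) CharTwo.two_eq_zero]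
  · exact h ⟨left_ne_zero_of_mul h5, h1, h2, h3, h4, right_ne_zero_of_mul h5⟩

/-- Parallel points have proportional coordinates. -/
lemma Alt2.parallel (hq : Alt2 q) (h2 : (2 : F) = 0) {y z : α} (h : q y z = 0) (a b : α) :
    q a y * q b z = q a z * q b y := by
  have := hq.three a b y z
  rw [h] at this
  linear_combination -this - (q a z * q b y) * h2

lemma Alt2.cr_parallel (hq : Alt2 q) (h2 : (2 : F) = 0) {y : α} (h : q d y = 0) (had : q a d ≠ 0)
    (hay : q a y ≠ 0) : cr q a b c d = cr q a b c y := by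
  have h1 := hq.parallel h2 h a b
  simp only [cr]
  by_cases hbc : q b c = 0
  · simp [hbc]
  · rw [div_eq_div_iff (mul_ne_zero had hbc) (mul_ne_zero hay hbc)]
    linear_combination -(q a c * q b c) * h1

end Algebra

section Plucker

variable {α F K : Type*} [DecidableEq α] [Field F] [Field K]

/-- The form of rank two obtained by contracting `J`. -/
def pr (χ : Finset α → F) (J : Finset α) (a b : α) : F := χ (insert a (insert b J))

/-- The form of rank three obtained by contracting `L`. -/
def tr (χ : Finset α → F) (L : Finset α) (a b c : α) : F := χ (insert a (insert b (insert c L)))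

/-- Plücker coordinates in characteristic two: `χ` is supported on `r`-element subsets of `E` and
satisfies the three-term relations. -/
structure IsPlucker (E : Finset α) (r : ℕ) (χ : Finset α → F) : Prop where
  card : ∀ I, χ I ≠ 0 → I.card = r
  sub : ∀ I, χ I ≠ 0 → I ⊆ E
  three : ∀ J, J.card + 2 = r → ∀ a b c d,
    pr χ J a b * pr χ J c d = pr χ J a c * pr χ J b d + pr χ J a d * pr χ J b c

/-- Steinitz exchange: an element of the base `I` can be replaced by one of `X`. -/
def Exch (χ : Finset α → F) : Prop :=
  ∀ I X, χ I ≠ 0 → χ X ≠ 0 → ∀ a ∈ I, a ∉ X → ∃ x ∈ X, x ∉ I ∧ χ (insert x (I.erase a)) ≠ 0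

/-- The deletion of `e`. -/
def del (e : α) (χ : Finset α → F) (I : Finset α) : F := if e ∈ I then 0 else χ I

/-- The dual (without signs, which is harmless in characteristic two). -/
def dual (E : Finset α) (χ : Finset α → F) (I : Finset α) : F := if I ⊆ E then χ (E \ I) else 0

/-- Rescaling of the columns. -/
def gauge (c : K) (t : α → K) (ψ : Finset α → K) (I : Finset α) : K := c * (∏ i ∈ I, t i) * ψ I

/-- `ψ` has the same support as `χ`, and its cross ratios are the images of those of `χ`. -/
structure Lift (f : F → K) (r : ℕ) (χ : Finset α → F) (ψ : Finset α → K) : Prop where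
  supp : ∀ I, ψ I = 0 ↔ χ I = 0
  ok : ∀ J, J.card + 2 = r → ∀ a b c d, Ok f (pr χ J) (pr ψ J) a b c d

variable {E : Finset α} {r : ℕ} {χ : Finset α → F} {ψ : Finset α → K} {f : F → K}
  {J L : Finset α} {a b c d e : α}

lemma pr_comm (χ : Finset α → F) (J : Finset α) (a b : α) : pr χ J a b = pr χ J b a := by
  simp [pr, Finset.insert_comm]

lemma pr_ne (hc : ∀ I, χ I ≠ 0 → I.card = r) (hJ : J.card + 2 = r) (h : pr χ J a b ≠ 0) :
    a ≠ b ∧ a ∉ J ∧ b ∉ J := by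
  have h1 := hc _ h
  have h2 := Finset.card_insert_le b J
  refine ⟨?_, ?_, ?_⟩
  · rintro rfl
    rw [Finset.insert_idem] at h1; omega
  · intro h
    rw [Finset.insert_eq_of_mem (Finset.mem_insert_of_mem h)] at h1; omega
  · intro h
    have := Finset.card_insert_le a (insert b J)
    rw [Finset.insert_eq_of_mem h] at *; omega

lemma pr_self (hc : ∀ I, χ I ≠ 0 → I.card = r) (hJ : J.card + 2 = r) : pr χ J a a = 0 := by
  by_contra h
  exact (pr_ne hc hJ h).1 rfl

lemma IsPlucker.alt2 (h : IsPlucker E r χ) (hJ : J.card + 2 = r) : Alt2 (pr χ J) :=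
  ⟨pr_comm χ J, fun _ => pr_self h.card hJ, h.three J hJ⟩

lemma tr_eq_pr (χ : Finset α → F) (L : Finset α) (a : α) : tr χ L a = pr χ (insert a L) := by
  funext b c
  simp only [tr, pr]; congr 1; ext; simp; tauto

lemma tr_comm (χ : Finset α → F) (L : Finset α) (a b c : α) : tr χ L a b c = tr χ L b a c := by
  simp only [tr]; congr 1; ext; simp; tauto

lemma tr_of_mem (hc : ∀ I, χ I ≠ 0 → I.card = r) (hL : L.card + 3 = r) (h : a ∈ L) :
    tr χ L a = fun _ _ => 0 := by
  funext b c
  by_contra h0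
  have h1 := hc _ h0
  rw [Finset.insert_eq_of_mem (by simp [h])] at h1
  have := Finset.card_insert_le b (insert c L)
  have := Finset.card_insert_le c L
  omega

lemma IsPlucker.alt3 (h : IsPlucker E r χ) (hL : L.card + 3 = r) : Alt3 (tr χ L) := by
  refine ⟨fun z => ?_, tr_comm χ L⟩
  by_cases hz : z ∈ L
  · rw [tr_of_mem h.card hL hz]
    exact ⟨by simp, by simp, by simp⟩
  · rw [tr_eq_pr]
    exact h.alt2 (by rw [Finset.card_insert_of_notMem hz]; omega)

/-- It suffices to check the three-term relations for distinct elements. -/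
lemma IsPlucker.of_distinct [CharP F 2] (hc : ∀ I, χ I ≠ 0 → I.card = r)
    (hs : ∀ I, χ I ≠ 0 → I ⊆ E)
    (h : ∀ J a b c d, J.card + 2 = r → a ∉ J → b ∉ J → c ∉ J → d ∉ J → a ≠ b → a ≠ c → a ≠ d →
      b ≠ c → b ≠ d → c ≠ d →
      pr χ J a b * pr χ J c d = pr χ J a c * pr χ J b d + pr χ J a d * pr χ J b c) :
    IsPlucker E r χ := by
  refine ⟨hc, hs, fun J hJ a b c d => ?_⟩
  have hself : ∀ a, pr χ J a a = 0 := fun a => pr_self hc hJ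
  have h1 : ∀ a b, a ∈ J → pr χ J a b = 0 := fun a b ha => by
    by_contra h0; exact (pr_ne hc hJ h0).2.1 ha
  have h2 : ∀ a b, b ∈ J → pr χ J a b = 0 := fun a b ha => by
    by_contra h0; exact (pr_ne hc hJ h0).2.2 ha
  have h22 : (2 : F) = 0 := CharTwo.two_eq_zero
  have hcm := pr_comm χ J
  by_cases ha : a ∈ J
  · simp [h1 a _ ha]
  by_cases hb : b ∈ J
  · simp [h1 b _ hb, h2 _ b hb]
  by_cases hcJ : c ∈ J
  · simp [h1 c _ hcJ, h2 _ c hcJ]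
  by_cases hd : d ∈ J
  · simp [h2 _ d hd]
  rcases eq_or_ne a b with rfl | hab
  · rw [hself]; linear_combination -(pr χ J a c * pr χ J a d) * h22
  rcases eq_or_ne a c with rfl | hac
  · rw [hself, hcm b a]; ring
  rcases eq_or_ne a d with rfl | had
  · rw [hself, hcm c a, hcm b a]; ring
  rcases eq_or_ne b c with rfl | hbc
  · rw [hself]; ring
  rcases eq_or_ne b d with rfl | hbd
  · rw [hself, hcm c b]; ring
  rcases eq_or_ne c d with rfl | hcd
  · rw [hself]; linear_combination -(pr χ J a c * pr χ J b c) * h22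
  exact h J a b c d hJ ha hb hcJ hd hab hac had hbc hbd hcd

lemma Alt2.of_ok {q : α → α → F} {q' : α → α → K} [CharP F 2] (hq : Alt2 q)
    (hf : CrMap f) (hcm : ∀ a b, q' a b = q' b a) (hself : ∀ a, q' a a = 0)
    (hs : ∀ a b, q' a b = 0 ↔ q a b = 0) (h : ∀ a b c d, Ok f q q' a b c d) : Alt2 q' := by
  refine ⟨hcm, hself, fun a b c d => ?_⟩
  by_cases h0 : q a d * q b c = 0
  · have h0' : q' a d * q' b c = 0 := by simpa [mul_eq_zero, hs] using h0
    have h1 := hq.three a b c d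
    rw [h0'] 
    rw [h0] at h1
    by_cases h2 : q a c * q b d = 0
    · have h2' : q' a c * q' b d = 0 := by simpa [mul_eq_zero, hs] using h2
      have h3 : q a b * q c d = 0 := by rw [h1, h2, add_zero]
      have h3' : q' a b * q' c d = 0 := by simpa [mul_eq_zero, hs] using h3
      rw [h2', h3', add_zero]
    · have h4 := h a d b c
      have h2' : q' a c * q' b d ≠ 0 := by simpa [mul_eq_zero, hs] using h2
      have h5 : cr q a d b c = 1 := by
        simp only [cr]; rw [hq.comm d c, hq.comm d b, h1, add_zero, div_self h2]
      rw [Ok, h5, hf.map_one] at h4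
      simp only [cr] at h4
      rw [hcm d c, hcm d b, eq_div_iff h2'] at h4
      linear_combination -h4
  · have h0' : q' a d * q' b c ≠ 0 := by simpa [mul_eq_zero, hs] using h0
    have h1 := h a b c d
    have h2 := h a c b d
    have had : q a d ≠ 0 := left_ne_zero_of_mul h0
    have hbc : q b c ≠ 0 := right_ne_zero_of_mul h0
    rw [Ok, hq.cr_swap_mid had hbc, hf.map_one_add, h1] at h2
    simp only [cr] at h2
    rw [hcm c b] at h2
    rw [eq_div_iff h0', add_mul, div_mul_cancel₀ _ h0', one_mul] at h2
    linear_combination -h2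

lemma Lift.isPlucker [CharP F 2] (hf : CrMap f) (hχ : IsPlucker E r χ) (h : Lift f r χ ψ) :
    IsPlucker E r ψ := by
  have hc : ∀ I, ψ I ≠ 0 → I.card = r := fun I hI => hχ.card I (mt (h.supp I).2 hI)
  refine ⟨hc, fun I hI => hχ.sub I (mt (h.supp I).2 hI), fun J hJ => ?_⟩
  exact ((hχ.alt2 hJ).of_ok hf (pr_comm ψ J) (fun _ => pr_self hc hJ) (fun _ _ => h.supp _)
    (h.ok J hJ)).three

lemma pr_del_of_mem (h : e ∈ J) (a b : α) : pr (del e χ) J a b = 0 := by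
  simp [pr, del, h]

lemma pr_del (he : e ∉ J) (ha : a ≠ e) (hb : b ≠ e) : pr (del e χ) J a b = pr χ J a b := by
  simp [pr, del, he, ha.symm, hb.symm]

lemma pr_del_left (b : α) : pr (del e χ) J e b = 0 := by
  simp [pr, del]

lemma pr_del_right (b : α) : pr (del e χ) J b e = 0 := by
  simp [pr, del]

lemma IsPlucker.del (h : IsPlucker E r χ) (e : α) : IsPlucker (E.erase e) r (del e χ) := by
  have h0 : ∀ I, CrossRatioLift.del e χ I ≠ 0 → e ∉ I ∧ χ I ≠ 0 := fun I hI => by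
    simp only [CrossRatioLift.del] at hI
    split_ifs at hI with h1
    · simp at hI
    · exact ⟨h1, hI⟩
  refine ⟨fun I hI => h.card I (h0 I hI).2, fun I hI => ?_, fun J hJ a b c d => ?_⟩
  · exact Finset.subset_erase.2 ⟨h.sub I (h0 I hI).2, (h0 I hI).1⟩
  by_cases he : e ∈ J
  · simp [pr_del_of_mem he]
  rcases eq_or_ne a e with rfl | ha
  · simp [pr_del_left]
  rcases eq_or_ne b e with rfl | hb
  · simp [pr_del_left, pr_del_right]
  rcases eq_or_ne c e with rfl | hc
  · simp [pr_del_left, pr_del_right]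
  rcases eq_or_ne d e with rfl | hd
  · simp [pr_del_right]
  simp only [pr_del he, ha, hb, hc, hd, ne_eq, not_false_eq_true]
  exact h.three J hJ a b c d

lemma Lift.del (h : Lift f r χ ψ) (hf : CrMap f) (e : α) :
    Lift f r (del e χ) (del e ψ) := by
  refine ⟨fun I => ?_, fun J hJ a b c d => ?_⟩
  · simp only [CrossRatioLift.del]; split_ifs <;> simp [h.supp]
  unfold Ok
  by_cases he : e ∈ J
  · simp [cr, pr_del_of_mem he, hf.map_zero]
  rcases eq_or_ne a e with rfl | ha
  · simp [cr, pr_del_left, hf.map_zero]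
  rcases eq_or_ne b e with rfl | hb
  · simp [cr, pr_del_left, hf.map_zero]
  rcases eq_or_ne c e with rfl | hc
  · simp [cr, pr_del_right, hf.map_zero]
  rcases eq_or_ne d e with rfl | hd
  · simp [cr, pr_del_right, hf.map_zero]
  have := h.ok J hJ a b c d
  simpa only [Ok, cr, pr_del he, ha, hb, hc, hd, ne_eq, not_false_eq_true] using this

lemma pr_gauge (hc : ∀ I, ψ I ≠ 0 → I.card = r) (hJ : J.card + 2 = r) (k : K) (t : α → K)
    (a b : α) : pr (gauge k t ψ) J a b = (k * ∏ i ∈ J, t i) * t a * t b * pr ψ J a b := by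
  by_cases h : pr ψ J a b = 0
  · rw [h, mul_zero]; simp only [pr, gauge] at *; rw [h, mul_zero]
  · obtain ⟨h1, h2, h3⟩ := pr_ne hc hJ h
    simp only [pr, gauge]
    rw [Finset.prod_insert (by simp [h1, h2]), Finset.prod_insert h3]; ring

lemma gauge_eq_zero {k : K} (hk : k ≠ 0) {t : α → K} (ht : ∀ i, t i ≠ 0) {I : Finset α} :
    gauge k t ψ I = 0 ↔ ψ I = 0 := by
  simp [gauge, hk, Finset.prod_eq_zero_iff, ht]

lemma cr_scale (q q' : α → α → K) (k : K) (hk : k ≠ 0) (t : α → K) (ht : ∀ i, t i ≠ 0)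
    (h : ∀ a b, q' a b = k * t a * t b * q a b) (a b c d : α) : cr q' a b c d = cr q a b c d := by
  have := ht a; have := ht b; have := ht c; have := ht d
  simp only [cr, h]
  by_cases h1 : q a d = 0
  · simp [h1]
  by_cases h2 : q b c = 0
  · simp [h2]
  field_simp

lemma Lift.gauge (h : Lift f r χ ψ) (hχ : IsPlucker E r χ) {k : K} (hk : k ≠ 0) {t : α → K}
    (ht : ∀ i, t i ≠ 0) : Lift f r χ (gauge k t ψ) := by
  refine ⟨fun I => (gauge_eq_zero hk ht).trans (h.supp I), fun J hJ a b c d => ?_⟩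
  have := pr_gauge (fun I hI => hχ.card I (mt (h.supp I).2 hI)) hJ k t
  unfold Ok
  rw [cr_scale (pr ψ J) _ _ (mul_ne_zero hk (Finset.prod_ne_zero_iff.2 fun i _ => ht i)) t ht this]
  exact h.ok J hJ a b c d

lemma dual_ne {I : Finset α} (h : dual E χ I ≠ 0) : I ⊆ E ∧ χ (E \ I) ≠ 0 := by
  unfold dual at h
  split_ifs at h with h1
  · exact ⟨h1, h⟩
  · simp at h

lemma dual_dual (hs : ∀ I, χ I ≠ 0 → I ⊆ E) : dual E (dual E χ) = χ := by
  funext I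
  by_cases h : I ⊆ E
  · simp [dual, h]
  · rw [dual, if_neg h]
    by_contra h0
    exact h (hs I (Ne.symm h0))

/-- Complementary pairs. -/
lemma pr_dual (χ : Finset α → F) {T : Finset α} (hJ : J ⊆ E) (ha : a ∈ E) (hb : b ∈ E) (hc : c ∈ E)
    (hd : d ∈ E) (haJ : a ∉ J) (hbJ : b ∉ J) (hac : a ≠ c) (had : a ≠ d) (hbc : b ≠ c) (hbd : b ≠ d)
    (hT : T = E \ insert a (insert b (insert c (insert d J)))) :
    pr (dual E χ) J c d = pr χ T a b := by
  have h1 : insert c (insert d J) ⊆ E := by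
    simp [Finset.insert_subset_iff, *]
  simp only [pr, dual, if_pos h1, hT]
  congr 1
  ext x
  simp only [Finset.mem_sdiff, Finset.mem_insert]
  by_cases h2 : x = a
  · subst h2; simp [*]
  by_cases h3 : x = b
  · subst h3; simp [*]
  simp [*]

/-- All complementary pairs of a quadruple. -/
lemma pr_dual_all (χ : Finset α → F) {T : Finset α} (hJ : J ⊆ E) (ha : a ∈ E) (hb : b ∈ E)
    (hc : c ∈ E) (hd : d ∈ E) (haJ : a ∉ J) (hbJ : b ∉ J) (hcJ : c ∉ J) (hdJ : d ∉ J)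
    (hab : a ≠ b) (hac : a ≠ c) (had : a ≠ d) (hbc : b ≠ c) (hbd : b ≠ d) (hcd : c ≠ d)
    (hT : T = E \ insert a (insert b (insert c (insert d J)))) :
    pr (dual E χ) J a b = pr χ T c d ∧ pr (dual E χ) J c d = pr χ T a b ∧
    pr (dual E χ) J a c = pr χ T b d ∧ pr (dual E χ) J b d = pr χ T a c ∧
    pr (dual E χ) J a d = pr χ T b c ∧ pr (dual E χ) J b c = pr χ T a d := by
  subst hT
  refine ⟨pr_dual χ hJ hc hd ha hb hcJ hdJ ?_ ?_ ?_ ?_ ?_,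
    pr_dual χ hJ ha hb hc hd haJ hbJ ?_ ?_ ?_ ?_ ?_,
    pr_dual χ hJ hb hd ha hc hbJ hdJ ?_ ?_ ?_ ?_ ?_,
    pr_dual χ hJ ha hc hb hd haJ hcJ ?_ ?_ ?_ ?_ ?_,
    pr_dual χ hJ hb hc ha hd hbJ hcJ ?_ ?_ ?_ ?_ ?_,
    pr_dual χ hJ ha hd hb hc haJ hdJ ?_ ?_ ?_ ?_ ?_⟩
  all_goals first
    | assumption
    | (apply Ne.symm; assumption)
    | rfl
    | (congr 1; ext; simp only [Finset.mem_insert]; tauto)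

lemma card_sdiff_four (hJ : insert a (insert b (insert c (insert d J))) ⊆ E)
    (hr : r ≤ E.card) (hcard : J.card + 2 = E.card - r)
    (ha : a ∉ J) (hb : b ∉ J) (hcJ : c ∉ J) (hd : d ∉ J)
    (hab : a ≠ b) (hac : a ≠ c) (had : a ≠ d) (hbc : b ≠ c) (hbd : b ≠ d) (hcd : c ≠ d) :
    (E \ insert a (insert b (insert c (insert d J)))).card + 2 = r := by
  have h := Finset.card_le_card hJ
  rw [Finset.card_sdiff_of_subset hJ]
  rw [Finset.card_insert_of_notMem (by simp [*]), Finset.card_insert_of_notMem (by simp [*]),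
    Finset.card_insert_of_notMem (by simp [*]), Finset.card_insert_of_notMem (by simp [*])] at *
  omega

lemma IsPlucker.dual_card (h : IsPlucker E r χ) (I : Finset α) (hI : dual E χ I ≠ 0) :
    I.card = E.card - r := by
  obtain ⟨h1, h2⟩ := dual_ne hI
  have := h.card _ h2
  rw [Finset.card_sdiff_of_subset h1] at this
  have := Finset.card_le_card h1
  omega

lemma subset_of_pr_dual (h1 : pr (dual E χ) J a b ≠ 0) (h2 : pr (dual E χ) J c d ≠ 0) :
    J ⊆ E ∧ a ∈ E ∧ b ∈ E ∧ c ∈ E ∧ d ∈ E := by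
  have h1 := (dual_ne h1).1
  have h2 := (dual_ne h2).1
  simp only [Finset.insert_subset_iff] at h1 h2
  tauto

lemma IsPlucker.dual [CharP F 2] (h : IsPlucker E r χ) (hr : r ≤ E.card) :
    IsPlucker E (E.card - r) (dual E χ) := by
  refine .of_distinct h.dual_card (fun I hI => (dual_ne hI).1) ?_
  intro J a b c d hJ ha hb hc hd hab hac had hbc hbd hcd
  by_cases hsub : J ⊆ E ∧ a ∈ E ∧ b ∈ E ∧ c ∈ E ∧ d ∈ E
  · obtain ⟨hs, haE, hbE, hcE, hdE⟩ := hsub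
    have hcard := card_sdiff_four (by simp [Finset.insert_subset_iff, *]) hr hJ ha hb hc hd hab hac
      had hbc hbd hcd
    have key := h.three _ hcard a b c d
    obtain ⟨e1, e2, e3, e4, e5, e6⟩ := pr_dual_all χ hs haE hbE hcE hdE ha hb hc hd hab hac had hbc
      hbd hcd rfl
    rw [e1, e2, e3, e4, e5, e6]
    linear_combination key
  · have hz : ∀ x y z w, (J ⊆ E ∧ x ∈ E ∧ y ∈ E ∧ z ∈ E ∧ w ∈ E → False) →
        pr (CrossRatioLift.dual E χ) J x y * pr (CrossRatioLift.dual E χ) J z w = 0 := by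
      intro x y z w hxy
      by_contra h0
      exact hxy (subset_of_pr_dual (left_ne_zero_of_mul h0) (right_ne_zero_of_mul h0))
    rw [hz a b c d (by tauto), hz a c b d (by tauto), hz a d b c (by tauto), add_zero]

/-- A lift may be checked on quadruples of pairwise independent elements. -/
lemma Lift.of_u24 [CharP F 2] [CharP K 2] (hf : CrMap f) (hχ : IsPlucker E r χ)
    (hψ : IsPlucker E r ψ) (hs : ∀ I, ψ I = 0 ↔ χ I = 0)
    (h : ∀ J, J.card + 2 = r → ∀ a b c d, U24 (pr χ J) a b c d → Ok f (pr χ J) (pr ψ J) a b c d) :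
    Lift f r χ ψ :=
  ⟨hs, fun J hJ a b c d => ok_of_u24 hf (hχ.alt2 hJ) (hψ.alt2 hJ) (fun _ _ => hs _) (h J hJ a b c d)⟩

lemma Lift.dual [CharP F 2] [CharP K 2] (hf : CrMap f) (hχ : IsPlucker E r χ) (hr : r ≤ E.card)
    (h : Lift f r χ ψ) : Lift f (E.card - r) (dual E χ) (dual E ψ) := by
  have hs : ∀ I, CrossRatioLift.dual E ψ I = 0 ↔ CrossRatioLift.dual E χ I = 0 := fun I => by
    simp only [CrossRatioLift.dual]; split_ifs <;> simp [h.supp]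
  refine .of_u24 hf (hχ.dual hr) ((h.isPlucker hf hχ).dual hr) hs fun J hJ a b c d hu => ?_
  obtain ⟨hab, ha, hb⟩ := pr_ne hχ.dual_card hJ hu.ab
  obtain ⟨hcd, hc, hd⟩ := pr_ne hχ.dual_card hJ hu.cd
  have hac := (pr_ne hχ.dual_card hJ hu.ac).1
  have had := (pr_ne hχ.dual_card hJ hu.ad).1
  have hbc := (pr_ne hχ.dual_card hJ hu.bc).1
  have hbd := (pr_ne hχ.dual_card hJ hu.bd).1
  obtain ⟨hs, haE, hbE, hcE, hdE⟩ := subset_of_pr_dual hu.ab hu.cd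
  have hcard := card_sdiff_four (by simp [Finset.insert_subset_iff, *]) hr hJ ha hb hc hd hab hac
    had hbc hbd hcd
  have key := h.ok _ hcard a b c d
  obtain ⟨-, -, e3, e4, e5, e6⟩ := pr_dual_all χ hs haE hbE hcE hdE ha hb hc hd hab hac had hbc
    hbd hcd rfl
  obtain ⟨-, -, e3', e4', e5', e6'⟩ := pr_dual_all ψ hs haE hbE hcE hdE ha hb hc hd hab hac had hbc
    hbd hcd rfl
  simp only [Ok, cr] at key ⊢
  rw [e3, e4, e5, e6, e3', e4', e5', e6', mul_comm, mul_comm (pr χ _ b c), key, mul_comm,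
    mul_comm (pr ψ _ b c)]

end Plucker

section Ternary

variable {α F K : Type*} [DecidableEq α] [Field F] [Field K]

/-- With respect to every base `X`, the support of `χ` is described by the subdeterminants of a
ternary matrix. -/
def Ternary (E : Finset α) (χ : Finset α → F) : Prop :=
  ∀ X, χ X ≠ 0 → ∃ N : α → α → ZMod 3, ∀ (k : ℕ) (x y : Fin k → α), Function.Injective x →
    Function.Injective y → (∀ i, x i ∈ X) → (∀ i, y i ∈ E ∧ y i ∉ X) →
    (χ ((X \ Finset.univ.image x) ∪ Finset.univ.image y) ≠ 0 ↔
      (Matrix.of fun i j => N (x i) (y j)).det ≠ 0)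

variable {E : Finset α} {r : ℕ} {χ : Finset α → F} {ψ : Finset α → K}
  {J L X : Finset α}

lemma Ternary.del (h : Ternary E χ) (e : α) : Ternary (E.erase e) (del e χ) := by
  intro X hX
  have hX' : e ∉ X ∧ χ X ≠ 0 := by
    simp only [CrossRatioLift.del] at hX
    split_ifs at hX with h1
    · simp at hX
    · exact ⟨h1, hX⟩
  obtain ⟨N, hN⟩ := h X hX'.2
  refine ⟨N, fun k x y h1 h2 h3 h4 => ?_⟩
  rw [← hN k x y h1 h2 h3 fun i => ⟨Finset.mem_of_mem_erase (h4 i).1, (h4 i).2⟩,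
    CrossRatioLift.del, if_neg]
  simp only [Finset.mem_union, Finset.mem_sdiff, hX'.1, false_and, Finset.mem_image,
    Finset.mem_univ, true_and, false_or, not_exists]
  rintro i rfl
  exact Finset.notMem_erase _ _ (h4 i).1

lemma Ternary.dual (h : Ternary E χ) : Ternary E (dual E χ) := by
  intro X hX
  obtain ⟨hXE, hX'⟩ := dual_ne hX
  obtain ⟨N, hN⟩ := h _ hX'
  refine ⟨fun a b => N b a, fun k x y h1 h2 h3 h4 => ?_⟩
  rw [← Matrix.det_transpose]
  have := hN k y x h2 h1 (fun i => Finset.mem_sdiff.2 (h4 i))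
    (fun i => ⟨hXE (h3 i), fun h => (Finset.mem_sdiff.1 h).2 (h3 i)⟩)
  have e1 : (Matrix.of fun i j => N (y j) (x i)).transpose = Matrix.of fun i j => N (y i) (x j) := by
    ext; rfl
  rw [e1, ← this, CrossRatioLift.dual, if_pos]
  · congr! 2
    ext z
    simp only [Finset.mem_sdiff, Finset.mem_union, Finset.mem_image, Finset.mem_univ, true_and]
    constructor
    · rintro ⟨hz, h5⟩
      by_cases hzx : ∃ i, x i = z
      · exact .inr hzx
      · refine .inl ⟨⟨hz, fun hzX => h5 (.inl ⟨hzX, hzx⟩)⟩, fun hzy => h5 (.inr hzy)⟩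
    · rintro (⟨⟨hz, hzX⟩, hzy⟩ | ⟨i, rfl⟩)
      · exact ⟨hz, fun h => h.elim (fun h => hzX h.1) hzy⟩
      · refine ⟨hXE (h3 i), fun h => ?_⟩
        rcases h with ⟨-, h⟩ | ⟨j, hj⟩
        · exact h ⟨i, rfl⟩
        · exact (h4 j).2 (hj ▸ h3 i)
  · intro z hz
    simp only [Finset.mem_sdiff, Finset.mem_union, Finset.mem_image, Finset.mem_univ,
      true_and] at hz
    rcases hz with ⟨hz, -⟩ | ⟨i, rfl⟩
    · exact hXE hz
    · exact (h4 i).1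

/-- Ternary data at a base: the entries and the small subdeterminants. -/
lemma Ternary.exists_matrix (h : Ternary E χ) (hX : χ X ≠ 0) : ∃ N : α → α → ZMod 3,
    (∀ x y, x ∈ X → y ∈ E → y ∉ X → (χ (insert y (X.erase x)) ≠ 0 ↔ N x y ≠ 0)) ∧
    (∀ x₁ x₂ y₁ y₂, x₁ ∈ X → x₂ ∈ X → x₁ ≠ x₂ → y₁ ∈ E → y₁ ∉ X → y₂ ∈ E → y₂ ∉ X → y₁ ≠ y₂ →
      (χ (insert y₁ (insert y₂ ((X.erase x₁).erase x₂))) ≠ 0 ↔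
        N x₁ y₁ * N x₂ y₂ - N x₁ y₂ * N x₂ y₁ ≠ 0)) ∧
    (∀ x₁ x₂ x₃ y₁ y₂ y₃, x₁ ∈ X → x₂ ∈ X → x₃ ∈ X → x₁ ≠ x₂ → x₁ ≠ x₃ → x₂ ≠ x₃ →
      y₁ ∈ E → y₁ ∉ X → y₂ ∈ E → y₂ ∉ X → y₃ ∈ E → y₃ ∉ X → y₁ ≠ y₂ → y₁ ≠ y₃ → y₂ ≠ y₃ →
      (χ (insert y₁ (insert y₂ (insert y₃ (((X.erase x₁).erase x₂).erase x₃)))) ≠ 0 ↔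
        (Matrix.of ![![N x₁ y₁, N x₁ y₂, N x₁ y₃], ![N x₂ y₁, N x₂ y₂, N x₂ y₃],
          ![N x₃ y₁, N x₃ y₂, N x₃ y₃]]).det ≠ 0)) := by
  obtain ⟨N, hN⟩ := h X hX
  refine ⟨N, ?_, ?_, ?_⟩
  · intro x y hx hy hy'
    have := hN 1 ![x] ![y] (Function.injective_of_subsingleton _)
      (Function.injective_of_subsingleton _) (by simp [hx]) (by simp [hy, hy'])
    simp only [Matrix.det_unique, Matrix.of_apply] at this
    rw [show insert y (X.erase x) = (X \ Finset.univ.image ![x]) ∪ Finset.univ.image ![y] by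
      ext; simp; tauto]
    simpa using this
  · intro x₁ x₂ y₁ y₂ hx₁ hx₂ hx hy₁ hy₁' hy₂ hy₂' hy
    have := hN 2 ![x₁, x₂] ![y₁, y₂] (by simp [Function.Injective, Fin.forall_fin_two, hx, hx.symm])
      (by simp [Function.Injective, Fin.forall_fin_two, hy, hy.symm])
      (by simp [Fin.forall_fin_two, *]) (by simp [Fin.forall_fin_two, *])
    simp only [Matrix.det_fin_two, Matrix.of_apply] at this
    rw [show insert y₁ (insert y₂ ((X.erase x₁).erase x₂)) =
      (X \ Finset.univ.image ![x₁, x₂]) ∪ Finset.univ.image ![y₁, y₂] by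
        ext; simp [Fin.exists_fin_two]; grind]
    simpa using this
  · intro x₁ x₂ x₃ y₁ y₂ y₃ hx₁ hx₂ hx₃ h12 h13 h23 hy₁ hy₁' hy₂ hy₂' hy₃ hy₃' g12 g13 g23
    have := hN 3 ![x₁, x₂, x₃] ![y₁, y₂, y₃]
      (by intro i j; fin_cases i <;> fin_cases j <;>
            simp [h12, h12.symm, h13, h13.symm, h23, h23.symm])
      (by intro i j; fin_cases i <;> fin_cases j <;>
            simp [g12, g12.symm, g13, g13.symm, g23, g23.symm])
      (by intro i; fin_cases i <;> simpa) (by intro i; fin_cases i <;> simp [*])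
    rw [show insert y₁ (insert y₂ (insert y₃ (((X.erase x₁).erase x₂).erase x₃))) =
      (X \ Finset.univ.image ![x₁, x₂, x₃]) ∪ Finset.univ.image ![y₁, y₂, y₃] by
        ext; simp [Fin.exists_fin_succ]; grind]
    rw [this]
    congr! 2
    ext i j
    fin_cases i <;> fin_cases j <;> rfl

/-- Two bases, enumerated along their differences. -/
lemma Ternary.exists_entry (h : Ternary E χ) (hχ : IsPlucker E r χ) {I : Finset α} (hI : χ I ≠ 0)
    (hX : χ X ≠ 0) : ∃ N : α → α → ZMod 3,
    (∀ x y, x ∈ I → y ∈ E → y ∉ I → (χ (insert y (I.erase x)) ≠ 0 ↔ N x y ≠ 0)) ∧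
    (∀ a ∈ I \ X, ∃ x ∈ X \ I, N a x ≠ 0) ∧ (∀ x ∈ X \ I, ∃ a ∈ I \ X, N a x ≠ 0) := by
  obtain ⟨N, hN⟩ := h I hI
  refine ⟨N, ?_, ?_⟩
  · intro x y hx hy hy'
    have := hN 1 ![x] ![y] (Function.injective_of_subsingleton _)
      (Function.injective_of_subsingleton _) (by simp [hx]) (by simp [hy, hy'])
    simp only [Matrix.det_unique, Matrix.of_apply] at this
    rw [show insert y (I.erase x) = (I \ Finset.univ.image ![x]) ∪ Finset.univ.image ![y] by
      ext; simp; tauto]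
    simpa using this
  have hc : (I \ X).card = (X \ I).card := by
    have h1 := Finset.card_sdiff_add_card_inter I X
    have h2 := Finset.card_sdiff_add_card_inter X I
    rw [Finset.inter_comm, hχ.card _ hX] at h2
    rw [hχ.card _ hI] at h1
    omega
  let x : Fin (I \ X).card → α := fun i => ((I \ X).equivFin.symm i : α)
  let y : Fin (I \ X).card → α := fun i => ((X \ I).equivFinOfCardEq hc.symm).symm i
  have hx : ∀ i, x i ∈ I \ X := fun i => ((I \ X).equivFin.symm i).2
  have hy : ∀ i, y i ∈ X \ I := fun i => (((X \ I).equivFinOfCardEq hc.symm).symm i).2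
  have hxs : ∀ a ∈ I \ X, ∃ i, x i = a := fun a ha => ⟨(I \ X).equivFin ⟨a, ha⟩, by simp [x]⟩
  have hys : ∀ a ∈ X \ I, ∃ i, y i = a := fun a ha =>
    ⟨((X \ I).equivFinOfCardEq hc.symm) ⟨a, ha⟩, by simp [y]⟩
  have key := hN _ x y (Subtype.val_injective.comp (Equiv.injective _))
    (Subtype.val_injective.comp (Equiv.injective _)) (fun i => (Finset.mem_sdiff.1 (hx i)).1)
    (fun i => ⟨hχ.sub _ hX (Finset.mem_sdiff.1 (hy i)).1, (Finset.mem_sdiff.1 (hy i)).2⟩)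
  have e : (I \ Finset.univ.image x) ∪ Finset.univ.image y = X := by
    have e1 : Finset.univ.image x = I \ X := by
      ext a; simp only [Finset.mem_image, Finset.mem_univ, true_and]
      exact ⟨fun ⟨i, hi⟩ => hi ▸ hx i, hxs a⟩
    have e2 : Finset.univ.image y = X \ I := by
      ext a; simp only [Finset.mem_image, Finset.mem_univ, true_and]
      exact ⟨fun ⟨i, hi⟩ => hi ▸ hy i, hys a⟩
    rw [e1, e2]; ext; simp; tauto
  rw [e] at key
  have hdet := key.1 hX
  constructor
  · intro a ha
    obtain ⟨i, rfl⟩ := hxs a ha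
    by_contra! h0
    exact hdet (Matrix.det_eq_zero_of_row_eq_zero i fun j => h0 _ (hy j))
  · intro a ha
    obtain ⟨i, rfl⟩ := hys a ha
    by_contra! h0
    exact hdet (Matrix.det_eq_zero_of_column_eq_zero i fun j => h0 _ (hx j))

lemma Ternary.exch (h : Ternary E χ) (hχ : IsPlucker E r χ) : Exch χ := by
  intro I X hI hX a ha haX
  obtain ⟨N, h1, h2, -⟩ := h.exists_entry hχ hI hX
  obtain ⟨x, hx, hN⟩ := h2 a (Finset.mem_sdiff.2 ⟨ha, haX⟩)
  rw [Finset.mem_sdiff] at hx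
  exact ⟨x, hx.1, hx.2, (h1 a x ha (hχ.sub _ hX hx.1) hx.2).2 hN⟩

lemma zmod_three_cases : ∀ x : ZMod 3, x ≠ 0 → x = 1 ∨ x = -1 := by decide

/-- There is no `U(2,5)`-minor. -/
lemma Ternary.pr_eq_zero (h : Ternary E χ) (hχ : IsPlucker E r χ) (hJ : J.card + 2 = r)
    (a b c d e : α) (h1 : pr χ J a b ≠ 0) (h2 : pr χ J a c ≠ 0) (h3 : pr χ J a d ≠ 0)
    (h4 : pr χ J a e ≠ 0) (h5 : pr χ J b c ≠ 0) (h6 : pr χ J b d ≠ 0) (h7 : pr χ J b e ≠ 0)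
    (h8 : pr χ J c d ≠ 0) (h9 : pr χ J c e ≠ 0) (h10 : pr χ J d e ≠ 0) : False := by
  obtain ⟨hab, ha, hb⟩ := pr_ne hχ.card hJ h1
  obtain ⟨hac, -, hc⟩ := pr_ne hχ.card hJ h2
  obtain ⟨had, -, hd⟩ := pr_ne hχ.card hJ h3
  obtain ⟨hae, -, he⟩ := pr_ne hχ.card hJ h4
  have hbc := (pr_ne hχ.card hJ h5).1
  have hbd := (pr_ne hχ.card hJ h6).1
  have hbe := (pr_ne hχ.card hJ h7).1
  have hcd := (pr_ne hχ.card hJ h8).1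
  have hce := (pr_ne hχ.card hJ h9).1
  have hde := (pr_ne hχ.card hJ h10).1
  obtain ⟨N, hN1, hN2, -⟩ := h.exists_matrix h1
  have hcE := hχ.sub _ h2 (show c ∈ _ by simp)
  have hdE := hχ.sub _ h3 (show d ∈ _ by simp)
  have heE := hχ.sub _ h4 (show e ∈ _ by simp)
  have ea : (insert a (insert b J)).erase a = insert b J :=
    Finset.erase_insert (by simp [hab, ha])
  have eb : (insert a (insert b J)).erase b = insert a J := by
    rw [Finset.insert_comm, Finset.erase_insert (by simp [hab.symm, hb])]
  have eab : ((insert a (insert b J)).erase a).erase b = J := by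
    rw [ea, Finset.erase_insert hb]
  have c1 := (hN1 a c (by simp) hcE (by simp [*, Ne.symm])).1
  have d1 := (hN1 a d (by simp) hdE (by simp [*, Ne.symm])).1
  have e1 := (hN1 a e (by simp) heE (by simp [*, Ne.symm])).1
  have c2 := (hN1 b c (by simp) hcE (by simp [*, Ne.symm])).1
  have d2 := (hN1 b d (by simp) hdE (by simp [*, Ne.symm])).1
  have e2 := (hN1 b e (by simp) heE (by simp [*, Ne.symm])).1
  have cd := (hN2 a b c d (by simp) (by simp) hab hcE (by simp [*, Ne.symm]) hdE
    (by simp [*, Ne.symm]) hcd).1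
  have ce := (hN2 a b c e (by simp) (by simp) hab hcE (by simp [*, Ne.symm]) heE
    (by simp [*, Ne.symm]) hce).1
  have de := (hN2 a b d e (by simp) (by simp) hab hdE (by simp [*, Ne.symm]) heE
    (by simp [*, Ne.symm]) hde).1
  rw [eab] at cd ce de
  rw [ea] at c1 d1 e1
  rw [eb] at c2 d2 e2
  rw [pr_comm] at h2 h3 h4 h5 h6 h7
  replace c1 := zmod_three_cases _ (c1 h5)
  replace d1 := zmod_three_cases _ (d1 h6)
  replace e1 := zmod_three_cases _ (e1 h7)
  replace c2 := zmod_three_cases _ (c2 h2)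
  replace d2 := zmod_three_cases _ (d2 h3)
  replace e2 := zmod_three_cases _ (e2 h4)
  replace cd := cd h8
  replace ce := ce h9
  replace de := de h10
  generalize N a c = p1 at *
  generalize N a d = p2 at *
  generalize N a e = p3 at *
  generalize N b c = q1 at *
  generalize N b d = q2 at *
  generalize N b e = q3 at *
  clear hN1 hN2
  rcases c1 with rfl | rfl <;> rcases d1 with rfl | rfl <;> rcases e1 with rfl | rfl <;>
    rcases c2 with rfl | rfl <;> rcases d2 with rfl | rfl <;> rcases e2 with rfl | rfl <;>
    simp_all

end Ternary

section TernaryThree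

variable {α F K : Type*} [DecidableEq α] [Field F] [Field K]
variable {E : Finset α} {r : ℕ} {χ : Finset α → F} {L X : Finset α} {a b c : α}

lemma tr_ne (hc : ∀ I, χ I ≠ 0 → I.card = r) (hL : L.card + 3 = r) (h : tr χ L a b c ≠ 0) :
    a ≠ b ∧ a ≠ c ∧ b ≠ c ∧ a ∉ L ∧ b ∉ L ∧ c ∉ L := by
  have ha : a ∉ L := fun ha => h (by rw [tr_of_mem hc hL ha])
  have h' := h
  rw [tr_eq_pr] at h'
  have := pr_ne hc (by rw [Finset.card_insert_of_notMem ha]; omega) h'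
  simp only [Finset.mem_insert, not_or] at this
  obtain ⟨h1, ⟨h2, h3⟩, h4, h5⟩ := this
  exact ⟨Ne.symm h2, Ne.symm h4, h1, ha, h3, h5⟩

/-- Ternary data at three elements of a base. -/
lemma Ternary.exists_matrix_three (h : Ternary E χ) (hχ : IsPlucker E r χ) (hL : L.card + 3 = r)
    (habc : tr χ L a b c ≠ 0) : ∃ A B C : α → ZMod 3,
    (∀ y ∈ E, y ∉ insert a (insert b (insert c L)) →
      (tr χ L y b c ≠ 0 ↔ A y ≠ 0) ∧ (tr χ L a y c ≠ 0 ↔ B y ≠ 0) ∧ (tr χ L a b y ≠ 0 ↔ C y ≠ 0) ∧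
      ∀ z ∈ E, z ∉ insert a (insert b (insert c L)) → y ≠ z →
      (tr χ L y z c ≠ 0 ↔ A y * B z - A z * B y ≠ 0) ∧
      (tr χ L y b z ≠ 0 ↔ A y * C z - A z * C y ≠ 0) ∧
      (tr χ L a y z ≠ 0 ↔ B y * C z - B z * C y ≠ 0) ∧
      ∀ w ∈ E, w ∉ insert a (insert b (insert c L)) → y ≠ w → z ≠ w →
      (tr χ L y z w ≠ 0 ↔ (Matrix.of ![![A y, A z, A w], ![B y, B z, B w],
          ![C y, C z, C w]]).det ≠ 0)) := by
  obtain ⟨hab, hac, hbc, ha, hb, hc⟩ := tr_ne hχ.card hL habc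
  obtain ⟨N, h1, h2, h3⟩ := h.exists_matrix (X := insert a (insert b (insert c L))) habc
  have ea : (insert a (insert b (insert c L))).erase a = insert b (insert c L) :=
    Finset.erase_insert (by simp [hab, hac, ha])
  have eb : (insert a (insert b (insert c L))).erase b = insert a (insert c L) := by
    rw [Finset.insert_comm, Finset.erase_insert (by simp [hab.symm, hbc, hb])]
  have ec : (insert a (insert b (insert c L))).erase c = insert a (insert b L) := by
    rw [Finset.insert_comm b, Finset.insert_comm a,
      Finset.erase_insert (by simp [hac.symm, hbc.symm, hc])]
  have eab : (insert b (insert c L)).erase b = insert c L :=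
    Finset.erase_insert (by simp [hbc, hb])
  have eac : (insert b (insert c L)).erase c = insert b L := by
    rw [Finset.insert_comm, Finset.erase_insert (by simp [hbc.symm, hc])]
  have ebc : (insert a (insert c L)).erase c = insert a L := by
    rw [Finset.insert_comm, Finset.erase_insert (by simp [hac.symm, hc])]
  have eabc : (insert c L).erase c = L := Finset.erase_insert hc
  refine ⟨N a, N b, N c, fun y hy hy' => ⟨?_, ?_, ?_, fun z hz hz' hyz => ⟨?_, ?_, ?_,
    fun w hw hw' hyw hzw => ?_⟩⟩⟩
  · rw [← h1 a y (by simp) hy hy', ea]; rfl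
  · rw [← h1 b y (by simp) hy hy', eb, tr, Finset.insert_comm]
  · rw [← h1 c y (by simp) hy hy', ec, tr]
    rw [Finset.insert_comm y, Finset.insert_comm y]
  · rw [← h2 a b y z (by simp) (by simp) hab hy hy' hz hz' hyz, ea, eab]; rfl
  · rw [← h2 a c y z (by simp) (by simp) hac hy hy' hz hz' hyz, ea, eac, tr, Finset.insert_comm b]
  · rw [← h2 b c y z (by simp) (by simp) hbc hy hy' hz hz' hyz, eb, ebc, tr, Finset.insert_comm a,
      Finset.insert_comm a]
  · rw [← h3 a b c y z w (by simp) (by simp) (by simp) hab hac hbc hy hy' hz hz' hw hw' hyz hyw hzw,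
      ea, eab, eabc]; rfl

/-- There is no `U(3,5)`-minor. -/
lemma Ternary.tr_eq_zero (h : Ternary E χ) (hχ : IsPlucker E r χ) (hL : L.card + 3 = r)
    (a b c d e : α) (habc : tr χ L a b c ≠ 0) (habd : tr χ L a b d ≠ 0) (habe : tr χ L a b e ≠ 0)
    (hacd : tr χ L a d c ≠ 0) (hace : tr χ L a e c ≠ 0) (hade : tr χ L a d e ≠ 0)
    (hbcd : tr χ L d b c ≠ 0) (hbce : tr χ L e b c ≠ 0) (hbde : tr χ L d b e ≠ 0)
    (hcde : tr χ L d e c ≠ 0) : False := by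
  obtain ⟨A, B, C, hN⟩ := h.exists_matrix_three hχ hL habc
  obtain ⟨hab, hac, hbc, ha, hb, hc⟩ := tr_ne hχ.card hL habc
  obtain ⟨-, had, hbd, -, -, hd⟩ := tr_ne hχ.card hL habd
  obtain ⟨-, hae, hbe, -, -, he⟩ := tr_ne hχ.card hL habe
  obtain ⟨hde, hdc, hec, -, -, -⟩ := tr_ne hχ.card hL hcde
  have hdE := hχ.sub _ hbcd (show d ∈ _ by simp)
  have heE := hχ.sub _ hbce (show e ∈ _ by simp)
  have hd' : d ∉ insert a (insert b (insert c L)) := by simp [*, Ne.symm]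
  have he' : e ∉ insert a (insert b (insert c L)) := by simp [*, Ne.symm]
  obtain ⟨d1, d2, d3, hde2⟩ := hN d hdE hd'
  obtain ⟨e1, e2, e3, -⟩ := hN e heE he'
  obtain ⟨de1, de2, de3, -⟩ := hde2 e heE he' hde
  replace d1 := zmod_three_cases _ (d1.1 hbcd)
  replace d2 := zmod_three_cases _ (d2.1 hacd)
  replace d3 := zmod_three_cases _ (d3.1 habd)
  replace e1 := zmod_three_cases _ (e1.1 hbce)
  replace e2 := zmod_three_cases _ (e2.1 hace)
  replace e3 := zmod_three_cases _ (e3.1 habe)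
  replace de1 := de1.1 hcde
  replace de2 := de2.1 hbde
  replace de3 := de3.1 hade
  clear hde2 hN
  generalize A d = p1 at *
  generalize B d = p2 at *
  generalize C d = p3 at *
  generalize A e = q1 at *
  generalize B e = q2 at *
  generalize C e = q3 at *
  rcases d1 with rfl | rfl <;> rcases d2 with rfl | rfl <;> rcases d3 with rfl | rfl <;>
    rcases e1 with rfl | rfl <;> rcases e2 with rfl | rfl <;> rcases e3 with rfl | rfl <;>
    simp_all

/-- The configuration distinguishing characteristic three from characteristic two. -/
lemma Ternary.not_fano (h : Ternary E χ) (hχ : IsPlucker E r χ) (hL : L.card + 3 = r)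
    {p q e f : α} (habc : tr χ L a b c ≠ 0)
    (p1 : tr χ L p b c ≠ 0) (p2 : tr χ L a p c ≠ 0) (p3 : tr χ L a b p = 0)
    (q1 : tr χ L q b c = 0) (q2 : tr χ L a q c ≠ 0) (q3 : tr χ L a b q ≠ 0)
    (e1 : tr χ L e b c ≠ 0) (e2 : tr χ L a e c ≠ 0) (e3 : tr χ L a b e ≠ 0)
    (f1 : tr χ L f b c ≠ 0) (f2 : tr χ L a f c = 0) (f3 : tr χ L a b f ≠ 0)
    (pe : tr χ L p e c = 0) (qe : tr χ L a q e = 0) :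
    ¬ (tr χ L e b f = 0 ↔ tr χ L p q f = 0) := by
  obtain ⟨A, B, C, hN⟩ := h.exists_matrix_three hχ hL habc
  obtain ⟨hab, hac, hbc, ha, hb, hc⟩ := tr_ne hχ.card hL habc
  obtain ⟨hpb, hpc, -, hp, -, -⟩ := tr_ne hχ.card hL p1
  obtain ⟨hap, -, -, -, -, -⟩ := tr_ne hχ.card hL p2
  obtain ⟨haq, -, hqc, -, hq, -⟩ := tr_ne hχ.card hL q2
  obtain ⟨-, -, hbq, -, -, -⟩ := tr_ne hχ.card hL q3
  obtain ⟨heb, hec, -, he, -, -⟩ := tr_ne hχ.card hL e1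
  obtain ⟨hae, -, -, -, -, -⟩ := tr_ne hχ.card hL e2
  obtain ⟨hfb, hfc, -, hf, -, -⟩ := tr_ne hχ.card hL f1
  obtain ⟨-, haf, -, -, -, -⟩ := tr_ne hχ.card hL f3
  have hpE := hχ.sub _ p1 (show p ∈ _ by simp)
  have hqE := hχ.sub _ q3 (show q ∈ _ by simp)
  have heE := hχ.sub _ e1 (show e ∈ _ by simp)
  have hfE := hχ.sub _ f1 (show f ∈ _ by simp)
  have hpq : p ≠ q := by rintro rfl; exact p1 q1
  have hpe' : p ≠ e := by rintro rfl; exact e3 p3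
  have hpf : p ≠ f := by rintro rfl; exact p2 f2
  have hqe' : q ≠ e := by rintro rfl; exact e1 q1
  have hqf : q ≠ f := by rintro rfl; exact q2 f2
  have hef : e ≠ f := by rintro rfl; exact e2 f2
  have hp' : p ∉ insert a (insert b (insert c L)) := by simp [*, Ne.symm]
  have hq' : q ∉ insert a (insert b (insert c L)) := by simp [*, Ne.symm]
  have he' : e ∉ insert a (insert b (insert c L)) := by simp [*, Ne.symm]
  have hf' : f ∉ insert a (insert b (insert c L)) := by simp [*, Ne.symm]
  obtain ⟨Np1, Np2, Np3, Np⟩ := hN p hpE hp'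
  obtain ⟨Nq1, Nq2, Nq3, Nq⟩ := hN q hqE hq'
  obtain ⟨Ne1, Ne2, Ne3, Ne⟩ := hN e heE he'
  obtain ⟨Nf1, Nf2, Nf3, -⟩ := hN f hfE hf'
  have Npe := (Np e heE he' hpe').1
  have Nqe := (Nq e heE he' hqe').2.2.1
  have Nef := (Ne f hfE hf' hef).2.1
  have Npqf := (Np q hqE hq' hpq).2.2.2 f hfE hf' hpf hqf
  have zero : ∀ {u : F} {v : ZMod 3}, (u ≠ 0 ↔ v ≠ 0) → u = 0 → v = 0 := fun h hu => by
    by_contra hv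
    exact h.2 hv hu
  replace Npe := zero Npe pe
  replace Nqe := zero Nqe qe
  replace Np1 := zmod_three_cases _ (Np1.1 p1)
  replace Np2 := zmod_three_cases _ (Np2.1 p2)
  replace Np3 := zero Np3 p3
  replace Nq1 := zero Nq1 q1
  replace Nq2 := zmod_three_cases _ (Nq2.1 q2)
  replace Nq3 := zmod_three_cases _ (Nq3.1 q3)
  replace Nf1 := zmod_three_cases _ (Nf1.1 f1)
  replace Nf2 := zero Nf2 f2
  replace Nf3 := zmod_three_cases _ (Nf3.1 f3)
  replace Ne1 := zmod_three_cases _ (Ne1.1 e1)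
  replace Ne2 := zmod_three_cases _ (Ne2.1 e2)
  replace Ne3 := zmod_three_cases _ (Ne3.1 e3)
  rw [← not_iff_not, ← ne_eq, ← ne_eq, Nef, Npqf, Matrix.det_fin_three]
  simp only [Matrix.of_apply, Matrix.cons_val', Matrix.cons_val_zero, Matrix.cons_val_one,
    Matrix.cons_val, Np3, Nq1, Nf2]
  clear Np Nq Ne hN
  generalize A p = vp1 at *
  generalize B p = vp2 at *
  generalize B q = vq2 at *
  generalize C q = vq3 at *
  generalize A f = vf1 at *
  generalize C f = vf3 at *
  generalize A e = ve1 at *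
  generalize B e = ve2 at *
  generalize C e = ve3 at *
  have hp : vp1 * ve2 = ve1 * vp2 := sub_eq_zero.1 Npe
  have hq : vq2 * ve3 = ve2 * vq3 := sub_eq_zero.1 Nqe
  clear Npe Nqe
  clear * - Np1 Np2 Nq2 Nq3 Nf1 Nf3 Ne1 Ne2 Ne3 hp hq
  have hv : ∀ v : ZMod 3, v = 1 ∨ v = -1 → v * v = 1 := by decide
  have hp' : vp1 = ve1 * vp2 * ve2 := by linear_combination ve2 * hp - vp1 * hv _ Ne2
  have hq' : vq3 = vq2 * ve3 * ve2 := by linear_combination -ve2 * hq - vq3 * hv _ Ne2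
  subst hp' hq'
  rcases Np2 with rfl | rfl <;> rcases Nq2 with rfl | rfl <;> rcases Nf1 with rfl | rfl <;>
    rcases Nf3 with rfl | rfl <;> rcases Ne1 with rfl | rfl <;> rcases Ne2 with rfl | rfl <;>
    rcases Ne3 with rfl | rfl <;> decide

end TernaryThree

section Vectors

variable {α K : Type*} [DecidableEq α] [Field K] {r : ℕ}

/-- The determinant of a family of vectors taken from the configuration `v`. -/
noncomputable def famDet (v : α → Fin r → K) (x : Fin r → α) : K :=
  (Matrix.of fun i j => v (x j) i).det

lemma famDet_update (v : α → Fin r → K) (x : Fin r → α) (i : Fin r) (c : α) :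
    famDet v (Function.update x i c) =
      Matrix.cramer (Matrix.of fun i j => v (x j) i) (v c) i := by
  rw [Matrix.cramer_apply, famDet]
  congr 1
  ext k j
  rcases eq_or_ne j i with rfl | h
  · simp
  · simp [h]

lemma famDet_exchange (v : α → Fin r → K) (x y : Fin r → α) (k : Fin r) (c : α) :
    famDet v x * famDet v (Function.update y k c) =
      ∑ i, famDet v (Function.update x i c) * famDet v (Function.update y k (x i)) := by
  have h := Matrix.mulVec_cramer (Matrix.of fun i j => v (x j) i) (v c)
  simp only [famDet_update]
  have h2 := congrArg (fun w => Matrix.cramer (Matrix.of fun i j => v (y j) i) w k) h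
  simp only [map_smul, Pi.smul_apply, smul_eq_mul] at h2
  rw [famDet, ← h2]
  have h3 : (Matrix.of fun i j => v (x j) i).mulVec
      (Matrix.cramer (Matrix.of fun i j => v (x j) i) (v c)) =
      ∑ i, Matrix.cramer (Matrix.of fun i j => v (x j) i) (v c) i • v (x i) := by
    ext j
    simp [Matrix.mulVec, dotProduct, mul_comm]
  rw [h3, map_sum, Finset.sum_apply]
  simp

lemma famDet_of_not_injective (v : α → Fin r → K) {x : Fin r → α} (h : ¬ Function.Injective x) :
    famDet v x = 0 := by
  simp only [Function.Injective, not_forall] at h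
  obtain ⟨i, j, h1, h2⟩ := h
  exact Matrix.det_zero_of_column_eq h2 (by simp [h1])

open Classical in
/-- The Plücker coordinates of a vector configuration in characteristic two. -/
noncomputable def vdet (v : α → Fin r → K) (I : Finset α) : K :=
  if h : ∃ x : Fin r → α, Function.Injective x ∧ Finset.univ.image x = I then famDet v h.choose
  else 0

lemma famDet_eq [CharP K 2] (v : α → Fin r → K) {x y : Fin r → α} (hx : Function.Injective x)
    (hy : Function.Injective y) (h : Finset.univ.image x = Finset.univ.image y) :
    famDet v x = famDet v y := by
  have hr : Set.range x = Set.range y := by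
    ext a
    have := congrArg (a ∈ ·) h
    simpa using this
  let σ : Equiv.Perm (Fin r) :=
    ((Equiv.ofInjective x hx).trans (Equiv.setCongr hr)).trans (Equiv.ofInjective y hy).symm
  have hσ : ∀ i, y (σ i) = x i := fun i => by
    simp [σ, Equiv.apply_ofInjective_symm]
  have h1 := Matrix.det_permute' σ (Matrix.of fun i j => v (y j) i)
  have h2 : (Matrix.of fun i j => v (y j) i).submatrix id σ = Matrix.of fun i j => v (x j) i := by
    ext i j; simp [hσ]
  rw [famDet, ← h2, h1, famDet]
  rcases Int.units_eq_one_or (Equiv.Perm.sign σ) with h | h <;> simp [h, CharTwo.neg_eq]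

lemma vdet_image [CharP K 2] (v : α → Fin r → K) {x : Fin r → α} (hx : Function.Injective x) :
    vdet v (Finset.univ.image x) = famDet v x := by
  have h : ∃ y : Fin r → α, Function.Injective y ∧ Finset.univ.image y = Finset.univ.image x :=
    ⟨x, hx, rfl⟩
  rw [vdet, dif_pos h]
  exact famDet_eq v h.choose_spec.1 hx h.choose_spec.2

lemma exists_enum (I : Finset α) (h : I.card = r) :
    ∃ x : Fin r → α, Function.Injective x ∧ Finset.univ.image x = I := by
  refine ⟨fun i => (I.equivFinOfCardEq h).symm i, Subtype.val_injective.comp (Equiv.injective _), ?_⟩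
  ext a
  simp only [Finset.mem_image, Finset.mem_univ, true_and]
  exact ⟨fun ⟨i, hi⟩ => hi ▸ ((I.equivFinOfCardEq h).symm i).2,
    fun ha => ⟨I.equivFinOfCardEq h ⟨a, ha⟩, by simp⟩⟩

lemma vdet_card (v : α → Fin r → K) (I : Finset α) (h : vdet v I ≠ 0) : I.card = r := by
  unfold vdet at h
  split_ifs at h with h1
  · obtain ⟨x, hx, rfl⟩ := h1
    rw [Finset.card_image_of_injective _ hx]; simp
  · simp at h

lemma vdet_ne_zero_iff [CharP K 2] (v : α → Fin r → K) (I : Finset α) :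
    vdet v I ≠ 0 ↔ I.card = r ∧ LinearIndependent K (fun i : I => v i) := by
  by_cases hc : I.card = r
  · obtain ⟨x, hx, rfl⟩ := exists_enum I hc
    rw [vdet_image v hx, famDet, ← Matrix.det_transpose, ← isUnit_iff_ne_zero,
      ← Matrix.isUnit_iff_isUnit_det, ← Matrix.linearIndependent_rows_iff_isUnit]
    simp only [hc, true_and]
    let e : Fin r ≃ (Finset.univ.image x : Finset α) := Equiv.ofBijective
      (fun i => ⟨x i, by simp⟩) ⟨fun i j h => hx (by simpa using h), fun ⟨a, ha⟩ => by
        simp only [Finset.mem_image, Finset.mem_univ, true_and] at ha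
        obtain ⟨i, rfl⟩ := ha
        exact ⟨i, rfl⟩⟩
    rw [← linearIndependent_equiv e]
    rfl
  · exact ⟨fun h => (hc (vdet_card v I h)).elim, fun h => (hc h.1).elim⟩

lemma cons_cons_injective_iff {m : ℕ} {j : Fin m → α} (hj : Function.Injective j) {a b : α} :
    Function.Injective (Fin.cons a (Fin.cons b j : Fin (m + 1) → α) : Fin (m + 2) → α) ↔
      a ≠ b ∧ a ∉ Finset.univ.image j ∧ b ∉ Finset.univ.image j := by
  rw [Fin.cons_injective_iff, Fin.cons_injective_iff, Fin.range_cons]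
  simp [hj]
  tauto

lemma vdet_pr [CharP K 2] {m : ℕ} (v : α → Fin (m + 2) → K) {j : Fin m → α}
    (hj : Function.Injective j) (a b : α) :
    pr (vdet v) (Finset.univ.image j) a b =
      famDet v (Fin.cons a (Fin.cons b j : Fin (m + 1) → α) : Fin (m + 2) → α) := by
  by_cases h : a ≠ b ∧ a ∉ Finset.univ.image j ∧ b ∉ Finset.univ.image j
  · rw [← vdet_image v ((cons_cons_injective_iff hj).2 h)]
    simp only [pr]; congr 1
    ext z; simp [Fin.exists_fin_succ, eq_comm]
  · rw [famDet_of_not_injective v (mt (cons_cons_injective_iff hj).1 h)]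
    by_contra h0
    exact h (pr_ne (vdet_card v) (by rw [Finset.card_image_of_injective _ hj]; simp) h0)

lemma vdet_isPlucker [CharP K 2] (v : α → Fin r → K) {E : Finset α} (hE : ∀ a ∉ E, v a = 0) :
    IsPlucker E r (vdet v) := by
  refine ⟨vdet_card v, fun I hI a ha => ?_, fun J hJ a b c d => ?_⟩
  · by_contra haE
    obtain ⟨-, h2⟩ := (vdet_ne_zero_iff v I).1 hI
    exact h2.ne_zero ⟨a, ha⟩ (hE a haE)
  · obtain ⟨m, rfl⟩ : ∃ m, r = m + 2 := ⟨_, hJ.symm⟩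
    obtain ⟨j, hj, rfl⟩ := exists_enum J (Nat.add_right_cancel hJ)
    have h := famDet_exchange v (Fin.cons a (Fin.cons b j : Fin (m + 1) → α) : Fin (m + 2) → α)
      (Fin.cons a (Fin.cons d j : Fin (m + 1) → α) : Fin (m + 2) → α) 0 c
    rw [Fin.sum_univ_succ, Fin.sum_univ_succ] at h
    have hz : ∀ i : Fin m, famDet v (Function.update
        (Fin.cons a (Fin.cons d j : Fin (m + 1) → α) : Fin (m + 2) → α) 0
        ((Fin.cons a (Fin.cons b j : Fin (m + 1) → α) : Fin (m + 2) → α) i.succ.succ)) = 0 := by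
      intro i
      refine famDet_of_not_injective v fun hinj => ?_
      have := @hinj 0 i.succ.succ (by simp)
      exact absurd this (Fin.succ_ne_zero _).symm
    simp only [hz, mul_zero, Finset.sum_const_zero, add_zero] at h
    simp only [Fin.update_cons_zero, Fin.cons_zero, Fin.cons_succ, ← Fin.cons_update,
      ← vdet_pr v hj] at h
    rw [h, pr_comm _ _ c b]; ring

lemma vdet_exch [CharP K 2] (v : α → Fin r → K) : Exch (vdet v) := by
  intro I X hI hX a ha haX
  obtain ⟨x, hx, rfl⟩ := exists_enum X (vdet_card v _ hX)
  obtain ⟨y, hy, rfl⟩ := exists_enum I (vdet_card v _ hI)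
  obtain ⟨k, -, rfl⟩ := Finset.mem_image.1 ha
  have h := famDet_exchange v x y k (y k)
  rw [Function.update_eq_self, ← vdet_image v hx, ← vdet_image v hy] at h
  have h0 : ∑ i, famDet v (Function.update x i (y k)) * famDet v (Function.update y k (x i)) ≠ 0 :=
    h ▸ mul_ne_zero hX hI
  obtain ⟨i, -, hi⟩ := Finset.exists_ne_zero_of_sum_ne_zero h0
  have hi2 := right_ne_zero_of_mul hi
  have hinj : Function.Injective (Function.update y k (x i)) := by
    by_contra hn
    exact hi2 (famDet_of_not_injective v hn)
  have himg : Finset.univ.image (Function.update y k (x i)) =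
      insert (x i) ((Finset.univ.image y).erase (y k)) := by
    ext z
    simp only [Finset.mem_image, Finset.mem_univ, true_and, Finset.mem_insert, Finset.mem_erase]
    constructor
    · rintro ⟨l, rfl⟩
      rcases eq_or_ne l k with rfl | hl
      · simp
      · right; simp [hl, hy.eq_iff]
    · rintro (rfl | ⟨h1, l, rfl⟩)
      · exact ⟨k, by simp⟩
      · exact ⟨l, by rw [Function.update_of_ne]; rintro rfl; exact h1 rfl⟩
  refine ⟨x i, by simp, fun hmem => ?_, ?_⟩
  · obtain ⟨l, -, hl⟩ := Finset.mem_image.1 hmem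
    rcases eq_or_ne l k with rfl | hlk
    · exact haX (by rw [hl]; simp)
    · exact hlk (hinj (by simp [hlk, hl]))
  · rw [← himg, vdet_image v hinj]; exact hi2

/-- Plücker coordinates with prescribed entries at a base. -/
lemma exists_vdet [CharP K 2] {E X : Finset α} (hX : X.card = r) (hXE : X ⊆ E)
    (N : α → α → K) : ∃ v : α → Fin r → K, (∀ a ∉ E, v a = 0) ∧ vdet v X = 1 ∧
      ∀ x ∈ X, ∀ y ∈ E, y ∉ X → vdet v (insert y (X.erase x)) = N x y := by
  classical
  obtain ⟨x, hx, rfl⟩ := exists_enum X hX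
  let v : α → Fin r → K := fun a i =>
    if a ∈ Finset.univ.image x then (if a = x i then 1 else 0) else if a ∈ E then N (x i) a else 0
  have hv1 : (Matrix.of fun i j => v (x j) i) = 1 := by
    ext i j
    simp [v, Matrix.one_apply, hx.eq_iff, eq_comm]
  refine ⟨v, fun a ha => ?_, ?_, ?_⟩
  · funext i
    have : a ∉ Finset.univ.image x := fun h => ha (hXE h)
    simp only [v, if_neg this, if_neg ha, Pi.zero_apply]
  · rw [vdet_image v hx, famDet, hv1, Matrix.det_one]
  · intro z hz y hyE hy
    obtain ⟨k, -, rfl⟩ := Finset.mem_image.1 hz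
    have hinj : Function.Injective (Function.update x k y) := by
      have hy' : ∀ i, x i ≠ y := by simpa using hy
      intro i j hij
      by_cases hi : i = k <;> by_cases hj : j = k
      · rw [hi, hj]
      · subst hi; simp [hj] at hij; exact absurd hij.symm (hy' j)
      · subst hj; simp [hi] at hij; exact absurd hij (hy' i)
      · simp [hi, hj] at hij; exact hx hij
    have himg : Finset.univ.image (Function.update x k y) =
        insert y ((Finset.univ.image x).erase (x k)) := by
      ext z
      simp only [Finset.mem_image, Finset.mem_univ, true_and, Finset.mem_insert, Finset.mem_erase]
      constructor
      · rintro ⟨l, rfl⟩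
        rcases eq_or_ne l k with rfl | hl
        · simp
        · right; simp [hl, hx.eq_iff]
      · rintro (rfl | ⟨h1, l, rfl⟩)
        · exact ⟨k, by simp⟩
        · exact ⟨l, by rw [Function.update_of_ne]; rintro rfl; exact h1 rfl⟩
    rw [← himg, vdet_image v hinj, famDet_update, hv1, Matrix.cramer_one]
    simp only [v, if_neg hy, if_pos hyE, Module.End.one_apply]

end Vectors

section Unique

variable {α K : Type*} [DecidableEq α] [Field K] {E X : Finset α} {r : ℕ} {φ ψ : Finset α → K}

lemma Exch.exists_pair {χ : Finset α → K} (h : Exch χ) {I : Finset α} (hI : χ I ≠ 0) (hX : χ X ≠ 0)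
    {a b : α} (ha : a ∈ I \ X) (hb : b ∈ I \ X) (hab : a ≠ b) : ∃ x ∈ X \ I, ∃ y ∈ X \ I, x ≠ y ∧
      χ (insert x (insert y ((I.erase a).erase b))) ≠ 0 := by
  rw [Finset.mem_sdiff] at ha hb
  obtain ⟨y, hy, hyI, h1⟩ := h I X hI hX a ha.1 ha.2
  have hby : b ≠ y := fun h => hyI (h ▸ hb.1)
  obtain ⟨x, hx, hxI, h2⟩ := h _ X h1 hX b (by simp [hb.1, hab.symm]) hb.2
  have hxy : x ≠ y := by rintro rfl; simp at hxI
  have hxa : x ≠ a := by rintro rfl; exact ha.2 hx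
  refine ⟨x, ?_, y, Finset.mem_sdiff.2 ⟨hy, hyI⟩, hxy, ?_⟩
  · simp only [Finset.mem_insert, Finset.mem_erase, not_or, not_and] at hxI
    exact Finset.mem_sdiff.2 ⟨hx, hxI.2 hxa⟩
  · rwa [Finset.erase_insert_of_ne hby.symm] at h2

/-- Plücker coordinates are determined by a base and its neighbours. -/
lemma IsPlucker.eq_of_entries (hφ : IsPlucker E r φ) (hψ : IsPlucker E r ψ) (eφ : Exch φ)
    (eψ : Exch ψ) (hX : φ X ≠ 0) (h0 : φ X = ψ X)
    (h1 : ∀ x ∈ X, ∀ y ∈ E, y ∉ X → φ (insert y (X.erase x)) = ψ (insert y (X.erase x))) :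
    φ = ψ := by
  have hXr := hφ.card X hX
  have key : ∀ n, ∀ I, (I \ X).card = n → φ I ≠ 0 ∨ ψ I ≠ 0 → φ I = ψ I := by
    intro n
    induction n using Nat.strong_induction_on with
    | _ n ih =>
      intro I hn hI
      have hIr : I.card = r := hI.elim (hφ.card I) (hψ.card I)
      have hIE : I ⊆ E := hI.elim (hφ.sub I) (hψ.sub I)
      have ih' : ∀ I', (I' \ X).card < n → φ I' = ψ I' := fun I' hI' => by
        by_cases h : φ I' ≠ 0 ∨ ψ I' ≠ 0
        · exact ih _ hI' I' rfl h
        · push Not at h; rw [h.1, h.2]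
      have hcard : (X \ I).card = n := by
        have h1 := Finset.card_sdiff_add_card_inter I X
        have h2 := Finset.card_sdiff_add_card_inter X I
        rw [Finset.inter_comm] at h2
        omega
      rcases Nat.lt_or_ge n 2 with hn2 | hn2
      · interval_cases n
        · rw [Finset.card_eq_zero, Finset.sdiff_eq_empty_iff_subset] at hn
          rw [Finset.eq_of_subset_of_card_le hn (by omega), h0]
        · obtain ⟨y, hy⟩ := Finset.card_eq_one.1 hn
          obtain ⟨x, hx⟩ := Finset.card_eq_one.1 hcard
          have hy' : y ∈ I \ X := by simp [hy]
          have hx' : x ∈ X \ I := by simp [hx]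
          rw [Finset.mem_sdiff] at hy' hx'
          have : I = insert y (X.erase x) := by
            ext z
            have h1 := congrArg (z ∈ ·) hy
            have h2 := congrArg (z ∈ ·) hx
            simp only [Finset.mem_sdiff, Finset.mem_singleton, eq_iff_iff] at h1 h2
            simp only [Finset.mem_insert, Finset.mem_erase]
            tauto
          rw [this]
          exact h1 x hx'.1 y (hIE hy'.1) hy'.2
      · obtain ⟨a, ha, b, hb, hab⟩ := Finset.one_lt_card.1 (hn ▸ hn2 : 1 < (I \ X).card)
        have hX' : ψ X ≠ 0 := h0 ▸ hX
        have hpair : ∃ x ∈ X \ I, ∃ y ∈ X \ I, x ≠ y ∧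
            (φ (insert x (insert y ((I.erase a).erase b))) ≠ 0 ∨
              ψ (insert x (insert y ((I.erase a).erase b))) ≠ 0) := by
          rcases hI with hI | hI
          · obtain ⟨x, hx, y, hy, hxy, h⟩ := eφ.exists_pair hI hX ha hb hab
            exact ⟨x, hx, y, hy, hxy, .inl h⟩
          · obtain ⟨x, hx, y, hy, hxy, h⟩ := eψ.exists_pair hI hX' ha hb hab
            exact ⟨x, hx, y, hy, hxy, .inr h⟩
        obtain ⟨x, hx, y, hy, hxy, hne⟩ := hpair
        rw [Finset.mem_sdiff] at ha hb hx hy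
        set J := (I.erase a).erase b with hJ
        have hIJ : I = insert a (insert b J) := by
          ext z; simp only [hJ, Finset.mem_insert, Finset.mem_erase]; grind
        have hJr : J.card + 2 = r := by
          rw [hJ, Finset.card_erase_of_mem (by simp [hb.1, hab.symm]),
            Finset.card_erase_of_mem ha.1]
          have := Finset.card_le_card (Finset.insert_subset ha.1 (Finset.singleton_subset_iff.2 hb.1))
          rw [Finset.card_pair hab] at this
          omega
        have t1 := hφ.three J hJr a b x y
        have t2 := hψ.three J hJr a b x y
        have hJX : J \ X = ((I \ X).erase a).erase b := by
          ext z; simp only [hJ, Finset.mem_sdiff, Finset.mem_erase]; tauto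
        have hJn : (J \ X).card + 2 = n := by
          rw [hJX, Finset.card_erase_of_mem (by simp [hb, hab.symm]),
            Finset.card_erase_of_mem (by simp [ha])]
          omega
        have one : ∀ c d, d ∈ X → pr φ J c d = pr ψ J c d := by
          intro c d hd
          apply ih'
          have : insert c (insert d J) \ X ⊆ insert c (J \ X) := by
            intro z; simp only [Finset.mem_sdiff, Finset.mem_insert]; grind
          have := Finset.card_le_card this
          have := Finset.card_insert_le c (J \ X)
          omega
        have hxy' : pr φ J x y = pr ψ J x y := one x y hy.1
        have hne' : pr φ J x y ≠ 0 := by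
          rcases hne with h | h
          · exact h
          · rw [hxy']; exact h
        rw [one a x hx.1, one b y hy.1, one a y hy.1, one b x hx.1, ← t2, ← hxy'] at t1
        rw [hIJ]
        exact mul_right_cancel₀ hne' t1
  funext I
  by_cases h : φ I ≠ 0 ∨ ψ I ≠ 0
  · exact key _ I rfl h
  · push Not at h; rw [h.1, h.2]

end Unique

section Rows

variable {α F K : Type*} [DecidableEq α] [Field F] [Field K]
  {E X : Finset α} {r : ℕ} {χ : Finset α → F} {x x' x₁ y y₂ e : α}

/-- The entry in row `x` and column `y` with respect to the base `X`. -/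
def ent (χ : Finset α → F) (X : Finset α) (x y : α) : F := χ (insert y (X.erase x))

/-- The fundamental graph of the base `X`. -/
def Edge (χ : Finset α → F) (X : Finset α) (x y : α) : Prop := x ∈ X ∧ y ∉ X ∧ ent χ X x y ≠ 0

/-- The row `x` is joined to the row `x'` by a walk through `n` columns. -/
def RowDist (χ : Finset α → F) (X : Finset α) (x' : α) : ℕ → α → Prop
  | 0, x => x = x'
  | n + 1, x => ∃ y x₁, Edge χ X x y ∧ Edge χ X x₁ y ∧ RowDist χ X x' n x₁

lemma insert_insert_erase_erase (hx : x ∈ X) (hx₁ : x₁ ∈ X) (h : x ≠ x₁) :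
    insert x (insert x₁ ((X.erase x).erase x₁)) = X := by
  rw [Finset.insert_erase (Finset.mem_erase.2 ⟨h.symm, hx₁⟩), Finset.insert_erase hx]

lemma base_eq_pr (χ : Finset α → F) (hx : x ∈ X) (hx₁ : x₁ ∈ X) (h : x ≠ x₁) :
    χ X = pr χ ((X.erase x).erase x₁) x x₁ := by
  rw [pr, insert_insert_erase_erase hx hx₁ h]

lemma ent_eq_pr (χ : Finset α → F) (hx₁ : x₁ ∈ X) (h : x ≠ x₁) (y : α) :
    ent χ X x y = pr χ ((X.erase x).erase x₁) y x₁ := by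
  rw [pr, ent, Finset.insert_erase (Finset.mem_erase.2 ⟨h.symm, hx₁⟩)]

lemma ent_eq_pr' (χ : Finset α → F) (hx : x ∈ X) (h : x ≠ x₁) (y : α) :
    ent χ X x₁ y = pr χ ((X.erase x).erase x₁) y x := by
  rw [Finset.erase_right_comm]
  exact ent_eq_pr χ hx h.symm y

lemma ent_pivot_eq_pr (χ : Finset α → F) (hx : x ≠ y₂) (y : α) :
    ent χ (insert y₂ (X.erase x₁)) x y = pr χ ((X.erase x).erase x₁) y y₂ := by
  rw [pr, ent, Finset.erase_insert_of_ne hx.symm, Finset.erase_right_comm]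

lemma IsPlucker.card_erase_erase (hχ : IsPlucker E r χ) (hX : χ X ≠ 0) (hx : x ∈ X) (hx₁ : x₁ ∈ X)
    (h : x ≠ x₁) : ((X.erase x).erase x₁).card + 2 = r := by
  rw [← hχ.card X hX, ← insert_insert_erase_erase hx hx₁ h, Finset.card_insert_of_notMem,
    Finset.card_insert_of_notMem]
  · simp [insert_insert_erase_erase hx hx₁ h]
  · simp
  · simp [h]

lemma IsPlucker.pivot (hχ : IsPlucker E r χ) (hX : χ X ≠ 0) (hx : x ∈ X) (hx₁ : x₁ ∈ X)
    (h : x ≠ x₁) (hy₂ : y₂ ∉ X) (y : α) :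
    χ X * ent χ (insert y₂ (X.erase x₁)) x y =
      χ (insert y₂ (X.erase x₁)) * ent χ X x y + ent χ X x₁ y * ent χ X x y₂ := by
  have hJ := hχ.card_erase_erase hX hx hx₁ h
  have h1 := hχ.three _ hJ x x₁ y y₂
  have h2 : χ (insert y₂ (X.erase x₁)) = ent χ X x₁ y₂ := rfl
  have hxy : x ≠ y₂ := by rintro rfl; exact hy₂ hx
  rw [h2, ent_pivot_eq_pr χ hxy, ent_eq_pr' χ hx h, ent_eq_pr' χ hx h,
    ent_eq_pr χ hx₁ h, ent_eq_pr χ hx₁ h, base_eq_pr χ hx hx₁ h, h1, pr_comm χ _ x y,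
    pr_comm χ _ x₁ y₂, pr_comm χ _ x y₂, pr_comm χ _ x₁ y]
  ring

lemma IsPlucker.pivot_old (hχ : IsPlucker E r χ) (hX : χ X ≠ 0) (hx : x ∈ X) (hx₁ : x₁ ∈ X)
    (h : x ≠ x₁) (hy₂ : y₂ ∉ X) (h0 : ent χ X x y₂ = 0 ∨ ent χ X x₁ y = 0) :
    χ X * ent χ (insert y₂ (X.erase x₁)) x y = χ (insert y₂ (X.erase x₁)) * ent χ X x y := by
  rw [hχ.pivot hX hx hx₁ h hy₂]
  rcases h0 with h0 | h0 <;> simp [h0]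

lemma IsPlucker.edge_pivot_old (hχ : IsPlucker E r χ) (hX : χ X ≠ 0) (h : x ≠ x₁)
    (h2 : Edge χ X x₁ y₂) (hy : y ≠ y₂) (h0 : ent χ X x y₂ = 0 ∨ ent χ X x₁ y = 0)
    (he : Edge χ X x y) : Edge χ (insert y₂ (X.erase x₁)) x y := by
  obtain ⟨hx, hyX, hne⟩ := he
  obtain ⟨hx₁, hy₂, hne₂⟩ := h2
  refine ⟨by simp [hx, h], by simp [hy, hyX], fun h3 => ?_⟩
  have := hχ.pivot_old hX hx hx₁ h hy₂ h0
  rw [h3, mul_zero] at this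
  exact mul_ne_zero hne₂ hne this.symm

lemma IsPlucker.edge_pivot_new (hχ : IsPlucker E r χ) (hX : χ X ≠ 0) (h : x ≠ x₁)
    (h2 : Edge χ X x₁ y₂) (h0 : ent χ X x y = 0)
    (h3 : Edge χ X x y₂) (h4 : Edge χ X x₁ y) : Edge χ (insert y₂ (X.erase x₁)) x y := by
  have hy : y ≠ y₂ := by rintro rfl; exact h3.2.2 h0
  refine ⟨by simp [h3.1, h], by simp [hy, h4.2.1], fun h5 => ?_⟩
  have := hχ.pivot hX h3.1 h2.1 h h2.2.1 y
  rw [h5, h0, mul_zero, mul_zero, zero_add] at this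
  exact mul_ne_zero h4.2.2 h3.2.2 this.symm

lemma not_edge_iff (hx : x ∈ X) (hy : y ∉ X) : ¬ Edge χ X x y ↔ ent χ X x y = 0 := by
  simp [Edge, hx, hy]

lemma cr_eq_ent (χ : Finset α → F) (hx : x ∈ X) (hx₁ : x₁ ∈ X) (h : x ≠ x₁) (y e : α) :
    cr (pr χ ((X.erase x).erase x₁)) e y x x₁ =
      ent χ X x₁ e * ent χ X x y / (ent χ X x e * ent χ X x₁ y) := by
  rw [ent_eq_pr' χ hx h, ent_eq_pr' χ hx h, ent_eq_pr χ hx₁ h, ent_eq_pr χ hx₁ h, cr]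

/-- Shortening a walk between two rows by a pivot. -/
lemma IsPlucker.exists_pivot (hχ : IsPlucker E r χ) (hX : χ X ≠ 0) {n : ℕ}
    (hD : RowDist χ X x' (n + 2) x) (hmin : ∀ k < n + 2, ¬ RowDist χ X x' k x) :
    ∃ y₁ x₁ y₂ x₂, Edge χ X x y₁ ∧ Edge χ X x₁ y₁ ∧ Edge χ X x₁ y₂ ∧ Edge χ X x₂ y₂ ∧
      RowDist χ X x' n x₂ ∧ ¬ Edge χ X x y₂ ∧ ¬ Edge χ X x₂ y₁ ∧ x₁ ≠ x ∧ x₁ ≠ x' ∧ x₁ ≠ x₂ ∧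
      (0 < n → ¬ Edge χ X x' y₂) ∧
      RowDist χ (insert y₂ (X.erase x₁)) x' (n + 1) x := by
  obtain ⟨y₁, x₁, hxy, hx₁y₁, hD₁⟩ := hD
  obtain ⟨y₂, x₂, hx₁y₂, hx₂y₂, hD₂⟩ := hD₁
  have hmin₁ : ∀ k ≤ n, ¬ RowDist χ X x' k x₁ := fun k hk h =>
    hmin (k + 1) (by omega) ⟨y₁, x₁, hxy, hx₁y₁, h⟩
  have hxy₂ : ¬ Edge χ X x y₂ := fun h => hmin (n + 1) (by omega) ⟨y₂, x₂, h, hx₂y₂, hD₂⟩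
  have hx₂y₁ : ¬ Edge χ X x₂ y₁ := fun h => hmin (n + 1) (by omega) ⟨y₁, x₂, hxy, h, hD₂⟩
  have hx₁x : x₁ ≠ x := by rintro rfl; exact hxy₂ hx₁y₂
  have hx₁x' : x₁ ≠ x' := fun h => hmin₁ 0 (by omega) h
  have hx₁x₂ : x₁ ≠ x₂ := fun h => hmin₁ n le_rfl (h ▸ hD₂)
  have hy : y₁ ≠ y₂ := by rintro rfl; exact hxy₂ hxy
  have persist : ∀ k ≤ n, ∀ v, RowDist χ X x' k v →
      RowDist χ (insert y₂ (X.erase x₁)) x' k v := by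
    intro k
    induction k with
    | zero => exact fun _ v hv => hv
    | succ k ih =>
      rintro hk v ⟨y, v₁, hv, hv₁, hD⟩
      have h1 : ¬ Edge χ X x₁ y := fun h => hmin₁ (k + 1) hk ⟨y, v₁, h, hv₁, hD⟩
      have hvx₁ : v ≠ x₁ := fun h => h1 (h ▸ hv)
      have hv₁x₁ : v₁ ≠ x₁ := fun h => h1 (h ▸ hv₁)
      have hyy₂ : y ≠ y₂ := fun h => h1 (h ▸ hx₁y₂)
      rw [not_edge_iff hx₁y₁.1 hv.2.1] at h1
      exact ⟨y, v₁, hχ.edge_pivot_old hX hvx₁ hx₁y₂ hyy₂ (.inr h1) hv,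
        hχ.edge_pivot_old hX hv₁x₁ hx₁y₂ hyy₂ (.inr h1) hv₁, ih (by omega) _ hD⟩
  refine ⟨y₁, x₁, y₂, x₂, hxy, hx₁y₁, hx₁y₂, hx₂y₂, hD₂, hxy₂, hx₂y₁, hx₁x, hx₁x', hx₁x₂, ?_, ?_⟩
  · exact fun hn h => hmin₁ 1 hn ⟨y₂, x', hx₁y₂, h, rfl⟩
  · exact ⟨y₁, x₂, hχ.edge_pivot_old hX hx₁x.symm hx₁y₂ hy
      (.inl ((not_edge_iff hxy.1 hx₁y₂.2.1).1 hxy₂)) hxy,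
      hχ.edge_pivot_new hX hx₁x₂.symm hx₁y₂ ((not_edge_iff hx₂y₂.1 hxy.2.1).1 hx₂y₁) hx₂y₂ hx₁y₁,
      persist n le_rfl _ hD₂⟩

/-- Connected rows are joined by a walk. -/
lemma exists_rowDist (hx' : x' ∈ X) (hx : x ∈ X) (h : Relation.EqvGen (Edge χ X) x x') :
    ∃ n, RowDist χ X x' n x := by
  have key : ∀ a b, Relation.EqvGen (Edge χ X) a b →
      (((a ∈ X → ∃ n, RowDist χ X x' n a) ∧
        (a ∉ X → ∃ z n, Edge χ X z a ∧ RowDist χ X x' n z)) ↔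
      ((b ∈ X → ∃ n, RowDist χ X x' n b) ∧
        (b ∉ X → ∃ z n, Edge χ X z b ∧ RowDist χ X x' n z))) := by
    intro a b hab
    induction hab with
    | rel a b h =>
      constructor
      · rintro ⟨h1, -⟩
        obtain ⟨n, hn⟩ := h1 h.1
        exact ⟨fun hb => (h.2.1 hb).elim, fun _ => ⟨a, n, h, hn⟩⟩
      · rintro ⟨-, h1⟩
        obtain ⟨z, n, hz, hn⟩ := h1 h.2.1
        exact ⟨fun _ => ⟨n + 1, b, z, h, hz, hn⟩, fun ha => (ha h.1).elim⟩
    | refl => rfl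
    | symm _ _ _ ih => exact ih.symm
    | trans _ _ _ _ _ ih₁ ih₂ => exact ih₁.trans ih₂
  exact (((key x x' h).2 ⟨fun _ => ⟨0, rfl⟩, fun h => (h hx').elim⟩).1 hx)

lemma ent_del (χ : Finset α → F) (he : e ∉ X) (hy : y ≠ e) : ent (del e χ) X x y = ent χ X x y := by
  simp [ent, del, he, hy.symm]

lemma edge_del_iff (he : e ∉ X) : Edge (del e χ) X x y ↔ Edge χ X x y ∧ y ≠ e := by
  rcases eq_or_ne y e with rfl | h
  · simp [Edge, ent, del]
  · simp only [Edge, ent_del χ he h]; tauto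

lemma del_base (he : e ∉ X) : del e χ X = χ X := if_neg he

end Rows

section Unique

variable {α F K : Type*} [DecidableEq α] [Field F] [Field K]
  {E X : Finset α} {r : ℕ} {ψ ψ' : Finset α → K} {x x' e : α}

lemma crMap_id : CrMap (id : F → F) := ⟨rfl, rfl, fun _ => rfl, fun _ => rfl, fun _ h => h⟩

lemma Exch.del (h : Exch ψ) (e : α) : Exch (del e ψ) := by
  have h0 : ∀ I, CrossRatioLift.del e ψ I ≠ 0 → e ∉ I ∧ ψ I ≠ 0 := fun I hI => by
    simp only [CrossRatioLift.del] at hI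
    split_ifs at hI with h1
    · simp at hI
    · exact ⟨h1, hI⟩
  intro I X hI hX a ha haX
  obtain ⟨x, hx, hxI, h1⟩ := h I X (h0 I hI).2 (h0 X hX).2 a ha haX
  have hxe : e ≠ x := by rintro rfl; exact (h0 X hX).1 hx
  refine ⟨x, hx, hxI, ?_⟩
  rwa [del_base]
  simp [hxe, (h0 I hI).1]

lemma Exch.congr {L : Type*} [Field L] {φ : Finset α → L} (h : Exch ψ)
    (hs : ∀ I, φ I = 0 ↔ ψ I = 0) : Exch φ := by
  intro I X hI hX a ha haX
  obtain ⟨x, hx, hxI, h1⟩ := h I X (mt (hs _).2 hI) (mt (hs _).2 hX) a ha haX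
  exact ⟨x, hx, hxI, mt (hs _).1 h1⟩

/-- The ratio of two lifts is constant on connected rows of the column `e`. -/
lemma Lift.row_ratio (hψ : IsPlucker E r ψ) (hψ' : IsPlucker E r ψ') (h : Lift id r ψ ψ')
    (hag : ∀ I, e ∉ I → ψ' I = ψ I) (n : ℕ) : ∀ X x x', e ∉ X → ψ X ≠ 0 →
      RowDist (CrossRatioLift.del e ψ) X x' n x → Edge ψ X x e → Edge ψ X x' e →
      ent ψ' X x e * ent ψ X x' e = ent ψ' X x' e * ent ψ X x e := by
  induction n using Nat.strong_induction_on with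
  | _ n ih =>
  intro X x x' heX hX hD hx hx'
  rcases eq_or_ne x x' with rfl | hxx'
  · ring
  by_cases hmin : ∃ k < n, RowDist (CrossRatioLift.del e ψ) X x' k x
  · obtain ⟨k, hk, hD⟩ := hmin
    exact ih k hk X x x' heX hX hD hx hx'
  push Not at hmin
  match n, hD with
  | 0, hD => exact absurd hD hxx'
  | 1, ⟨y, x₁, hy, hx₁, hx₁x'⟩ =>
    obtain rfl : x₁ = x' := hx₁x'
    rw [edge_del_iff heX] at hy hx₁
    obtain ⟨⟨-, hyX, hy⟩, hye⟩ := hy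
    have hx₁ := hx₁.1.2.2
    have hJ := hψ.card_erase_erase hX hx.1 hx'.1 hxx'
    have hok := h.ok _ hJ e y x x₁
    have hag' : ∀ z ∈ X, ent ψ' X z y = ent ψ X z y := fun z hz =>
      hag _ (by simp [hye.symm, heX])
    have hx2 : ent ψ' X x e ≠ 0 := mt (h.supp _).1 hx.2.2
    have hxe := hx.2.2
    rw [Ok, cr_eq_ent ψ hx.1 hx'.1 hxx', cr_eq_ent ψ' hx.1 hx'.1 hxx', hag' x hx.1,
      hag' x₁ hx'.1, id] at hok
    field_simp at hok
    linear_combination hok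
  | n + 2, hD =>
    obtain ⟨y₁, x₁, y₂, x₂, hxy₁, hx₁y₁, hx₁y₂, hx₂y₂, hD₂, hxy₂, hx₂y₁, hx₁x, hx₁x', -, -, hD'⟩ :=
      (hψ.del e).exists_pivot (by rwa [del_base heX]) hD hmin
    by_cases hx₁ : Edge ψ X x₁ e
    · have h1 := ih 1 (by omega) X x x₁ heX hX ⟨y₁, x₁, hxy₁, hx₁y₁, rfl⟩ hx hx₁
      have h2 := ih (n + 1) (by omega) X x₁ x' heX hX ⟨y₂, x₂, hx₁y₂, hx₂y₂, hD₂⟩ hx₁ hx'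
      apply mul_right_cancel₀ hx₁.2.2
      linear_combination ent ψ X x' e * h1 + ent ψ X x e * h2
    · rw [not_edge_iff hx₁y₁.1 heX] at hx₁
      have hx₁' : ent ψ' X x₁ e = 0 := (h.supp _).2 hx₁
      rw [edge_del_iff heX] at hx₁y₂
      have hX' : ψ' X ≠ 0 := mt (h.supp _).1 hX
      have heX' : e ∉ insert y₂ (X.erase x₁) := by simp [hx₁y₂.2.symm, heX]
      have e1 := hψ.pivot_old hX hx.1 hx₁y₁.1 hx₁x.symm hx₁y₂.1.2.1 (.inr hx₁)
      have e2 := hψ.pivot_old hX hx'.1 hx₁y₁.1 hx₁x'.symm hx₁y₂.1.2.1 (.inr hx₁)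
      have e1' := hψ'.pivot_old hX' hx.1 hx₁y₁.1 hx₁x.symm hx₁y₂.1.2.1 (.inr hx₁')
      have e2' := hψ'.pivot_old hX' hx'.1 hx₁y₁.1 hx₁x'.symm hx₁y₂.1.2.1 (.inr hx₁')
      rw [hag _ heX, hag _ heX'] at e1' e2'
      have key := ih (n + 1) (by omega) (insert y₂ (X.erase x₁)) x x' heX' hx₁y₂.1.2.2 hD'
        (hψ.edge_pivot_old hX hx₁x.symm hx₁y₂.1 hx₁y₂.2.symm (.inr hx₁) hx)
        (hψ.edge_pivot_old hX hx₁x'.symm hx₁y₂.1 hx₁y₂.2.symm (.inr hx₁) hx')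
      have h0 : ψ (insert y₂ (X.erase x₁)) ≠ 0 := hx₁y₂.1.2.2
      apply mul_left_cancel₀ (mul_ne_zero h0 h0)
      linear_combination (ψ X * ψ X) * key -
        ψ (insert y₂ (X.erase x₁)) * ent ψ X x' e * e1' -
        ψ X * ent ψ' (insert y₂ (X.erase x₁)) x e * e2 +
        ψ (insert y₂ (X.erase x₁)) * ent ψ X x e * e2' +
        ψ X * ent ψ' (insert y₂ (X.erase x₁)) x' e * e1

lemma gauge_gauge (k k' : K) (t t' : α → K) :
    gauge k t (gauge k' t' ψ) = gauge (k * k') (fun i => t i * t' i) ψ := by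
  funext I
  simp only [gauge, Finset.prod_mul_distrib]; ring

lemma ent_gauge (k : K) (t : α → K) {x y : α} (hx : x ∈ X) (hy : y ∉ X) :
    t x * ent (gauge k t ψ) X x y = k * (∏ i ∈ X, t i) * t y * ent ψ X x y := by
  rw [ent, gauge, Finset.prod_insert (by simp [hy]), ← Finset.mul_prod_erase X t hx, ent]
  ring

lemma Lift.refl : Lift id r ψ ψ := ⟨fun _ => Iff.rfl, fun _ _ _ _ _ _ => rfl⟩

lemma Exch.gauge (h : Exch ψ) {k : K} (hk : k ≠ 0) {t : α → K} (ht : ∀ i, t i ≠ 0) :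
    Exch (gauge k t ψ) := h.congr fun _ => gauge_eq_zero hk ht

/-- Two lifts which agree away from the column `e` are equivalent. -/
lemma Lift.exists_gauge_of_agree [CharP K 2] (hψ : IsPlucker E r ψ) (eψ : Exch ψ)
    (h : Lift id r ψ ψ') (hag : ∀ I, e ∉ I → ψ' I = ψ I) (he : e ∉ X) (hX : ψ X ≠ 0) :
    ∃ (k : K) (t : α → K), k ≠ 0 ∧ (∀ i, t i ≠ 0) ∧ ψ' = CrossRatioLift.gauge k t ψ := by
  have hψ' := h.isPlucker crMap_id hψ
  have hC : ∃ C : α → K, (∀ v, C v ≠ 0) ∧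
      (∀ u v, Relation.EqvGen (Edge (CrossRatioLift.del e ψ) X) u v → C u = C v) ∧
      ∀ x, Edge ψ X x e → ent ψ' X x e = C x * ent ψ X x e := by
    classical
    let P : α → α → Prop := fun v x =>
      Relation.EqvGen (Edge (CrossRatioLift.del e ψ) X) v x ∧ Edge ψ X x e
    let C : α → K := fun v =>
      if hv : ∃ x, P v x then ent ψ' X hv.choose e / ent ψ X hv.choose e else 1
    have hCx : ∀ v x, P v x → C v = ent ψ' X x e / ent ψ X x e := by
      intro v x hvx
      have hv : ∃ x, P v x := ⟨x, hvx⟩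
      have h1 := hv.choose_spec
      obtain ⟨n, hn⟩ := exists_rowDist hvx.2.1 h1.2.1 (.trans _ _ _ (.symm _ _ h1.1) hvx.1)
      have := h.row_ratio hψ hψ' hag n X _ _ he hX hn h1.2 hvx.2
      have h2 := h1.2.2.2
      have h3 := hvx.2.2.2
      simp only [C, dif_pos hv]
      rw [div_eq_div_iff h2 h3, this]
    refine ⟨C, fun v => ?_, fun u v huv => ?_, fun x hx => ?_⟩
    · by_cases hv : ∃ x, P v x
      · obtain ⟨x, hx⟩ := hv
        rw [hCx v x hx]
        exact div_ne_zero (mt (h.supp _).1 hx.2.2.2) hx.2.2.2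
      · simp [C, dif_neg hv]
    · by_cases hv : ∃ x, P v x
      · obtain ⟨x, hx⟩ := hv
        rw [hCx v x hx, hCx u x ⟨.trans _ _ _ huv hx.1, hx.2⟩]
      · have hu : ¬ ∃ x, P u x :=
          fun ⟨x, hx⟩ => hv ⟨x, .trans _ _ _ (.symm _ _ huv) hx.1, hx.2⟩
        simp [C, dif_neg hv, dif_neg hu]
    · rw [hCx x x ⟨.refl _, hx⟩, div_mul_cancel₀ _ hx.2.2]
  obtain ⟨C, hC0, hC1, hC2⟩ := hC
  set t : α → K := fun v => if v = e then 1 else (C v)⁻¹ with ht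
  have ht0 : ∀ v, t v ≠ 0 := fun v => by simp only [ht]; split_ifs <;> simp [hC0]
  have hP : ∏ i ∈ X, t i ≠ 0 := Finset.prod_ne_zero_iff.2 fun i _ => ht0 i
  refine ⟨(∏ i ∈ X, t i)⁻¹, t, inv_ne_zero hP, ht0, ?_⟩
  refine hψ'.eq_of_entries (Lift.refl.gauge hψ (inv_ne_zero hP) ht0 |>.isPlucker crMap_id hψ)
    (eψ.congr h.supp) (eψ.gauge (inv_ne_zero hP) ht0) (X := X) (mt (h.supp _).1 hX) ?_ ?_
  · rw [hag X he, CrossRatioLift.gauge, inv_mul_cancel₀ hP, one_mul]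
  · intro x hx y _ hyX
    have hxe : x ≠ e := fun h => he (h ▸ hx)
    apply mul_left_cancel₀ (ht0 x)
    have := ent_gauge (ψ := ψ) (∏ i ∈ X, t i)⁻¹ t hx hyX
    rw [inv_mul_cancel₀ hP, one_mul] at this
    change _ = t x * ent (CrossRatioLift.gauge (∏ i ∈ X, t i)⁻¹ t ψ) X x y
    rw [this]
    change t x * ent ψ' X x y = _
    by_cases h0 : ent ψ X x y = 0
    · have h0' : ent ψ' X x y = 0 := (h.supp _).2 h0
      rw [h0, h0', mul_zero, mul_zero]
    by_cases hye : y = e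
    · have h1 := hC2 x ⟨hx, he, hye ▸ h0⟩
      have h2 : t y = 1 := by simp [ht, hye]
      have h3 : t x = (C x)⁻¹ := by simp [ht, hxe]
      rw [h2, h3, hye, h1, inv_mul_cancel_left₀ (hC0 x), one_mul]
    · have h2 : t y = t x := by
        simp only [ht, if_neg hye, if_neg hxe]
        rw [hC1 x y (.rel _ _ ((edge_del_iff he).2 ⟨⟨hx, hyX, h0⟩, hye⟩))]
      rw [h2, ent, hag _ (by simp [Ne.symm hye, he]), ent]

/-- Lifts are unique up to rescaling. -/
theorem Lift.exists_gauge [CharP K 2] (n : ℕ) : ∀ (E : Finset α) (ψ ψ' : Finset α → K),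
    (E \ X).card = n → IsPlucker E r ψ → Exch ψ → Lift id r ψ ψ' → ψ X ≠ 0 →
    ∃ (k : K) (t : α → K), k ≠ 0 ∧ (∀ i, t i ≠ 0) ∧ ψ' = CrossRatioLift.gauge k t ψ := by
  induction n with
  | zero =>
    intro E ψ ψ' hn hψ _ h hX
    have hX' : ψ' X ≠ 0 := mt (h.supp _).1 hX
    refine ⟨ψ' X / ψ X, 1, div_ne_zero hX' hX, by simp, ?_⟩
    funext I
    by_cases hI : ψ I = 0
    · rw [CrossRatioLift.gauge, hI, (h.supp _).2 hI, mul_zero]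
    · have h1 : I ⊆ X := (hψ.sub I hI).trans (Finset.sdiff_eq_empty_iff_subset.1
        (Finset.card_eq_zero.1 hn))
      have h2 := Finset.eq_of_subset_of_card_le h1 (by rw [hψ.card I hI, hψ.card X hX])
      simp [CrossRatioLift.gauge, h2, div_mul_cancel₀ _ hX]
  | succ n ih =>
    intro E ψ ψ' hn hψ eψ h hX
    obtain ⟨e, he⟩ : (E \ X).Nonempty := Finset.card_pos.1 (by omega)
    rw [Finset.mem_sdiff] at he
    obtain ⟨k, t, hk, ht, hkt⟩ := ih (E.erase e) (CrossRatioLift.del e ψ) (CrossRatioLift.del e ψ')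
      (by rw [Finset.erase_sdiff_comm, Finset.card_erase_of_mem (Finset.mem_sdiff.2 he), hn]; rfl)
      (hψ.del e) (eψ.del e) (h.del crMap_id e) (by rwa [del_base he.2])
    have hg := Lift.refl.gauge hψ hk ht
    have h' : Lift id r (CrossRatioLift.gauge k t ψ) ψ' :=
      ⟨fun I => (h.supp I).trans (hg.supp I).symm, fun J hJ a b c d =>
        (hg.ok J hJ a b c d).symm.trans (h.ok J hJ a b c d)⟩
    obtain ⟨k', t', hk', ht', h1⟩ := h'.exists_gauge_of_agree (hg.isPlucker crMap_id hψ)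
      (eψ.gauge hk ht) (e := e) (fun I hI => by
        have := congrFun hkt I
        simpa [CrossRatioLift.del, CrossRatioLift.gauge, hI] using this) he.2
      (mt (hg.supp _).1 hX)
    rw [gauge_gauge] at h1
    exact ⟨k' * k, _, mul_ne_zero hk' hk, fun i => mul_ne_zero (ht' i) (ht i), h1⟩

end Unique

section Alt

variable {K : Type*} {α : Type*} [Field K] {q : α → α → K} {t : α → α → α → K} {a b c d e g p y z : α}

lemma cr_mul_cr (q : α → α → K) (hay : q a y ≠ 0) (hby : q b y ≠ 0) :
    cr q a b c y * cr q a b y d = cr q a b c d := by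
  simp only [cr]
  by_cases h1 : q b c = 0
  · simp [h1]
  by_cases h2 : q a d = 0
  · simp [h2]
  field_simp

lemma Alt3.comm' (ht : Alt3 t) (a b c : α) : t a b c = t a c b := (ht.alt a).comm b c

lemma Alt3.rot (ht : Alt3 t) (a b c : α) : t a b c = t b c a := by
  rw [ht.comm a b c, ht.comm' b a c]

lemma Alt3.minor₁₂ (ht : Alt3 t) (a b c y z : α) :
    t a b c * t y z c = t y b c * t a z c + t z b c * t a y c := by
  have := (ht.alt c).three a b y z
  rw [ht.rot c a b, ht.rot c y z, ht.rot c a y, ht.rot c b z, ht.rot c a z, ht.rot c b y,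
    ht.comm b y c, ht.comm b z c] at this
  rw [this]; ring

lemma Alt3.minor₂₃ (ht : Alt3 t) (a b c y z : α) :
    t a b c * t a y z = t a y c * t a b z + t a z c * t a b y := by
  have := (ht.alt a).three b c y z
  rw [this, ht.comm' a c z, ht.comm' a c y]; ring

lemma Alt3.minor₁₃ (ht : Alt3 t) (a b c y z : α) :
    t a b c * t y b z = t y b c * t a b z + t z b c * t a b y := by
  have := (ht.alt b).three a c y z
  rw [ht.comm b a c, ht.comm b y z, ht.comm b a y, ht.comm b a z, ht.comm' b c z, ht.comm' b c y,
    ht.comm b z c, ht.comm b y c] at this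
  rw [ht.comm a b c, ht.comm b a c, ht.comm y b z, ht.comm b y z, this]; ring

lemma Alt3.cr_pivot (ht : Alt3 t) (habc : t a b c ≠ 0) (p2 : t a p c ≠ 0)
    (p3 : t a b p = 0) (e1 : t e b c ≠ 0) (f1 : t g b c ≠ 0)
    (f2 : t a g c = 0) (f3 : t a b g ≠ 0) (pe : t p e c ≠ 0) :
    cr (t b) a c e g = cr (t p) a c e g * (1 + cr (t c) a b e p) := by
  have h1 := ht.minor₂₃ a b c p e
  have h2 := ht.minor₂₃ a b c p g
  have h3 := ht.minor₁₂ a b c p e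
  have h4 := ht.minor₁₂ a b c p g
  simp only [p3, f2, mul_zero, add_zero, zero_add] at h1 h2 h3 h4
  have h5 : t a p g ≠ 0 := fun h0 => mul_ne_zero p2 f3 (by rw [← h2, h0, mul_zero])
  simp only [cr]
  rw [ht.comm b a e, ht.comm b a g, ← ht.rot g b c, ← ht.rot e b c, ht.comm p a e, ht.comm p a g,
    ht.comm' p c g, ht.comm' p c e, ht.rot c a e, ht.rot c b p, ht.comm b p c, ht.rot c a p,
    ht.rot c b e, ht.comm b e c]
  have h6 := pe
  rw [eq_div_of_mul_eq habc ((mul_comm _ _).trans h3)] at h6 ⊢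
  rw [eq_div_of_mul_eq habc ((mul_comm _ _).trans h1),
    eq_div_of_mul_eq habc ((mul_comm _ _).trans h2),
    eq_div_of_mul_eq habc ((mul_comm _ _).trans h4)]
  have h7 := (div_ne_zero_iff.1 h6).1
  field_simp
  ring

lemma Alt3.cr_trans (ht : Alt3 t) (k1 : t e b c ≠ 0) (k2 : t a e c ≠ 0)
    (k3 : t a b e ≠ 0) (k4 : t g b c ≠ 0) (k5 : t a g c ≠ 0) (k6 : t a b g ≠ 0) :
    cr (t b) a c e g = cr (t c) a b e g * cr (t a) b c e g := by
  simp only [cr]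
  rw [ht.comm b a e, ← ht.rot g b c, ht.comm b a g, ← ht.rot e b c, ht.rot c a e, ht.rot c b g,
    ht.comm b g c, ht.rot c a g, ht.rot c b e, ht.comm b e c, ht.comm' a c g, ht.comm' a c e]
  field_simp

lemma Alt3.fano_iff (ht : Alt3 t) (habc : t a b c ≠ 0) (p2 : t a p c ≠ 0) (p3 : t a b p = 0)
    (q1 : t d b c = 0) (q2 : t a d c ≠ 0) (e2 : t a e c ≠ 0) (f2 : t a g c = 0) (f3 : t a b g ≠ 0)
    (pe : t p e c = 0) (qe : t a d e = 0) : t e b g = 0 ↔ t p d g = 0 := by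
  have h0 := (ht.alt g).three p d a b
  rw [ht.rot g p d, ht.rot g a b, ht.rot g p a, ht.comm p a g, ht.rot g d b, ht.rot g p b,
    ht.rot g d a, ht.comm d a g] at h0
  have h1 := ht.minor₂₃ a b c p g
  have h2 := ht.minor₁₃ a b c d g
  have h3 := ht.minor₁₃ a b c p g
  have h4 := ht.minor₂₃ a b c d g
  have h5 := ht.minor₁₂ a b c p e
  have h6 := ht.minor₂₃ a b c d e
  have h7 := ht.minor₁₃ a b c e g
  simp only [p3, q1, f2, pe, qe, mul_zero, zero_mul, add_zero, zero_add] at h1 h2 h3 h4 h5 h6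
  have h8 : t a b c * t a b c * t a e c * t p d g = - (t a p c * t a d c * t a b c * t e b g) := by
    apply mul_right_cancel₀ f3
    linear_combination t a b c * t a b c * t a e c * h0 + t a e c * t a b c * t d b g * h1 +
      t a e c * t a p c * t a b g * h2 + t a e c * t a b c * t a d g * h3 +
      t a e c * t p b c * t a b g * h4 + t a p c * t a d c * t a b g * h7 -
      t a p c * t g b c * t a b g * h6 - t a d c * t a b g * t a b g * h5
  constructor
  · intro h
    rw [h, mul_zero, neg_zero] at h8
    exact (mul_eq_zero.1 h8).resolve_left (by simp [habc, e2])
  · intro h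
    rw [h, mul_zero, eq_comm, neg_eq_zero] at h8
    exact (mul_eq_zero.1 h8).resolve_left (by simp [habc, p2, q2])

end Alt

section Cand

variable {α F K : Type*} [DecidableEq α] [Field F] [Field K]

/-- `φ` is a lift of `χ` away from `e` and away from `g`. -/
structure Cand (f : F → K) (E : Finset α) (r : ℕ) (χ : Finset α → F) (φ : Finset α → K)
    (e g : α) : Prop where
  hf : CrMap f
  pl : IsPlucker E r χ
  tern : Ternary E χ
  pl' : IsPlucker E r φ
  ne : e ≠ g
  del_left : Lift f r (del e χ) (del e φ)
  del_right : Lift f r (del g χ) (del g φ)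

variable {f : F → K} {E J L X : Finset α} {r : ℕ} {χ : Finset α → F} {φ : Finset α → K}
  {e g a b c d x x' y p q : α}

lemma Cand.symm (h : Cand f E r χ φ e g) : Cand f E r χ φ g e :=
  ⟨h.hf, h.pl, h.tern, h.pl', h.ne.symm, h.del_right, h.del_left⟩

lemma Cand.supp_of_notMem (h : Cand f E r χ φ e g) {I : Finset α} (hI : e ∉ I) :
    φ I = 0 ↔ χ I = 0 := by
  have := h.del_left.supp I
  simpa [del, hI] using this

lemma Cand.supp (h : Cand f E r χ φ e g) {I : Finset α} (hI : e ∉ I ∨ g ∉ I) :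
    φ I = 0 ↔ χ I = 0 :=
  hI.elim h.supp_of_notMem h.symm.supp_of_notMem

lemma Cand.ok_of_notMem (h : Cand f E r χ φ e g) (hJ : J.card + 2 = r) (he : e ∉ J) (ha : a ≠ e)
    (hb : b ≠ e) (hc : c ≠ e) (hd : d ≠ e) : Ok f (pr χ J) (pr φ J) a b c d := by
  have := h.del_left.ok J hJ a b c d
  simpa only [Ok, cr, pr_del he, ha, hb, hc, hd, ne_eq, not_false_eq_true, pr_del] using this

variable [CharP F 2] [CharP K 2]

/-- Two rows with a common third column. -/
lemma Cand.ok_of_common (h : Cand f E r χ φ e g) (hJ : J.card + 2 = r) (he : e ∉ J) (hg : g ∉ J)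
    (hye : y ≠ e) (hyg : y ≠ g) (hxx' : pr χ J x x' ≠ 0) (hxe : pr χ J x e ≠ 0)
    (hxg : pr χ J x g ≠ 0) (hx'e : pr χ J x' e ≠ 0) (hx'g : pr χ J x' g ≠ 0)
    (hxy : pr χ J x y ≠ 0) (hx'y : pr χ J x' y ≠ 0) : Ok f (pr χ J) (pr φ J) x x' e g := by
  have hq := h.pl.alt2 hJ
  have h2 : (2 : F) = 0 := CharTwo.two_eq_zero
  have n1 := pr_ne h.pl.card hJ hxe
  have n2 := pr_ne h.pl.card hJ hxg
  have n3 := pr_ne h.pl.card hJ hx'e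
  have n4 := pr_ne h.pl.card hJ hx'g
  have o1 : Ok f (pr χ J) (pr φ J) x x' e y :=
    h.symm.ok_of_notMem hJ hg n2.1 n4.1 h.ne hyg
  have o2 : Ok f (pr χ J) (pr φ J) x x' y g :=
    h.ok_of_notMem hJ he n1.1 n3.1 hye h.ne.symm
  have hφ : ∀ u, u ≠ e → u ≠ g → pr χ J u y ≠ 0 → pr φ J u y ≠ 0 := fun u hu _ hn =>
    mt (h.supp (.inl (by simp [hu.symm, hye.symm, he]))).1 hn
  have m := cr_mul_cr (c := e) (d := g) (pr χ J) hxy hx'y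
  have m' := cr_mul_cr (c := e) (d := g) (pr φ J) (hφ x n1.1 n2.1 hxy) (hφ x' n3.1 n4.1 hx'y)
  rw [Ok, ← m, ← m', ← o1, ← o2]
  refine h.hf.map_mul ?_ ?_ ?_
  · simp only [cr]; exact div_ne_zero (mul_ne_zero hxe hx'y) (mul_ne_zero hxy hx'e)
  · simp only [cr]; exact div_ne_zero (mul_ne_zero hxy hx'g) (mul_ne_zero hxg hx'y)
  · by_contra! hcon
    have k : ∀ u v, pr χ J x v ≠ 0 → pr χ J x' u ≠ 0 → cr (pr χ J) x x' u v ≠ 1 →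
        pr χ J u v ≠ 0 := fun u v h3 h4 h5 h6 =>
      h5 (hq.cr_eq_one (by rw [h6, mul_zero]) h3 h4 h2)
    exact h.tern.pr_eq_zero h.pl hJ x x' e g y hxx' hxe hxg hxy hx'e hx'g hx'y
      (k e g hxg hx'e (m ▸ hcon.2.2)) (k e y hxy hx'e hcon.1)
      (hq.comm y g ▸ k y g hxg hx'y hcon.2.1)

lemma Cand.ok_trans (h : Cand f E r χ φ e g) (hL : L.card + 3 = r) (heL : e ∉ L) (hgL : g ∉ L)
    (habc : tr χ L a b c ≠ 0) (e1 : tr χ L e b c ≠ 0) (e2 : tr χ L a e c ≠ 0)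
    (e3 : tr χ L a b e ≠ 0) (g1 : tr χ L g b c ≠ 0) (g2 : tr χ L a g c ≠ 0)
    (g3 : tr χ L a b g ≠ 0) (o1 : Ok f (tr χ L c) (tr φ L c) a b e g)
    (o2 : Ok f (tr χ L a) (tr φ L a) b c e g) : Ok f (tr χ L b) (tr φ L b) a c e g := by
  have ht := h.pl.alt3 hL
  have ht' := h.pl'.alt3 hL
  have h2 : (2 : F) = 0 := CharTwo.two_eq_zero
  have n1 := tr_ne h.pl.card hL e1
  have n2 := tr_ne h.pl.card hL e2
  have n3 := tr_ne h.pl.card hL g1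
  have n4 := tr_ne h.pl.card hL g2
  have f1 : tr φ L e b c ≠ 0 :=
    mt (h.supp (.inr (by simp [h.ne.symm, n3.1, n3.2.1, hgL]))).1 e1
  have f2 : tr φ L a e c ≠ 0 :=
    mt (h.supp (.inr (by simp [h.ne.symm, n4.1.symm, n3.2.1, hgL]))).1 e2
  have f3 : tr φ L a b e ≠ 0 :=
    mt (h.supp (.inr (by simp [h.ne.symm, n4.1.symm, n3.1, hgL]))).1 e3
  have f4 : tr φ L g b c ≠ 0 :=
    mt (h.supp (.inl (by simp [h.ne, n1.1, n1.2.1, heL]))).1 g1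
  have f5 : tr φ L a g c ≠ 0 :=
    mt (h.supp (.inl (by simp [h.ne, n2.1.symm, n1.2.1, heL]))).1 g2
  have f6 : tr φ L a b g ≠ 0 :=
    mt (h.supp (.inl (by simp [h.ne, n2.1.symm, n1.1, heL]))).1 g3
  have m := ht.cr_trans e1 e2 e3 g1 g2 g3
  rw [Ok, m, ht'.cr_trans f1 f2 f3 f4 f5 f6, ← o1, ← o2]
  have ca1 : tr χ L c b g ≠ 0 := by rwa [ht.rot c b g, ht.comm b g c]
  have ca2 : tr χ L c b e ≠ 0 := by rwa [ht.rot c b e, ht.comm b e c]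
  have ca3 : tr χ L c a e ≠ 0 := by rwa [ht.rot c a e]
  have ca4 : tr χ L c a g ≠ 0 := by rwa [ht.rot c a g]
  have aa1 : tr χ L a c g ≠ 0 := by rwa [ht.comm' a c g]
  have aa2 : tr χ L a c e ≠ 0 := by rwa [ht.comm' a c e]
  refine h.hf.map_mul ?_ ?_ ?_
  · simp only [cr]; exact div_ne_zero (mul_ne_zero ca3 ca1) (mul_ne_zero ca4 ca2)
  · simp only [cr]; exact div_ne_zero (mul_ne_zero e3 aa1) (mul_ne_zero g3 aa2)
  · by_contra! hcon
    refine h.tern.tr_eq_zero h.pl hL a b c e g habc e3 g3 e2 g2 ?_ e1 g1 ?_ ?_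
    · exact fun h0 => hcon.2.1 ((ht.alt a).cr_eq_one (by rw [h0, mul_zero]) g3 aa2 h2)
    · intro h0
      refine hcon.2.2 (m ▸ (ht.alt b).cr_eq_one ?_ ?_ ?_ h2)
      · rw [ht.comm b e g, h0, mul_zero]
      · rwa [ht.comm b a g]
      · rwa [← ht.rot e b c]
    · intro h0
      exact hcon.1 ((ht.alt c).cr_eq_one (by rw [ht.rot c e g, h0, mul_zero]) ca4 ca2 h2)

lemma Cand.supp_tr (h : Cand f E r χ φ e g) (heL : e ∉ L) (ha : a ≠ e) (hb : b ≠ e) (hc : c ≠ e) :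
    tr φ L a b c = 0 ↔ tr χ L a b c = 0 :=
  h.supp_of_notMem (by simp [ha.symm, hb.symm, hc.symm, heL])

lemma Cand.ok_of_ne (h : Cand f E r χ φ e g) (hL : L.card + 3 = r) (heL : e ∉ L) (hgL : g ∉ L)
    (hpe : p ≠ e) (hpg : p ≠ g) (hqe : q ≠ e) (hqg : q ≠ g) (habc : tr χ L a b c ≠ 0)
    (p1 : tr χ L p b c ≠ 0) (p2 : tr χ L a p c ≠ 0) (p3 : tr χ L a b p = 0)
    (q1 : tr χ L q b c = 0) (q2 : tr χ L a q c ≠ 0) (q3 : tr χ L a b q ≠ 0)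
    (e1 : tr χ L e b c ≠ 0) (e2 : tr χ L a e c ≠ 0) (e3 : tr χ L a b e ≠ 0)
    (g1 : tr χ L g b c ≠ 0) (g2 : tr χ L a g c = 0) (g3 : tr χ L a b g ≠ 0)
    (pe : tr χ L p e c ≠ 0) : Ok f (tr χ L b) (tr φ L b) a c e g := by
  have ht := h.pl.alt3 hL
  have ht' := h.pl'.alt3 hL
  have h2 : (2 : F) = 0 := CharTwo.two_eq_zero
  have hbc := tr_ne h.pl.card hL e1
  have hac := tr_ne h.pl.card hL e2
  have hbc' := tr_ne h.pl.card hL g1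
  have hab' := tr_ne h.pl.card hL g3
  have hbp := tr_ne h.pl.card hL p1
  have heb := hbc.1.symm
  have hec := hbc.2.1.symm
  have hea := hac.1
  have hgb := hbc'.1.symm
  have hgc := hbc'.2.1.symm
  have hga := hab'.2.1
  have hpL := hbp.2.2.2.1
  -- the cross ratio seen from `p`
  have m1 : tr χ L p a e ≠ 0 := fun h0 => by
    have := ht.minor₂₃ a b c p e
    rw [ht.comm a p e, h0, p3] at this
    simp [p2, e3] at this
  have m2 : tr χ L p a g ≠ 0 := fun h0 => by
    have := ht.minor₂₃ a b c p g
    rw [ht.comm a p g, h0, p3] at this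
    simp [p2, g3] at this
  have m3 : tr χ L p c g ≠ 0 := fun h0 => by
    have := ht.minor₁₂ a b c p g
    rw [ht.comm' p g c, h0, g2] at this
    simp [p2, g1] at this
  have m4 : tr χ L p a q ≠ 0 := fun h0 => by
    have := ht.minor₂₃ a b c p q
    rw [ht.comm a p q, h0, p3] at this
    simp [p2, q3] at this
  have m5 : tr χ L p c q ≠ 0 := fun h0 => by
    have := ht.minor₁₂ a b c p q
    rw [ht.comm' p q c, h0, q1] at this
    simp [p1, q2] at this
  have o1 : Ok f (tr χ L p) (tr φ L p) a c e g := by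
    rw [ht.comm a p c] at p2
    rw [ht.comm' p e c] at pe
    rw [tr_eq_pr χ L p] at m1 m2 m3 m4 m5 pe p2 ⊢
    rw [tr_eq_pr φ L p]
    exact h.ok_of_common (y := q) (by rw [Finset.card_insert_of_notMem hpL]; exact hL)
      (by simp [hpe.symm, heL]) (by simp [hpg.symm, hgL]) hqe hqg p2 m1 m2 pe m3 m4 m5
  have o2 : Ok f (tr χ L c) (tr φ L c) a b e p := by
    have hcL : c ∉ L := hbc.2.2.2.2.2
    rw [tr_eq_pr χ L c, tr_eq_pr φ L c]
    exact h.symm.ok_of_notMem (by rw [Finset.card_insert_of_notMem hcL]; exact hL)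
      (by simp [hgc.symm, hgL]) hga hgb h.ne hpg
  have s1 : tr φ L a b c ≠ 0 := mt (h.supp_tr heL hea heb hec).1 habc
  have s2 : tr φ L a p c ≠ 0 := mt (h.supp_tr heL hea hpe hec).1 p2
  have s3 : tr φ L a b p = 0 := (h.supp_tr heL hea heb hpe).2 p3
  have s4 : tr φ L e b c ≠ 0 := mt (h.symm.supp_tr hgL h.ne hgb hgc).1 e1
  have s5 : tr φ L g b c ≠ 0 := mt (h.supp_tr heL h.ne.symm heb hec).1 g1
  have s6 : tr φ L a g c = 0 := (h.supp_tr heL hea h.ne.symm hec).2 g2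
  have s7 : tr φ L a b g ≠ 0 := mt (h.supp_tr heL hea heb h.ne.symm).1 g3
  have s8 : tr φ L p e c ≠ 0 := mt (h.symm.supp_tr hgL hpg h.ne hgc).1 pe
  have m := ht.cr_pivot habc p2 p3 e1 g1 g2 g3 pe
  rw [Ok, m, ht'.cr_pivot s1 s2 s3 s4 s5 s6 s7 s8, ← o1, ← o2, ← h.hf.map_one_add]
  have c1 : tr χ L c b e ≠ 0 := by rwa [ht.rot c b e, ht.comm b e c]
  have c2 : tr χ L c a p ≠ 0 := by rwa [ht.rot c a p]
  have c3 : tr χ L c a e ≠ 0 := by rwa [ht.rot c a e]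
  have c4 : tr χ L c b p ≠ 0 := by rwa [ht.rot c b p, ht.comm b p c]
  have b1 : tr χ L b a g ≠ 0 := by rwa [ht.comm b a g]
  have b2 : tr χ L b c e ≠ 0 := by rwa [← ht.rot e b c]
  have b3 : tr χ L b a e ≠ 0 := by rwa [ht.comm b a e]
  have b4 : tr χ L b c g ≠ 0 := by rwa [← ht.rot g b c]
  have p4 : tr χ L p c e ≠ 0 := by rwa [ht.comm' p c e]
  have hW : cr (tr χ L b) a c e g ≠ 0 := by
    simp only [cr]; exact div_ne_zero (mul_ne_zero b3 b4) (mul_ne_zero b1 b2)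
  rw [m] at hW
  refine h.hf.map_mul (left_ne_zero_of_mul hW) (right_ne_zero_of_mul hW) ?_
  by_contra! hcon
  have k1 : tr χ L p e g ≠ 0 := fun h0 =>
    hcon.1 ((ht.alt p).cr_eq_one (by rw [h0, mul_zero]) m2 p4 h2)
  have k2 : tr χ L b e g ≠ 0 := fun h0 =>
    hcon.2.2 (m ▸ (ht.alt b).cr_eq_one (by rw [h0, mul_zero]) b1 b2 h2)
  have k3 : tr χ L p b e ≠ 0 := fun h0 => by
    have := ht.minor₁₃ a b c p e
    rw [h0, p3] at this
    simp [p1, e3] at this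
  have k4 : tr χ L p b g ≠ 0 := fun h0 => by
    have := ht.minor₁₃ a b c p g
    rw [h0, p3] at this
    simp [p1, g3] at this
  have k5 : tr χ L e g c ≠ 0 := fun h0 => by
    have := ht.minor₁₂ a b c e g
    rw [h0, g2] at this
    simp [e2, g1] at this
  refine h.tern.tr_eq_zero h.pl hL p b c e g p1 k3 k4 pe ?_ k1 e1 g1 ?_ k5
  · rwa [ht.comm' p g c]
  · rwa [ht.comm e b g]

lemma Cand.ok_of_two (h : Cand f E r χ φ e g) (hL : L.card + 3 = r) (heL : e ∉ L) (hgL : g ∉ L)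
    (hpe : p ≠ e) (hpg : p ≠ g) (hqe : q ≠ e) (hqg : q ≠ g) (habc : tr χ L a b c ≠ 0)
    (p1 : tr χ L p b c ≠ 0) (p2 : tr χ L a p c ≠ 0) (p3 : tr χ L a b p = 0)
    (q1 : tr χ L q b c = 0) (q2 : tr χ L a q c ≠ 0) (q3 : tr χ L a b q ≠ 0)
    (e1 : tr χ L e b c ≠ 0) (e2 : tr χ L a e c ≠ 0) (e3 : tr χ L a b e ≠ 0)
    (g1 : tr χ L g b c ≠ 0) (g2 : tr χ L a g c = 0) (g3 : tr χ L a b g ≠ 0) :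
    Ok f (tr χ L b) (tr φ L b) a c e g := by
  have ht := h.pl.alt3 hL
  by_cases pe : tr χ L p e c = 0
  · by_cases qe : tr χ L a q e = 0
    · exact (h.tern.not_fano h.pl hL habc p1 p2 p3 q1 q2 q3 e1 e2 e3 g1 g2 g3 pe qe
        (ht.fano_iff habc p2 p3 q1 q2 e2 g2 g3 pe qe)).elim
    · have rev : ∀ u v w, tr χ L u v w = tr χ L w v u := fun u v w => by
        rw [ht.rot u v w, ht.comm v w u]
      refine (h.ok_of_ne (a := c) (b := b) (c := a) (p := q) (q := p) hL heL hgL hqe hqg hpe hpg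
        ?_ ?_ ?_ ?_ ?_ ?_ ?_ ?_ ?_ ?_ ?_ ?_ ?_ ?_).swap_left h.hf <;> rw [rev] <;> try assumption
      rwa [ht.comm' a e q]
  · exact h.ok_of_ne hL heL hgL hpe hpg hqe hqg habc p1 p2 p3 q1 q2 q3 e1 e2 e3 g1 g2 g3 pe

end Cand

section Walk

variable {α F K : Type*} [DecidableEq α] [Field F] [Field K]
  {f : F → K} {E J L X : Finset α} {r : ℕ} {χ : Finset α → F} {φ : Finset α → K}
  {e g a b c x x' x₁ y y₂ : α}

lemma edge_del_del_iff (he : e ∉ X) (hg : g ∉ X) :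
    Edge (del e (del g χ)) X x y ↔ Edge χ X x y ∧ y ≠ e ∧ y ≠ g := by
  rw [edge_del_iff he, edge_del_iff hg]; tauto

lemma cr_eq_ent_rows (χ : Finset α → F) (hx : x ∈ X) (hx₁ : x₁ ∈ X) (h : x ≠ x₁) (y e : α) :
    cr (pr χ ((X.erase x).erase x₁)) x x₁ e y =
      ent χ X x₁ e * ent χ X x y / (ent χ X x₁ y * ent χ X x e) := by
  rw [ent_eq_pr' χ hx h, ent_eq_pr' χ hx h, ent_eq_pr χ hx₁ h, ent_eq_pr χ hx₁ h, cr,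
    pr_comm _ _ x e, pr_comm _ _ x y, pr_comm _ _ x₁ e, pr_comm _ _ x₁ y]

lemma IsPlucker.cr_pivot (hχ : IsPlucker E r χ) (hX : χ X ≠ 0) (hx : x ∈ X) (hx' : x' ∈ X)
    (h : x ≠ x') (hx₁ : x₁ ∈ X) (hxx₁ : x ≠ x₁) (hx'x₁ : x' ≠ x₁) (hy₂ : y₂ ∉ X)
    (hX' : χ (insert y₂ (X.erase x₁)) ≠ 0)
    (h0 : (ent χ X x y₂ = 0 ∧ ent χ X x' y₂ = 0) ∨ (ent χ X x₁ e = 0 ∧ ent χ X x₁ g = 0)) :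
    cr (pr χ (((insert y₂ (X.erase x₁)).erase x).erase x')) x x' e g =
      cr (pr χ ((X.erase x).erase x')) x x' e g := by
  rw [cr_eq_ent_rows χ hx hx' h, cr_eq_ent_rows χ (by simp [hx, hxx₁]) (by simp [hx', hx'x₁]) h]
  have key : ∀ v w, (v = x ∨ v = x') → (w = e ∨ w = g) →
      ent χ (insert y₂ (X.erase x₁)) v w = χ (insert y₂ (X.erase x₁)) / χ X * ent χ X v w := by
    rintro v w hv hw
    have := hχ.pivot_old (x := v) (y := w) hX (by aesop) hx₁ (by aesop) hy₂ (by aesop)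
    field_simp
    linear_combination this
  have hs : χ (insert y₂ (X.erase x₁)) / χ X ≠ 0 := div_ne_zero hX' hX
  rw [key x e (.inl rfl) (.inl rfl), key x g (.inl rfl) (.inr rfl), key x' e (.inr rfl) (.inl rfl),
    key x' g (.inr rfl) (.inr rfl)]
  field_simp

variable [CharP F 2] [CharP K 2]

/-- Two rows joined by a walk avoiding the columns `e` and `g`. -/
theorem Cand.ok_of_rowDist (h : Cand f E r χ φ e g) (n : ℕ) : ∀ X x x', e ∉ X → g ∉ X → χ X ≠ 0 →
    RowDist (del e (del g χ)) X x' n x → x ≠ x' → Edge χ X x e → Edge χ X x g → Edge χ X x' e →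
    Edge χ X x' g → Ok f (pr χ ((X.erase x).erase x')) (pr φ ((X.erase x).erase x')) x x' e g := by
  induction n using Nat.strong_induction_on with
  | _ n ih =>
  intro X x x' he hg hX hD hxx' hxe hxg hx'e hx'g
  by_cases hmin : ∃ k < n, RowDist (del e (del g χ)) X x' k x
  · obtain ⟨k, hk, hD⟩ := hmin
    exact ih k hk X x x' he hg hX hD hxx' hxe hxg hx'e hx'g
  push Not at hmin
  match n, hD with
  | 0, hD => exact absurd hD hxx'
  | 1, ⟨y, x₁, hy, hx₁, hx₁x'⟩ =>
    obtain rfl : x₁ = x' := hx₁x'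
    rw [edge_del_del_iff he hg] at hy hx₁
    have hJ := h.pl.card_erase_erase hX hxe.1 hx'e.1 hxx'
    refine h.ok_of_common (y := y) hJ (by simp [he]) (by simp [hg]) hy.2.1 hy.2.2 ?_ ?_ ?_ ?_ ?_ ?_
      ?_
    · rwa [← base_eq_pr χ hxe.1 hx'e.1 hxx']
    · rw [pr_comm, ← ent_eq_pr' χ hxe.1 hxx']; exact hx'e.2.2
    · rw [pr_comm, ← ent_eq_pr' χ hxe.1 hxx']; exact hx'g.2.2
    · rw [pr_comm, ← ent_eq_pr χ hx'e.1 hxx']; exact hxe.2.2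
    · rw [pr_comm, ← ent_eq_pr χ hx'e.1 hxx']; exact hxg.2.2
    · rw [pr_comm, ← ent_eq_pr' χ hxe.1 hxx']; exact hx₁.1.2.2
    · rw [pr_comm, ← ent_eq_pr χ hx'e.1 hxx']; exact hy.1.2.2
  | n + 2, hD =>
    obtain ⟨y₁, x₁, y₂, x₂, hxy₁, hx₁y₁, hx₁y₂, hx₂y₂, hD₂, hxy₂, hx₂y₁, hx₁x, hx₁x', hx₁x₂, hpos,
      hD'⟩ := ((h.pl.del g).del e).exists_pivot (by rwa [del_base he, del_base hg]) hD hmin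
    have ih₁ := ih 1 (by omega) X x x₁ he hg hX ⟨y₁, x₁, hxy₁, hx₁y₁, rfl⟩ hx₁x.symm hxe hxg
    have ih₂ := fun k1 k2 => ih (n + 1) (by omega) X x₁ x' he hg hX ⟨y₂, x₂, hx₁y₂, hx₂y₂, hD₂⟩
      hx₁x' k1 k2 hx'e hx'g
    rw [edge_del_del_iff he hg] at hxy₁ hx₁y₁ hx₁y₂ hx₂y₂
    simp only [edge_del_del_iff he hg, hx₁y₁.2, hx₁y₂.2, ne_eq, not_false_eq_true, and_true] at hxy₂ hx₂y₁ hpos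
    have hx := hxe.1
    have hx' := hx'e.1
    have hx₁ := hx₁y₁.1.1
    rw [not_edge_iff hx hx₁y₂.1.2.1] at hxy₂
    rw [not_edge_iff hx₂y₂.1.1 hx₁y₁.1.2.1] at hx₂y₁
    by_cases hpiv : 0 < n ∨ (ent χ X x₁ e = 0 ∧ ent χ X x₁ g = 0)
    · have h0 : (ent χ X x y₂ = 0 ∧ ent χ X x' y₂ = 0) ∨
          (ent χ X x₁ e = 0 ∧ ent χ X x₁ g = 0) :=
        hpiv.imp_left fun hn => ⟨hxy₂, (not_edge_iff hx' hx₁y₂.1.2.1).1 (hpos hn)⟩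
      have h0' : ∀ {v w}, v ∈ X → w ≠ e ∨ w ≠ g → (ent φ X v w = 0 ↔ ent χ X v w = 0) :=
        fun {v w} hv hw => h.supp (by
          rcases hw with hw | hw
          · exact .inl (by simp [hw.symm, he])
          · exact .inr (by simp [hw.symm, hg]))
      have he' : e ∉ insert y₂ (X.erase x₁) := by simp [he, Ne.symm hx₁y₂.2.1]
      have hg' : g ∉ insert y₂ (X.erase x₁) := by simp [hg, Ne.symm hx₁y₂.2.2]
      have hX' : χ (insert y₂ (X.erase x₁)) ≠ 0 := hx₁y₂.1.2.2
      have ed : ∀ {v w}, v = x ∨ v = x' → w = e ∨ w = g → Edge χ X v w →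
          Edge χ (insert y₂ (X.erase x₁)) v w := fun {v w} hv hw hvw =>
        h.pl.edge_pivot_old hX (by aesop) hx₁y₂.1 (by rcases hw with rfl | rfl; exacts [Ne.symm hx₁y₂.2.1, Ne.symm hx₁y₂.2.2]) (by aesop) hvw
      have key := ih (n + 1) (by omega) (insert y₂ (X.erase x₁)) x x' he' hg' hX' hD' hxx'
        (ed (.inl rfl) (.inl rfl) hxe) (ed (.inl rfl) (.inr rfl) hxg)
        (ed (.inr rfl) (.inl rfl) hx'e) (ed (.inr rfl) (.inr rfl) hx'g)
      rw [Ok, h.pl.cr_pivot hX hx hx' hxx' hx₁ hx₁x.symm hx₁x'.symm hx₁y₂.1.2.1 hX' h0,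
        h.pl'.cr_pivot (mt (h.supp (.inl he)).1 hX) hx hx' hxx' hx₁ hx₁x.symm hx₁x'.symm
          hx₁y₂.1.2.1 (mt (h.supp (.inl he')).1 hX')] at key
      · exact key
      · rwa [h0' hx (.inl hx₁y₂.2.1), h0' hx' (.inl hx₁y₂.2.1), h0' hx₁ (.inr h.ne),
          h0' hx₁ (.inl h.ne.symm)]
    push Not at hpiv
    obtain ⟨hn, hpiv⟩ := hpiv
    obtain rfl : n = 0 := by omega
    set L := ((X.erase x).erase x₁).erase x' with hLdef
    have s3 : insert x' L = (X.erase x).erase x₁ :=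
      Finset.insert_erase (by simp [hx', hxx'.symm, hx₁x'.symm])
    have s2 : insert x₁ L = (X.erase x).erase x' := by
      rw [hLdef, Finset.erase_right_comm]
      exact Finset.insert_erase (by simp [hx₁, hx₁x, hx₁x'])
    have s1 : insert x L = (X.erase x₁).erase x' := by
      rw [hLdef, Finset.erase_right_comm (a := x), Finset.erase_right_comm (a := x)]
      exact Finset.insert_erase (by simp [hx, hxx', hx₁x.symm])
    have t1 : ∀ y, tr χ L y x₁ x' = ent χ X x y := fun y => by
      rw [ent_eq_pr χ hx₁ hx₁x.symm, ← s3]; rfl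
    have t2 : ∀ y, tr χ L x y x' = ent χ X x₁ y := fun y => by
      rw [tr_comm, ent_eq_pr' χ hx hx₁x.symm, ← s3]; rfl
    have t3 : ∀ y, tr χ L x x₁ y = ent χ X x' y := fun y => by
      rw [tr_eq_pr, s1, pr_comm, ent_eq_pr' χ hx₁ hx₁x']
    have t0 : tr χ L x x₁ x' = χ X := by
      rw [tr_eq_pr, s1, base_eq_pr χ hx₁ hx' hx₁x']
    have hL : L.card + 3 = r := by
      have := h.pl.card_erase_erase hX hx hx₁ hx₁x.symm
      rw [← s3, Finset.card_insert_of_notMem (by simp [hLdef])] at this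
      omega
    have heL : e ∉ L := by simp [hLdef, he]
    have hgL : g ∉ L := by simp [hLdef, hg]
    rw [← s2, ← tr_eq_pr, ← tr_eq_pr]
    have hx₂ : x₂ = x' := hD₂
    subst hx₂
    by_cases h1 : ent χ X x₁ e = 0
    · refine (h.symm.ok_of_two (p := y₁) (q := y₂) hL hgL heL hxy₁.2.2 hxy₁.2.1 hx₂y₂.2.2 hx₂y₂.2.1
        ?_ ?_ ?_ ?_ ?_ ?_ ?_ ?_ ?_ ?_ ?_ ?_ ?_).swap_right h.hf <;> simp only [t0, t1, t2, t3]
      exacts [hX, hxy₁.1.2.2, hx₁y₁.1.2.2, hx₂y₁, hxy₂, hx₁y₂.1.2.2, hx₂y₂.1.2.2, hxg.2.2, hpiv h1,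
        hx'g.2.2, hxe.2.2, h1, hx'e.2.2]
    by_cases h2 : ent χ X x₁ g = 0
    · refine h.ok_of_two (p := y₁) (q := y₂) hL heL hgL hxy₁.2.1 hxy₁.2.2 hx₂y₂.2.1 hx₂y₂.2.2
        ?_ ?_ ?_ ?_ ?_ ?_ ?_ ?_ ?_ ?_ ?_ ?_ ?_ <;> simp only [t0, t1, t2, t3]
      exacts [hX, hxy₁.1.2.2, hx₁y₁.1.2.2, hx₂y₁, hxy₂, hx₁y₂.1.2.2, hx₂y₂.1.2.2, hxe.2.2, h1,
        hx'e.2.2, hxg.2.2, h2, hx'g.2.2]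
    have a1 : Edge χ X x₁ e := ⟨hx₁, he, h1⟩
    have a2 : Edge χ X x₁ g := ⟨hx₁, hg, h2⟩
    refine h.ok_trans hL heL hgL ?_ ?_ ?_ ?_ ?_ ?_ ?_ ?_ ?_
    any_goals simp only [t0, t1, t2, t3]
    exacts [hX, hxe.2.2, h1, hx'e.2.2, hxg.2.2, h2, hx'g.2.2,
      by rw [tr_eq_pr, tr_eq_pr, s3]; exact ih₁ a1 a2, by rw [tr_eq_pr, tr_eq_pr, s1]; exact ih₂ a1 a2]

end Walk

section Alt

variable {K : Type*} {α : Type*} [Field K] {q : α → α → K} {t : α → α → α → K} {a b c d z h : α}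

lemma Alt3.cr_swap (ht : Alt3 t) (h2 : (2 : K) = 0) (habc : t a b c = 0) (hdbc : t d b c ≠ 0)
    (hu : U24 (t z) a b c d) : cr (t z) a b c d = cr (t d) a b c z := by
  have h1 := (ht.alt c).parallel h2 (y := a) (z := b) (by rw [ht.rot c a b, habc]) z d
  rw [ht.rot c z a, ht.rot c d b, ht.rot c z b, ht.rot c d a] at h1
  have n1 : t d a c ≠ 0 := fun h0 => mul_ne_zero hu.ac hdbc (by rw [h1, h0, mul_zero])
  have hz := hu.ad
  have hz' := hu.bd
  have hz'' := hu.bc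
  have e1 : ∀ u, t d u z = t z u d := fun u => by rw [ht.rot d u z, ht.comm u z d]
  simp only [cr, e1]
  field_simp
  linear_combination h1

lemma cr_eq_of_ratio {q' : α → α → K} (h1 : q a c * q' b c = q' a c * q b c)
    (h2 : q a d * q' b d = q' a d * q b d) (hu : U24 q a b c d) (had : q' a d ≠ 0)
    (hbc : q' b c ≠ 0) : cr q a b c d = cr q' a b c d := by
  have := hu.ad
  have := hu.bc
  simp only [cr]
  field_simp
  linear_combination q b d * q' a d * h1 - q' a c * q b c * h2

/-- Collinear points have the same cross ratio from any point. -/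
lemma Alt3.cr_line (ht : Alt3 t) (h2 : (2 : K) = 0) (habc : t a b c = 0) (habd : t a b d = 0)
    (hh : t h a b ≠ 0) (hu : U24 (t z) a b c d) : cr (t z) a b c d = cr (t h) a b c d := by
  have key : ∀ u, t a b u = 0 → t z a u * t h b u = t h a u * t z b u := fun u hu => by
    have := (ht.alt u).parallel h2 (y := a) (z := b) (by rw [ht.rot u a b, hu]) z h
    rw [ht.rot u z a, ht.rot u h b, ht.rot u z b, ht.rot u h a] at this
    linear_combination this
  refine cr_eq_of_ratio (key c habc) (key d habd) hu ?_ ?_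
  · have := (ht.alt a).parallel h2 habd z h
    intro h0
    rw [ht.comm a h d, h0, mul_zero, ht.comm a z d, ht.comm a h b, eq_comm] at this
    exact mul_ne_zero hu.ad hh this
  · have := (ht.alt b).parallel h2 (y := a) (z := c) (by rw [ht.comm b a c, habc]) z h
    intro h0
    rw [ht.comm b h c, h0, mul_zero, ht.comm b z c, ht.rot b h a, eq_comm] at this
    exact mul_ne_zero hu.bc hh this

/-- Parallel elements can be exchanged in a contraction. -/
lemma Alt3.cr_loop (ht : Alt3 t) (h2 : (2 : K) = 0) (hc : t z h c = 0) (hd : t z h d = 0)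
    (hbc : t h b c ≠ 0) (hu : U24 (t z) a b c d) : cr (t z) a b c d = cr (t h) a b c d := by
  have key : ∀ u v w, t z h u = 0 → t z v u * t h w u = t h v u * t z w u := fun u v w hu => by
    have := (ht.alt u).parallel h2 (y := z) (z := h) (by rw [ht.rot u z h, hu]) v w
    rw [ht.rot u v z, ht.comm v z u, ht.rot u w h, ht.comm w h u, ht.rot u v h, ht.comm v h u,
      ht.rot u w z, ht.comm w z u] at this
    exact this
  have hdc : t h d c ≠ 0 := fun h0 => by
    have := key c d b hc
    rw [h0, zero_mul, ht.comm' z d c] at this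
    exact mul_ne_zero hu.cd hbc this
  refine cr_eq_of_ratio (key c a b hc) (key d a b hd) hu (fun h0 => ?_) hbc
  have := key d a c hd
  rw [h0, zero_mul, ht.comm' h c d] at this
  exact mul_ne_zero hu.ad hdc this

lemma U24.rot_to {q : α → α → K} {P : α → α → α → α → Prop} {g : α} (hq : Alt2 q)
    (hl : ∀ {a b c d}, P b a c d → P a b c d) (hp : ∀ {a b c d}, P c d a b → P a b c d)
    (hu : U24 q a b c d) (hg : g = a ∨ g = b ∨ g = c ∨ g = d)
    (h : ∀ b c d, U24 q g b c d → P g b c d) : P a b c d := by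
  rcases hg with rfl | rfl | rfl | rfl
  · exact h _ _ _ hu
  · exact hl (h _ _ _ (hu.swap_left hq))
  · exact hp (h _ _ _ (hu.swap_pairs hq))
  · exact hp (hl (h _ _ _ ((hu.swap_pairs hq).swap_left hq)))

end Alt

section Propagate

variable {α F K : Type*} [DecidableEq α] [Field F] [Field K]
  {f : F → K} {E J L X : Finset α} {r : ℕ} {χ : Finset α → F} {φ : Finset α → K}
  {e g a b c d x x' z : α} [CharP F 2] [CharP K 2]

lemma Alt2.eq_zero_of_cr {q : α → α → K} (hq : Alt2 q) (hxx : q x x' ≠ 0) (h2 : q x g ≠ 0)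
    (h3 : q x' e ≠ 0) (h : cr q x x' e g = 1) : q e g = 0 := by
  have := hq.three x x' e g
  have h20 : (2 : K) = 0 := CharTwo.two_eq_zero
  simp only [cr] at h
  field_simp at h
  refine (mul_eq_zero.1 (?_ : q x x' * q e g = 0)).resolve_left hxx
  rw [this, h]
  linear_combination q x g * q x' e * h20

lemma Alt2.eq_zero_iff {q : α → α → F} {q' : α → α → K} (hf : CrMap f) (hq : Alt2 q) (hq' : Alt2 q')
    (hxx : q x x' ≠ 0) (hxx' : q' x x' ≠ 0) (h1 : q' x e = 0 ↔ q x e = 0)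
    (h2 : q' x g = 0 ↔ q x g = 0) (h3 : q' x' e = 0 ↔ q x' e = 0) (h4 : q' x' g = 0 ↔ q x' g = 0)
    (ho : q x e ≠ 0 → q x g ≠ 0 → q x' e ≠ 0 → q x' g ≠ 0 → Ok f q q' x x' e g) :
    q' e g = 0 ↔ q e g = 0 := by
  have t := hq.three x x' e g
  have t' := hq'.three x x' e g
  have k : q e g = 0 ↔ q x x' * q e g = 0 := by simp [hxx]
  have k' : q' e g = 0 ↔ q' x x' * q' e g = 0 := by simp [hxx']
  by_cases c1 : q x e = 0
  · rw [k, k', t, t']; simp [c1, h1.2 c1, h2, h3]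
  by_cases c2 : q x g = 0
  · rw [k, k', t, t']; simp [c2, h2.2 c2, h1, h4]
  by_cases c3 : q x' e = 0
  · rw [k, k', t, t']; simp [c3, h3.2 c3, h1, h4]
  by_cases c4 : q x' g = 0
  · rw [k, k', t, t']; simp [c4, h4.2 c4, h2, h3]
  have o := ho c1 c2 c3 c4
  unfold Ok at o
  constructor
  · intro h0
    rw [hq'.cr_eq_one (by rw [h0, mul_zero]) (mt h2.1 c2) (mt h3.1 c3) CharTwo.two_eq_zero] at o
    exact hq.eq_zero_of_cr hxx c2 c3 (hf.eq_one CharTwo.two_eq_zero o)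
  · intro h0
    rw [hq.cr_eq_one (by rw [h0, mul_zero]) c2 c3 CharTwo.two_eq_zero, hf.map_one] at o
    exact hq'.eq_zero_of_cr hxx' (mt h2.1 c2) (mt h3.1 c3) o.symm

lemma Cand.supp_all (h : Cand f E r χ φ e g) (eφ : Exch φ) (he : e ∉ X) (hg : g ∉ X) (hX : χ X ≠ 0)
    (hv : ∀ J x x', J.card + 2 = r → e ∉ J → g ∉ J → pr χ J x x' ≠ 0 → pr χ J x e ≠ 0 →
      pr χ J x g ≠ 0 → pr χ J x' e ≠ 0 → pr χ J x' g ≠ 0 → Ok f (pr χ J) (pr φ J) x x' e g)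
    (I : Finset α) : φ I = 0 ↔ χ I = 0 := by
  by_cases hI : e ∉ I ∨ g ∉ I
  · exact h.supp hI
  push Not at hI
  have eχ := h.tern.exch h.pl
  have hX' : φ X ≠ 0 := mt (h.supp (.inl he)).1 hX
  set J := (I.erase e).erase g with hJdef
  have hIJ : I = insert e (insert g J) := by
    rw [Finset.insert_erase (by simp [h.ne.symm, hI.2]), Finset.insert_erase hI.1]
  have heJ : e ∉ J := by simp [hJdef]
  have hgJ : g ∉ J := by simp [hJdef]
  have main : I.card = r → (∃ x ∈ X \ I, ∃ y ∈ X \ I, x ≠ y ∧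
      χ (insert x (insert y ((I.erase e).erase g))) ≠ 0) → (φ I = 0 ↔ χ I = 0) := by
    rintro hr ⟨x, hx, x', hx', -, hn⟩
    rw [Finset.mem_sdiff] at hx hx'
    have hxe : x ≠ e := fun h0 => he (h0 ▸ hx.1)
    have hxg : x ≠ g := fun h0 => hg (h0 ▸ hx.1)
    have hx'e : x' ≠ e := fun h0 => he (h0 ▸ hx'.1)
    have hx'g : x' ≠ g := fun h0 => hg (h0 ▸ hx'.1)
    have hJ : J.card + 2 = r := by
      rw [hIJ, Finset.card_insert_of_notMem (by simp [h.ne, heJ]),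
        Finset.card_insert_of_notMem hgJ] at hr
      exact hr
    rw [hIJ]
    refine (h.pl.alt2 hJ).eq_zero_iff (x := x) (x' := x') h.hf (h.pl'.alt2 hJ) hn ?_ ?_ ?_ ?_ ?_
      (hv J x x' hJ heJ hgJ hn)
    · exact mt (h.supp (.inl (by simp [hxe.symm, hx'e.symm, heJ]))).1 hn
    · exact h.supp (.inr (by simp [hxg.symm, h.ne.symm, hgJ]))
    · exact h.supp (.inl (by simp [hxe.symm, h.ne, heJ]))
    · exact h.supp (.inr (by simp [hx'g.symm, h.ne.symm, hgJ]))
    · exact h.supp (.inl (by simp [hx'e.symm, h.ne, heJ]))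
  have he' : e ∈ I \ X := Finset.mem_sdiff.2 ⟨hI.1, he⟩
  have hg' : g ∈ I \ X := Finset.mem_sdiff.2 ⟨hI.2, hg⟩
  by_cases h0 : χ I = 0
  · by_cases h0' : φ I = 0
    · simp [h0, h0']
    · obtain ⟨x, hx, x', hx', hne, hn⟩ := eφ.exists_pair h0' hX' he' hg' h.ne
      refine main (h.pl'.card _ h0') ⟨x, hx, x', hx', hne, mt (h.supp (.inl ?_)).2 hn⟩
      rw [Finset.mem_sdiff] at hx hx'
      have hxe : x ≠ e := fun h0 => he (h0 ▸ hx.1)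
      have hx'e : x' ≠ e := fun h0 => he (h0 ▸ hx'.1)
      simp [hxe.symm, hx'e.symm]
  · exact main (h.pl.card _ h0) (eχ.exists_pair h0 hX he' hg' h.ne)

end Propagate

section Propagate

variable {α F K : Type*} [DecidableEq α] [Field F] [Field K]
  {f : F → K} {E J L X : Finset α} {r : ℕ} {χ : Finset α → F} {φ : Finset α → K}
  {e g a b c d h x x' z : α} [CharP F 2] [CharP K 2]

lemma Ok.swap_mid' {q : α → α → F} {q' : α → α → K} (hf : CrMap f) (hq : Alt2 q) (hq' : Alt2 q')
    (hs : ∀ a b, q' a b = 0 ↔ q a b = 0) (hu : U24 q a c b d) (h : Ok f q q' a b c d) :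
    Ok f q q' a c b d :=
  h.swap_mid hf hq hq' hu.ad (hq.comm c b ▸ hu.bc) (mt (hs _ _).1 hu.ad)
    (mt (hs _ _).1 (hq.comm c b ▸ hu.bc))

/-- A candidate with the right support, whose cross ratios involving `e`, `g` and two elements
outside of them are as prescribed. -/
structure CandV (f : F → K) (E : Finset α) (r : ℕ) (χ : Finset α → F) (φ : Finset α → K)
    (e g : α) : Prop where
  cand : Cand f E r χ φ e g
  supp : ∀ I, φ I = 0 ↔ χ I = 0
  ok : ∀ J x x', J.card + 2 = r → e ∉ J → g ∉ J → pr χ J x x' ≠ 0 → pr χ J x e ≠ 0 →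
      pr χ J x g ≠ 0 → pr χ J x' e ≠ 0 → pr χ J x' g ≠ 0 → Ok f (pr χ J) (pr φ J) x x' e g

lemma CandV.symm (h : CandV f E r χ φ e g) : CandV f E r χ φ g e :=
  ⟨h.cand.symm, h.supp, fun J x x' hJ he hg h1 h2 h3 h4 h5 =>
    (h.ok J x x' hJ hg he h1 h3 h2 h5 h4).swap_right h.cand.hf⟩

lemma CandV.ok_of_notMem (hV : CandV f E r χ φ e g) (hJ : J.card + 2 = r) (he : e ∉ J) (hg : g ∉ J)
    (a b c d : α) : Ok f (pr χ J) (pr φ J) a b c d := by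
  have hq := hV.cand.pl.alt2 hJ
  have hq' := hV.cand.pl'.alt2 hJ
  have hs : ∀ a b, pr φ J a b = 0 ↔ pr χ J a b = 0 := fun a b => hV.supp _
  have hf := hV.cand.hf
  refine ok_of_u24 hf hq hq' hs fun hu => ?_
  by_cases hgm : g = a ∨ g = b ∨ g = c ∨ g = d
  swap
  · push Not at hgm
    exact hV.cand.symm.ok_of_notMem hJ hg hgm.1.symm hgm.2.1.symm hgm.2.2.1.symm hgm.2.2.2.symm
  refine hu.rot_to hq (fun h => h.swap_left hf) (fun h => h.swap_pairs hq hq') hgm ?_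
  have key : ∀ c d, U24 (pr χ J) g e c d → Ok f (pr χ J) (pr φ J) g e c d := fun c d hu =>
    ((hV.ok J c d hJ he hg hu.cd (hq.comm _ _ ▸ hu.bc) (hq.comm _ _ ▸ hu.ac) (hq.comm _ _ ▸ hu.bd)
      (hq.comm _ _ ▸ hu.ad)).swap_right hf).swap_pairs hq hq'
  intro b c d hu
  by_cases hb : b = e
  · exact hb ▸ key _ _ (hb ▸ hu)
  by_cases hc : c = e
  · subst hc
    exact (key _ _ (hu.swap_mid hq)).swap_mid' hf hq hq' hs hu
  by_cases hd : d = e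
  · subst hd
    exact ((key _ _ ((hu.swap_right hq).swap_mid hq)).swap_mid' hf hq hq' hs
      (hu.swap_right hq)).swap_right hf
  exact hV.cand.ok_of_notMem hJ he hV.cand.ne.symm hb hc hd

lemma CandV.ok_tr_of_notMem (hV : CandV f E r χ φ e g) (hL : L.card + 3 = r) (he : e ∉ L)
    (hg : g ∉ L) (hz : z ∉ L) (hze : z ≠ e) (hzg : z ≠ g) (a b c d : α) :
    Ok f (tr χ L z) (tr φ L z) a b c d := by
  rw [tr_eq_pr, tr_eq_pr]
  exact hV.ok_of_notMem (by rw [Finset.card_insert_of_notMem hz]; exact hL) (by simp [hze.symm, he])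
    (by simp [hzg.symm, hg]) a b c d

lemma Exch.exists_tr (eχ : Exch χ) (hX : χ X ≠ 0) (hz : z ∉ X) (hL : z ∉ L) (ha : z ≠ a) (hb : z ≠ b)
    (h : tr χ L z a b ≠ 0) : ∃ y ∈ X, y ∉ L ∧ tr χ L y a b ≠ 0 := by
  obtain ⟨y, hy, hyI, hn⟩ := eχ _ X h hX z (by simp) hz
  refine ⟨y, hy, fun h0 => hyI (by simp [h0]), ?_⟩
  rwa [Finset.erase_insert (by simp [ha, hb, hL])] at hn

lemma Alt3.ne_of_line {t : α → α → α → F} (ht : Alt3 t) (h2 : (2 : F) = 0) (hbcd : t b c d = 0)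
    (hbc : t h b c ≠ 0) (hcd : t e c d ≠ 0) : t d c h ≠ 0 := fun h0 => by
  have := (ht.alt c).parallel h2 (y := b) (z := d) (by rwa [ht.comm c b d]) h e
  rw [ht.comm' c h d, ht.comm c d h, h0, zero_mul, ht.rot c h b, ht.rot c e d,
    ht.comm' e d c] at this
  exact mul_ne_zero hbc hcd this

lemma CandV.ok_of_triple_zero (hV : CandV f E r χ φ e g) (hL : L.card + 3 = r) (heL : e ∉ L)
    (hgL : g ∉ L) (hu : U24 (tr χ L e) g b c d) (h1 : tr χ L g b c = 0)
    (h2 : tr χ L d b c ≠ 0) : Ok f (tr χ L e) (tr φ L e) g b c d := by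
  have ht := hV.cand.pl.alt3 hL
  have ht' := hV.cand.pl'.alt3 hL
  have hs : ∀ a b c, tr φ L a b c = 0 ↔ tr χ L a b c = 0 := fun a b c => hV.supp _
  have n1 := tr_ne hV.cand.pl.card hL hu.ad
  rw [Ok, ht.cr_swap CharTwo.two_eq_zero h1 h2 hu, ht'.cr_swap CharTwo.two_eq_zero ((hs _ _ _).2 h1)
    (mt (hs _ _ _).1 h2) (hu.of_supp (hs e))]
  exact hV.ok_tr_of_notMem hL heL hgL n1.2.2.2.2.2 n1.2.1.symm n1.2.2.1.symm _ _ _ _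

lemma CandV.ok_of_triple (hV : CandV f E r χ φ e g) (hL : L.card + 3 = r) (heL : e ∉ L)
    (hgL : g ∉ L) (hu : U24 (tr χ L e) g b c d) (h : tr χ L b c d ≠ 0) :
    Ok f (tr χ L e) (tr φ L e) g b c d := by
  have ht := hV.cand.pl.alt3 hL
  have hq := ht.alt e
  have hq' := (hV.cand.pl'.alt3 hL).alt e
  have hs : ∀ a b, tr φ L e a b = 0 ↔ tr χ L e a b = 0 := fun a b => hV.supp _
  have hf := hV.cand.hf
  by_cases h1 : tr χ L g b c = 0
  · exact hV.ok_of_triple_zero hL heL hgL hu h1 (by rwa [ht.rot])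
  by_cases h2 : tr χ L g b d = 0
  · exact (hV.ok_of_triple_zero hL heL hgL (hu.swap_right hq) h2
      (by rwa [ht.comm])).swap_right hf
  by_cases h3 : tr χ L g c d = 0
  · exact ((hV.ok_of_triple_zero hL heL hgL ((hu.swap_mid hq).swap_right hq) h3 h).swap_right
      hf).swap_mid' hf hq hq' hs hu
  refine (hV.cand.tern.tr_eq_zero hV.cand.pl hL e g b c d hu.ab hu.ac hu.ad
    (by rw [ht.comm']; exact hu.bc) (by rw [ht.comm']; exact hu.bd) hu.cd ?_ ?_ ?_ ?_).elim
  · rwa [ht.rot]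
  · rwa [ht.rot]
  · rwa [ht.comm]
  · rwa [← ht.rot]

lemma CandV.ok_of_parallel (hV : CandV f E r χ φ e g) (hL : L.card + 3 = r) (heL : e ∉ L)
    (hgL : g ∉ L) (hu : U24 (tr χ L e) g b c d) (hd : tr χ L e h d = 0)
    (hg : tr χ L e h g ≠ 0) (hb : tr χ L e h b ≠ 0) (hc : tr χ L e h c ≠ 0)
    (hn : tr χ L b c h ≠ 0) : Ok f (tr χ L e) (tr φ L e) g b c d := by
  have hq := (hV.cand.pl.alt3 hL).alt e
  have hq' := (hV.cand.pl'.alt3 hL).alt e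
  have hs : ∀ a b, tr φ L e a b = 0 ↔ tr χ L e a b = 0 := fun a b => hV.supp _
  rw [hq.comm] at hg hb hc hd
  rw [Ok, hq.cr_parallel CharTwo.two_eq_zero hd hu.ad hg,
    hq'.cr_parallel CharTwo.two_eq_zero ((hs _ _).2 hd) (mt (hs _ _).1 hu.ad) (mt (hs _ _).1 hg)]
  exact hV.ok_of_triple hL heL hgL ⟨hu.ab, hu.ac, hg, hu.bc, hb, hc⟩ hn

lemma CandV.ok_insert (hV : CandV f E r χ φ e g) (hL : L.card + 3 = r) (heL : e ∉ L)
    (hgL : g ∉ L) (heX : e ∉ X) (hgX : g ∉ X) (hX : χ X ≠ 0) (a b c d : α) :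
    Ok f (tr χ L e) (tr φ L e) a b c d := by
  have ht := hV.cand.pl.alt3 hL
  have ht' := hV.cand.pl'.alt3 hL
  have hq := ht.alt e
  have hq' := ht'.alt e
  have hs : ∀ a b c, tr φ L a b c = 0 ↔ tr χ L a b c = 0 := fun a b c => hV.supp _
  have hf := hV.cand.hf
  have h20 : (2 : F) = 0 := CharTwo.two_eq_zero
  have hJ : (insert e L).card + 2 = r := by rw [Finset.card_insert_of_notMem heL]; exact hL
  have hgJ : g ∉ insert e L := by simp [hV.cand.ne.symm, hgL]
  have avoid : ∀ {a b c d}, a ≠ g → b ≠ g → c ≠ g → d ≠ g →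
      Ok f (tr χ L e) (tr φ L e) a b c d := fun h1 h2 h3 h4 => by
    rw [tr_eq_pr, tr_eq_pr]
    exact hV.cand.symm.ok_of_notMem hJ hgJ h1 h2 h3 h4
  refine ok_of_u24 hf hq hq' (hs e) fun hu => ?_
  by_cases hgm : g = a ∨ g = b ∨ g = c ∨ g = d
  swap
  · push Not at hgm
    exact avoid hgm.1.symm hgm.2.1.symm hgm.2.2.1.symm hgm.2.2.2.symm
  refine hu.rot_to hq (fun h => h.swap_left hf) (fun h => h.swap_pairs hq hq') hgm ?_
  intro b c d hu
  by_cases hbcd : tr χ L b c d ≠ 0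
  · exact hV.ok_of_triple hL heL hgL hu hbcd
  push Not at hbcd
  have n1 := tr_ne hV.cand.pl.card hL hu.bc
  have n2 := tr_ne hV.cand.pl.card hL hu.bd
  have n3 := tr_ne hV.cand.pl.card hL hu.ab
  have n4 := tr_ne hV.cand.pl.card hL hu.ac
  have n5 := tr_ne hV.cand.pl.card hL hu.ad
  obtain ⟨h, hhX, hhL, hbc⟩ := (hV.cand.tern.exch hV.cand.pl).exists_tr hX heX heL n1.1 n1.2.1 hu.bc
  have hhe : h ≠ e := fun h0 => heX (h0 ▸ hhX)
  have hhg : h ≠ g := fun h0 => hgX (h0 ▸ hhX)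
  by_cases hl : tr χ L e h c = 0 ∧ tr χ L e h d = 0
  · rw [Ok, ht.cr_loop h20 hl.1 hl.2 hbc hu, ht'.cr_loop CharTwo.two_eq_zero ((hs _ _ _).2 hl.1)
      ((hs _ _ _).2 hl.2) (mt (hs _ _ _).1 hbc) (hu.of_supp (hs e))]
    exact hV.ok_tr_of_notMem hL heL hgL hhL hhe hhg _ _ _ _
  have hl' : ∀ u v, tr χ L e u v ≠ 0 → tr χ L e h u = 0 → tr χ L e h v ≠ 0 := by
    intro u v huv h1 h2
    have : ∀ w, tr χ L e h w = 0 := fun w => by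
      have := hq.three h w u v
      rw [h1, h2, zero_mul, zero_mul, add_zero] at this
      exact (mul_eq_zero.1 this).resolve_right huv
    exact hl ⟨this c, this d⟩
  by_cases kg : tr χ L e h g = 0
  · have kc : tr χ L e c h ≠ 0 := by rw [hq.comm]; exact hl' _ _ hu.ac kg
    have hcg : tr χ L e c g ≠ 0 := by rw [hq.comm]; exact hu.ac
    rw [hq.comm] at kg
    have : Ok f (tr χ L e) (tr φ L e) c d b g := by
      rw [Ok, hq.cr_parallel h20 kg hcg kc, hq'.cr_parallel CharTwo.two_eq_zero ((hs _ _ _).2 kg)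
        (mt (hs _ _ _).1 hcg) (mt (hs _ _ _).1 kc)]
      exact avoid n4.2.2.1.symm n5.2.2.1.symm n3.2.2.1.symm hhg
    exact (this.swap_pairs hq hq').swap_left hf
  have hdch : tr χ L d c h ≠ 0 := ht.ne_of_line h20 hbcd hbc hu.cd
  have hbdh : tr χ L b d h ≠ 0 := by
    rw [ht.comm]
    exact ht.ne_of_line h20 (by rwa [ht.comm]) (by rwa [ht.comm']) hu.bd
  rw [ht.rot] at hbc
  by_cases kb : tr χ L e h b = 0
  · have hu' := (hu.swap_right hq).swap_mid hq
    exact ((hV.ok_of_parallel hL heL hgL (hu'.swap_right hq) kb kg (hl' _ _ hu.bd kb)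
      (hl' _ _ hu.bc kb) hdch).swap_right hf |>.swap_mid' hf hq hq' (hs e)
        (hu.swap_right hq)).swap_right hf
  by_cases kc : tr χ L e h c = 0
  · exact (hV.ok_of_parallel hL heL hgL (hu.swap_right hq) kc kg kb
      (hl' _ _ hu.cd kc) hbdh).swap_right hf
  by_cases kd : tr χ L e h d = 0
  · exact hV.ok_of_parallel hL heL hgL hu kd kg kb kc hbc
  · have := hV.cand.tern.pr_eq_zero hV.cand.pl hJ h g b c d
    rw [← tr_eq_pr] at this
    exact (this kg kb kc kd hu.ab hu.ac hu.ad hu.bc hu.bd hu.cd).elim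

lemma CandV.ok_insert_insert (hV : CandV f E r χ φ e g) (hL : L.card + 4 = r) (heL : e ∉ L)
    (hgL : g ∉ L) (heX : e ∉ X) (hgX : g ∉ X) (hX : χ X ≠ 0) (a b c d : α) :
    Ok f (tr χ (insert e L) g) (tr φ (insert e L) g) a b c d := by
  have hJ : (insert e L).card + 3 = r := by rw [Finset.card_insert_of_notMem heL]; exact hL
  have hgJ : g ∉ insert e L := by simp [hV.cand.ne.symm, hgL]
  have ht := hV.cand.pl.alt3 hJ
  have ht' := hV.cand.pl'.alt3 hJ
  have hq := ht.alt g
  have hq' := ht'.alt g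
  have hs : ∀ a b c, tr φ (insert e L) a b c = 0 ↔ tr χ (insert e L) a b c = 0 :=
    fun a b c => hV.supp _
  have hf := hV.cand.hf
  have h20 : (2 : F) = 0 := CharTwo.two_eq_zero
  have main : ∀ a b c d, U24 (tr χ (insert e L) g) a b c d → tr χ (insert e L) a b c = 0 →
      Ok f (tr χ (insert e L) g) (tr φ (insert e L) g) a b c d := by
    intro a b c d hu habc
    obtain ⟨h1, h2, h3, h4, h5, h6⟩ := tr_ne hV.cand.pl.card hJ hu.ab
    obtain ⟨k1, k2, k3, k4, k5, k6⟩ := tr_ne hV.cand.pl.card hJ hu.cd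
    by_cases hdbc : tr χ (insert e L) d b c = 0
    · have habd : tr χ (insert e L) a b d = 0 := by
        have := (ht.alt b).three c g a d
        rw [ht.rot b c a, ht.rot c a b, habc, ht.rot b c d, ht.rot c d b, hdbc, zero_mul, zero_mul,
          add_zero] at this
        rw [ht.comm]
        refine (mul_eq_zero.1 this).resolve_left ?_
        rw [← ht.rot g b c]
        exact hu.bc
      obtain ⟨h, hhX, hhL, hab⟩ :=
        (hV.cand.tern.exch hV.cand.pl).exists_tr hX hgX hgJ h1 h2 hu.ab
      rw [Ok, ht.cr_line h20 habc habd hab hu, ht'.cr_line CharTwo.two_eq_zero ((hs _ _ _).2 habc)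
        ((hs _ _ _).2 habd) (mt (hs _ _ _).1 hab) (hu.of_supp (hs g)), tr_eq_pr, tr_eq_pr]
      have hhg : g ≠ h := fun h0 => hgX (h0 ▸ hhX)
      exact hV.cand.symm.ok_of_notMem (by rw [Finset.card_insert_of_notMem hhL]; exact hJ)
        (by simp [hhg, hV.cand.ne.symm, hgL]) h1.symm h2.symm k1.symm k2.symm
    · rw [Ok, ht.cr_swap h20 habc hdbc hu, ht'.cr_swap CharTwo.two_eq_zero ((hs _ _ _).2 habc)
        (mt (hs _ _ _).1 hdbc) (hu.of_supp (hs g)), tr_eq_pr, tr_eq_pr, Finset.insert_comm,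
        ← tr_eq_pr, ← tr_eq_pr]
      rw [Finset.mem_insert, not_or] at k6
      exact hV.ok_insert (by rw [Finset.card_insert_of_notMem k6.2]; exact hL)
        (by simp [Ne.symm k6.1, heL]) (by simp [k2, hgL]) heX hgX hX _ _ _ _
  refine ok_of_u24 hf hq hq' (hs g) fun hu => ?_
  by_cases h1 : tr χ (insert e L) a b c = 0
  · exact main _ _ _ _ hu h1
  by_cases h2 : tr χ (insert e L) a b d = 0
  · exact (main _ _ _ _ (hu.swap_right hq) h2).swap_right hf
  by_cases h3 : tr χ (insert e L) a c d = 0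
  · exact ((main _ _ _ _ ((hu.swap_mid hq).swap_right hq) h3).swap_right hf).swap_mid' hf hq hq'
      (hs g) hu
  by_cases h4 : tr χ (insert e L) b c d = 0
  · exact (((main _ _ _ _ (((hu.swap_left hq).swap_mid hq).swap_right hq) h4).swap_right
      hf).swap_mid' hf hq hq' (hs g) (hu.swap_left hq)).swap_left hf
  refine (hV.cand.tern.tr_eq_zero hV.cand.pl hJ g a b c d hu.ab hu.ac hu.ad
    (by rw [ht.comm']; exact hu.bc) (by rw [ht.comm']; exact hu.bd) hu.cd ?_ ?_ ?_ ?_).elim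
  · rwa [ht.rot]
  · rwa [ht.rot]
  · rwa [ht.comm]
  · rwa [← ht.rot]

theorem CandV.lift (hV : CandV f E r χ φ e g) (heX : e ∉ X) (hgX : g ∉ X) (hX : χ X ≠ 0) :
    Lift f r χ φ := by
  refine ⟨hV.supp, fun J hJ a b c d => ?_⟩
  have single : ∀ {e g : α}, CandV f E r χ φ e g → e ∉ X → g ∉ X → e ∈ J → g ∉ J →
      Ok f (pr χ J) (pr φ J) a b c d := by
    intro e g hV heX hgX he hg
    have hc : (J.erase e).card + 3 = r := by
      have := Finset.card_erase_add_one he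
      omega
    have := hV.ok_insert hc (by simp) (by simp [hg]) heX hgX hX a b c d
    rwa [tr_eq_pr, tr_eq_pr, Finset.insert_erase he] at this
  by_cases he : e ∈ J
  · by_cases hg : g ∈ J
    · have hge : g ∈ J.erase e := Finset.mem_erase.2 ⟨hV.cand.ne.symm, hg⟩
      have hc : ((J.erase e).erase g).card + 4 = r := by
        have := Finset.card_erase_add_one he
        have := Finset.card_erase_add_one hge
        omega
      have := hV.ok_insert_insert hc (by simp) (by simp) heX hgX hX a b c d
      rwa [tr_eq_pr, tr_eq_pr, Finset.insert_comm, Finset.insert_erase hge,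
        Finset.insert_erase he] at this
    · exact single hV heX hgX he hg
  · by_cases hg : g ∈ J
    · exact single hV.symm hgX heX hg he
    · exact hV.ok_of_notMem hJ he hg a b c d

end Propagate

section Connect

variable {α F : Type*} [DecidableEq α] [Field F] {E X X' : Finset α} {r : ℕ} {χ : Finset α → F}
  {e g a b x x' y : α}

lemma eqvGen_trans_of {ρ σ : α → α → Prop} (h : ∀ a b, ρ a b → Relation.EqvGen σ a b) {a b : α}
    (hab : Relation.EqvGen ρ a b) : Relation.EqvGen σ a b := by
  induction hab with
  | rel _ _ h1 => exact h _ _ h1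
  | refl _ => exact .refl _
  | symm _ _ _ ih => exact ih.symm
  | trans _ _ _ _ _ ih1 ih2 => exact ih1.trans _ _ _ ih2

lemma edge_pivot_row (hy : y ∉ X) (hb : b ≠ y) (h : Edge χ X x b) :
    Edge χ (insert y (X.erase x)) y b := by
  refine ⟨by simp, by simp [hb, h.2.1], ?_⟩
  have := h.2.2
  rwa [ent, Finset.erase_insert (by simp [hy])]

lemma edge_pivot_swap (hX : χ X ≠ 0) (hx : x ∈ X) (hy : y ∉ X) :
    Edge χ (insert y (X.erase x)) y x := by
  have hxy : x ≠ y := fun h => hy (h ▸ hx)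
  refine ⟨by simp, by simp [hxy], ?_⟩
  rwa [ent, Finset.erase_insert (by simp [hy]), Finset.insert_erase hx]

lemma edge_pivot_col (hx : x ∈ X) (hax : a ≠ x) (h : Edge χ X a y) :
    Edge χ (insert y (X.erase x)) a x := by
  obtain ⟨h1, h2, h3⟩ := h
  have hxy : x ≠ y := fun h => h2 (h ▸ hx)
  have hay : a ≠ y := fun h => h2 (h ▸ h1)
  refine ⟨by simp [hax, h1], by simp [hxy], ?_⟩
  have : insert x ((insert y (X.erase x)).erase a) = insert y (X.erase a) := by
    ext i
    simp only [Finset.mem_insert, Finset.mem_erase]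
    grind
  rwa [ent, this]

/-- Under a pivot, an entry stays or both of its companions are nonzero. -/
lemma IsPlucker.edge_pivot_or (hχ : IsPlucker E r χ) (hX : χ X ≠ 0) (hxy : Edge χ X x y)
    (hax : a ≠ x) (hby : b ≠ y) (h : Edge χ X a b) :
    Edge χ (insert y (X.erase x)) a b ∨ (Edge χ X x b ∧ Edge χ X a y) := by
  by_cases h0 : ent χ X a y = 0 ∨ ent χ X x b = 0
  · exact .inl (hχ.edge_pivot_old hX hax hxy hby h0 h)
  · push Not at h0
    exact .inr ⟨⟨hxy.1, h.2.1, h0.2⟩, h.1, hxy.2.1, h0.1⟩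

lemma IsPlucker.eqvGen_pivot (hχ : IsPlucker E r χ) (hX : χ X ≠ 0) (hxy : Edge χ X x y)
    (h : Edge χ X a b) : Relation.EqvGen (Edge χ (insert y (X.erase x))) a b := by
  have hs : Relation.EqvGen (Edge χ (insert y (X.erase x))) x y :=
    .symm _ _ (.rel _ _ (edge_pivot_swap hX hxy.1 hxy.2.1))
  by_cases hax : a = x
  · subst hax
    by_cases hby : b = y
    · exact hby ▸ hs
    · exact hs.trans _ _ _ (.rel _ _ (edge_pivot_row hxy.2.1 hby h))
  · by_cases hby : b = y
    · subst hby
      exact .trans _ _ _ (.rel _ _ (edge_pivot_col hxy.1 hax h)) hs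
    · rcases hχ.edge_pivot_or hX hxy hax hby h with h1 | ⟨h1, h2⟩
      · exact .rel _ _ h1
      · exact .trans _ _ _ (.rel _ _ (edge_pivot_col hxy.1 hax h2))
          (.trans _ _ _ hs (.rel _ _ (edge_pivot_row hxy.2.1 hby h1)))

lemma Exch.exists_edge (eχ : Exch χ) (hχ : IsPlucker E r χ) (hX : χ X ≠ 0) (hX' : χ X' ≠ 0)
    (hne : X ≠ X') : ∃ x y, Edge χ X x y ∧ y ∈ X' ∧
      (insert y (X.erase x) \ X').card < (X \ X').card := by
  have : ¬ X ⊆ X' := fun h => hne (Finset.eq_of_subset_of_card_le h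
    ((hχ.card _ hX').trans (hχ.card _ hX).symm).le)
  obtain ⟨x, hx, hx'⟩ := Finset.not_subset.1 this
  obtain ⟨y, hy, hyX, hn⟩ := eχ X X' hX hX' x hx hx'
  refine ⟨x, y, ⟨hx, hyX, hn⟩, hy, Finset.card_lt_card ⟨fun i hi => ?_, fun h => ?_⟩⟩
  · simp only [Finset.mem_sdiff, Finset.mem_insert, Finset.mem_erase] at hi ⊢
    rcases hi with ⟨rfl | hi, h2⟩
    · exact absurd hy h2
    · exact ⟨hi.2, h2⟩
  · have h1 := h (Finset.mem_sdiff.2 ⟨hx, hx'⟩)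
    simp only [Finset.mem_sdiff, Finset.mem_insert, Finset.mem_erase] at h1
    rcases h1.1 with rfl | h1
    · exact hx' hy
    · exact h1.1 rfl

/-- The components of the fundamental graph do not depend on the base. -/
lemma IsPlucker.eqvGen_base (hχ : IsPlucker E r χ) (eχ : Exch χ) (hX' : χ X' ≠ 0) (n : ℕ) :
    ∀ X, (X \ X').card = n → χ X ≠ 0 → ∀ a b, Edge χ X a b → Relation.EqvGen (Edge χ X') a b := by
  induction n using Nat.strong_induction_on with
  | _ n ih =>
    intro X hn hX a b hab
    by_cases hne : X = X'
    · exact hne ▸ .rel _ _ hab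
    obtain ⟨x, y, hxy, -, hlt⟩ := eχ.exists_edge hχ hX hX' hne
    exact eqvGen_trans_of (ih _ (hn ▸ hlt) _ rfl hxy.2.2) (hχ.eqvGen_pivot hX hxy hab)

lemma exists_row_base (hχ : IsPlucker E r χ) (eχ : Exch (del e (del g χ)))
    (he : e ∉ X') (hg : g ∉ X') (hX' : χ X' ≠ 0) (n : ℕ) :
    ∀ X, (X \ X').card = n → e ∉ X → g ∉ X → χ X ≠ 0 → ∀ a, Edge χ X a e →
      ∃ x, Edge χ X' x e ∧ Relation.EqvGen (Edge (del e (del g χ)) X') a x := by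
  have hχ0 := (hχ.del g).del e
  have hX0 : ∀ {Y}, e ∉ Y → g ∉ Y → del e (del g χ) Y = χ Y := fun h1 h2 => by
    rw [del_base h1, del_base h2]
  induction n using Nat.strong_induction_on with
  | _ n ih =>
    intro X hn heX hgX hX a hae
    by_cases hne : X = X'
    · exact ⟨a, hne ▸ hae, .refl _⟩
    have hX1 := hX
    have hX2 := hX'
    rw [← hX0 heX hgX] at hX1
    rw [← hX0 he hg] at hX2
    obtain ⟨x, y, hxy0, hyX', hlt⟩ := eχ.exists_edge hχ0 hX1 hX2 hne
    obtain ⟨hxy, hye, hyg⟩ := (edge_del_del_iff heX hgX).1 hxy0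
    have hex : e ∉ insert y (X.erase x) := by simp [hye.symm, heX]
    have hgx : g ∉ insert y (X.erase x) := by simp [hyg.symm, hgX]
    have hxy' : Relation.EqvGen (Edge (del e (del g χ)) (insert y (X.erase x))) x y :=
      .symm _ _ (.rel _ _ (edge_pivot_swap hX1 hxy0.1 hxy0.2.1))
    obtain ⟨x₁, h1, h2⟩ : ∃ x₁, Edge χ (insert y (X.erase x)) x₁ e ∧
        Relation.EqvGen (Edge (del e (del g χ)) (insert y (X.erase x))) a x₁ := by
      by_cases hax : a = x
      · subst hax
        exact ⟨y, edge_pivot_row hxy.2.1 hye.symm hae, hxy'⟩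
      · rcases hχ.edge_pivot_or hX hxy hax hye.symm hae with h1 | ⟨h1, h2⟩
        · exact ⟨a, h1, .refl _⟩
        · exact ⟨y, edge_pivot_row hxy.2.1 hye.symm h1, .trans _ _ _ (.rel _ _
            (edge_pivot_col hxy.1 hax ((edge_del_del_iff heX hgX).2 ⟨h2, hye, hyg⟩))) hxy'⟩
    obtain ⟨x₀, h3, h4⟩ := ih _ (hn ▸ hlt) _ rfl hex hgx hxy.2.2 _ h1
    exact ⟨x₀, h3, .trans _ _ _
      (eqvGen_trans_of (hχ0.eqvGen_base eχ hX2 _ _ rfl hxy0.2.2) h2) h4⟩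

end Connect

section Glue

variable {α F K : Type*} [DecidableEq α] [Field F] [Field K]
  {f : F → K} {E J L X : Finset α} {r : ℕ} {χ : Finset α → F} {φ ψ₁ ψ₂ : Finset α → K}
  {e g a b c x x' x₁ y y₂ : α} [CharP F 2] [CharP K 2]

lemma del_comm (e g : α) (χ : Finset α → F) : del e (del g χ) = del g (del e χ) := by
  funext I
  simp only [del]
  split_ifs <;> rfl

lemma del_gauge (e : α) (k : K) (t : α → K) (ψ : Finset α → K) :
    del e (gauge k t ψ) = gauge k t (del e ψ) := by
  funext I
  simp only [del, gauge]
  split_ifs <;> simp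

lemma Cand.lift (h : Cand f E r χ φ e g) (he : e ∉ X) (hg : g ∉ X) (hX : χ X ≠ 0) (eφ : Exch φ)
    (hc : ∀ x x', Edge χ X x e → Edge χ X x' e →
      Relation.EqvGen (Edge (del e (del g χ)) X) x x') : Lift f r χ φ := by
  have hv : ∀ J x x', J.card + 2 = r → e ∉ J → g ∉ J → pr χ J x x' ≠ 0 → pr χ J x e ≠ 0 →
      pr χ J x g ≠ 0 → pr χ J x' e ≠ 0 → pr χ J x' g ≠ 0 →
      Ok f (pr χ J) (pr φ J) x x' e g := by
    intro J x x' hJ heJ hgJ h0 h1 h2 h3 h4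
    have n0 := pr_ne h.pl.card hJ h0
    have n1 := pr_ne h.pl.card hJ h1
    have n2 := pr_ne h.pl.card hJ h2
    have n3 := pr_ne h.pl.card hJ h3
    have n4 := pr_ne h.pl.card hJ h4
    set X' := insert x (insert x' J) with hX'def
    have heX' : e ∉ X' := by simp [hX'def, n1.1.symm, n3.1.symm, heJ]
    have hgX' : g ∉ X' := by simp [hX'def, n2.1.symm, n4.1.symm, hgJ]
    have hx : x ∈ X' := by simp [hX'def]
    have hx' : x' ∈ X' := by simp [hX'def]
    have hXx : X'.erase x = insert x' J := by
      rw [hX'def, Finset.erase_insert (by simp [n0.1, n0.2.1])]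
    have hXx' : X'.erase x' = insert x J := by
      rw [hX'def, Finset.insert_comm, Finset.erase_insert (by simp [n0.1.symm, n0.2.2])]
    have hJ' : (X'.erase x).erase x' = J := by rw [hXx, Finset.erase_insert n0.2.2]
    have hedge : ∀ u, pr χ J x u ≠ 0 → u ∉ X' → Edge χ X' x' u := fun u hu huX =>
      ⟨hx', huX, by rw [ent, hXx', Finset.insert_comm]; exact hu⟩
    have hedge' : ∀ u, pr χ J x' u ≠ 0 → u ∉ X' → Edge χ X' x u := fun u hu huX =>
      ⟨hx, huX, by rw [ent, hXx, Finset.insert_comm]; exact hu⟩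
    have hχ0 := (h.pl.del g).del e
    have eχ := ((h.tern.exch h.pl).del g).del e
    have hX0 : del e (del g χ) X' ≠ 0 := by rwa [del_base heX', del_base hgX']
    have hX1 : del e (del g χ) X ≠ 0 := by rwa [del_base he, del_base hg]
    obtain ⟨y, hy, hxy⟩ :=
      exists_row_base h.pl eχ he hg hX _ X' rfl heX' hgX' h0 x (hedge' e h3 heX')
    obtain ⟨y', hy', hxy'⟩ :=
      exists_row_base h.pl eχ he hg hX _ X' rfl heX' hgX' h0 x' (hedge e h1 heX')
    have hxx' := eqvGen_trans_of (hχ0.eqvGen_base eχ hX0 _ X rfl hX1)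
      ((hxy.trans _ _ _ (hc _ _ hy hy')).trans _ _ _ hxy'.symm)
    obtain ⟨n, hn⟩ := exists_rowDist hx' hx hxx'
    have := h.ok_of_rowDist n X' x x' heX' hgX' h0 hn n0.1 (hedge' e h3 heX') (hedge' g h4 hgX')
      (hedge e h1 heX') (hedge g h2 hgX')
    rwa [hJ'] at this
  exact CandV.lift ⟨h, h.supp_all eφ he hg hX hv, hv⟩ he hg hX

lemma Lift.lift_id (h₁ : Lift f r χ ψ₁) (h₂ : Lift f r χ ψ₂) : Lift id r ψ₁ ψ₂ :=
  ⟨fun I => (h₂.supp I).trans (h₁.supp I).symm,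
    fun J hJ a b c d => (h₁.ok J hJ a b c d).symm.trans (h₂.ok J hJ a b c d)⟩

/-- Lifts of two deletions can be combined. -/
theorem exists_lift_of_del (hf : CrMap f) (hχ : IsPlucker E r χ) (ht : Ternary E χ) (hX : χ X ≠ 0)
    (hne : e ≠ g) (he : e ∉ X) (hg : g ∉ X)
    (hc : ∀ x x', Edge χ X x e → Edge χ X x' e → Relation.EqvGen (Edge (del e (del g χ)) X) x x')
    (h₁ : ∃ ψ : Finset α → K, Lift f r (del e χ) ψ)
    (h₂ : ∃ ψ : Finset α → K, Lift f r (del g χ) ψ) :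
    ∃ φ : Finset α → K, Lift f r χ φ := by
  obtain ⟨ψ₁, h₁⟩ := h₁
  obtain ⟨ψ₂, h₂⟩ := h₂
  have h₁' := h₁.del hf g
  have h₂' := h₂.del hf e
  rw [← del_comm] at h₁'
  have hχ0 := (hχ.del g).del e
  have eχ := ht.exch hχ
  have hX0 : del e (del g χ) X ≠ 0 := by rwa [del_base he, del_base hg]
  obtain ⟨k, t, hk, ht0, hkt⟩ := (h₁'.lift_id h₂').exists_gauge _ _ _ _ rfl
    (h₁'.isPlucker hf hχ0) (((eχ.del g).del e).congr h₁'.supp) (mt (h₁'.supp _).1 hX0)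
  rw [← del_gauge] at hkt
  have h₁ := h₁.gauge (hχ.del e) hk ht0
  generalize CrossRatioLift.gauge k t ψ₁ = ψ₁ at *
  have p₁ := h₁.isPlucker hf (hχ.del e)
  have p₂ := h₂.isPlucker hf (hχ.del g)
  have e₁ := (eχ.del e).congr h₁.supp
  have e₂ := (eχ.del g).congr h₂.supp
  have hag : ∀ I, e ∉ I → g ∉ I → ψ₂ I = ψ₁ I := fun I h1 h2 => by
    rw [← del_base (χ := ψ₂) h1, ← del_base (χ := ψ₁) h2, hkt]
  have hX1 : ψ₁ X ≠ 0 := mt (h₁.supp X).1 (by rwa [del_base he])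
  obtain ⟨v, hv0, hvX, hv⟩ := exists_vdet (hχ.card X hX) (hχ.sub X hX)
    (fun x y => (if y = e then ψ₂ else ψ₁) (insert y (X.erase x)) / ψ₁ X)
  set φ := CrossRatioLift.gauge (ψ₁ X) (fun _ => 1) (vdet v) with hφ
  have hφI : ∀ I, φ I = ψ₁ X * vdet v I := fun I => by simp [hφ, CrossRatioLift.gauge]
  have pφ : IsPlucker E r φ := (Lift.refl.gauge (vdet_isPlucker v hv0) hX1
    (t := fun _ => 1) (by simp)).isPlucker crMap_id (vdet_isPlucker v hv0)
  have eφ : Exch φ := (vdet_exch v).gauge hX1 (by simp)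
  have hφX : φ X = ψ₁ X := by rw [hφI, hvX, mul_one]
  have hφy : ∀ x ∈ X, ∀ y ∈ E, y ∉ X → φ (insert y (X.erase x)) =
      (if y = e then ψ₂ else ψ₁) (insert y (X.erase x)) := fun x hx y hy hyX => by
    rw [hφI, hv x hx y hy hyX]
    field_simp
  have hnot : ∀ {x y z}, z ∉ X → y ≠ z → z ∉ insert y (X.erase x) := fun h1 h2 => by
    simp [h1, h2.symm]
  have d₁ : del e φ = ψ₁ := by
    refine (pφ.del e).eq_of_entries p₁ (eφ.del e) e₁ (X := X) ?_ ?_ ?_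
    · rwa [del_base he, hφX]
    · rw [del_base he, hφX]
    · intro x hx y hy hyX
      rw [Finset.mem_erase] at hy
      rw [del_base (hnot he hy.1), hφy x hx y hy.2 hyX, if_neg hy.1]
  have d₂ : del g φ = ψ₂ := by
    refine (pφ.del g).eq_of_entries p₂ (eφ.del g) e₂ (X := X) ?_ ?_ ?_
    · rwa [del_base hg, hφX]
    · rw [del_base hg, hφX, hag X he hg]
    · intro x hx y hy hyX
      rw [Finset.mem_erase] at hy
      rw [del_base (hnot hg hy.1), hφy x hx y hy.2 hyX]
      split_ifs with h0
      · rfl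
      · exact (hag _ (hnot he h0) (hnot hg hy.1)).symm
  exact ⟨φ, Cand.lift ⟨hf, hχ, ht, pφ, hne, d₁ ▸ h₁, d₂ ▸ h₂⟩ he hg hX eφ hc⟩

end Glue

section Small

lemma forall_perm_three {α : Type*} {T : α → α → α → Prop} {a b c a' b' c' : α}
    (h₁ : ∀ a b c, T a b c → T b a c) (h₂ : ∀ a b c, T a b c → T a c b) (h : T a b c)
    (ha : a' = a ∨ a' = b ∨ a' = c) (hb : b' = a ∨ b' = b ∨ b' = c)
    (hc : c' = a ∨ c' = b ∨ c' = c) (hab : a' ≠ b') (hac : a' ≠ c') (hbc : b' ≠ c') :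
    T a' b' c' := by
  rcases ha with rfl | rfl | rfl <;> rcases hb with rfl | rfl | rfl <;>
    rcases hc with rfl | rfl | rfl <;> first | contradiction | skip
  · exact h
  · exact h₂ _ _ _ h
  · exact h₁ _ _ _ h
  · exact h₂ _ _ _ (h₁ _ _ _ h)
  · exact h₁ _ _ _ (h₂ _ _ _ h)
  · exact h₁ _ _ _ (h₂ _ _ _ (h₁ _ _ _ h))

lemma forall_perm_four {α : Type*} {S : α → α → α → α → Prop} {a b c d a' b' c' d' : α}
    (h₁ : ∀ a b c d, S a b c d → S b a c d) (h₂ : ∀ a b c d, S a b c d → S a c b d)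
    (h₃ : ∀ a b c d, S a b c d → S a b d c) (h : S a b c d)
    (ha : a' = a ∨ a' = b ∨ a' = c ∨ a' = d) (hb : b' = a ∨ b' = b ∨ b' = c ∨ b' = d)
    (hc : c' = a ∨ c' = b ∨ c' = c ∨ c' = d) (hd : d' = a ∨ d' = b ∨ d' = c ∨ d' = d)
    (hab : a' ≠ b') (hac : a' ≠ c') (had : a' ≠ d') (hbc : b' ≠ c') (hbd : b' ≠ d')
    (hcd : c' ≠ d') : S a' b' c' d' := by
  have key : ∀ x y z, S x y z d' → (a' = x ∨ a' = y ∨ a' = z) → (b' = x ∨ b' = y ∨ b' = z) →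
      (c' = x ∨ c' = y ∨ c' = z) → S a' b' c' d' := fun x y z h h1 h2 h3 =>
    forall_perm_three (T := fun a b c => S a b c d') (fun _ _ _ => h₁ _ _ _ _)
      (fun _ _ _ => h₂ _ _ _ _) h h1 h2 h3 hab hac hbc
  rcases hd with rfl | rfl | rfl | rfl
  · exact key b c d (h₃ _ _ _ _ (h₂ _ _ _ _ (h₁ _ _ _ _ h))) (by grind) (by grind) (by grind)
  · exact key a c d (h₃ _ _ _ _ (h₂ _ _ _ _ h)) (by grind) (by grind) (by grind)
  · exact key a b d (h₃ _ _ _ _ h) (by grind) (by grind) (by grind)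
  · exact key a b c h (by grind) (by grind) (by grind)

variable {α F K : Type*} [DecidableEq α] [Field F] [Field K]
  {f : F → K} {E : Finset α} {r : ℕ} {χ : Finset α → F} [CharP F 2] [CharP K 2]

lemma Alt2.ne_zero_of_u24 {q : α → α → F} (hs : Alt2 q) {a b c d i j : α} (hu : U24 q a b c d)
    (hi : i = a ∨ i = b ∨ i = c ∨ i = d) (hj : j = a ∨ j = b ∨ j = c ∨ j = d) (hij : i ≠ j) :
    q i j ≠ 0 := by
  obtain ⟨h1, h2, h3, h4, h5, h6⟩ := hu
  rcases hi with rfl | rfl | rfl | rfl <;> rcases hj with rfl | rfl | rfl | rfl <;>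
    first | contradiction | assumption | (rw [hs.comm]; assumption)

/-- If there are no four pairwise independent points, then the indicator of the support is a
lift. -/
lemma IsPlucker.lift_of_no_u24 (hf : CrMap f) (hχ : IsPlucker E r χ)
    (h : ∀ J, J.card + 2 = r → ∀ a b c d, ¬ U24 (pr χ J) a b c d) :
    ∃ ψ : Finset α → K, Lift f r χ ψ := by
  classical
  set ψ : Finset α → K := fun I => if χ I = 0 then 0 else 1 with hψ
  have hs : ∀ I, ψ I = 0 ↔ χ I = 0 := fun I => by simp [hψ]
  refine ⟨ψ, .of_u24 hf hχ ⟨fun I hI => hχ.card I (mt (hs I).2 hI),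
    fun I hI => hχ.sub I (mt (hs I).2 hI), fun J hJ a b c d => ?_⟩ hs
    fun J hJ a b c d hu => absurd hu (h J hJ a b c d)⟩
  have h3 := hχ.three J hJ a b c d
  have hp : ∀ a b c d, pr ψ J a b * pr ψ J c d =
      if pr χ J a b * pr χ J c d = 0 then 0 else 1 := fun a b c d => by
    simp only [pr, hψ, mul_eq_zero]
    split_ifs <;> simp_all
  have h0 : ¬ (pr χ J a b * pr χ J c d ≠ 0 ∧ pr χ J a c * pr χ J b d ≠ 0 ∧
      pr χ J a d * pr χ J b c ≠ 0) := by
    simp only [ne_eq, mul_eq_zero, not_or]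
    exact fun ⟨⟨h1, h2⟩, ⟨h3, h4⟩, h5, h6⟩ => h J hJ a b c d ⟨h1, h3, h5, h6, h4, h2⟩
  rw [hp, hp, hp]
  generalize pr χ J a b * pr χ J c d = x at *
  generalize pr χ J a c * pr χ J b d = y at *
  generalize pr χ J a d * pr χ J b c = z at *
  have h2 : (1 : K) + 1 = 0 := CharTwo.add_self_eq_zero 1
  subst h3
  by_cases hy : y = 0 <;> by_cases hz : z = 0 <;> simp_all

lemma IsPlucker.lift_of_card_le_four (hf : CrMap f) (hχ : IsPlucker E r χ) (hE : E.card ≤ 4) :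
    ∃ ψ : Finset α → K, Lift f r χ ψ := by
  classical
  by_cases hno : ∀ J, J.card + 2 = r → ∀ a b c d, ¬ U24 (pr χ J) a b c d
  · exact hχ.lift_of_no_u24 hf hno
  push Not at hno
  obtain ⟨J, hJ, a, b, c, d, hu⟩ := hno
  obtain ⟨hab, haJ, hbJ⟩ := pr_ne hχ.card hJ hu.ab
  obtain ⟨hcd, hcJ, hdJ⟩ := pr_ne hχ.card hJ hu.cd
  have hac := (pr_ne hχ.card hJ hu.ac).1
  have had := (pr_ne hχ.card hJ hu.ad).1
  have hbc := (pr_ne hχ.card hJ hu.bc).1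
  have hbd := (pr_ne hχ.card hJ hu.bd).1
  have hcard : (insert a (insert b (insert c (insert d J)))).card = J.card + 4 := by
    rw [Finset.card_insert_of_notMem, Finset.card_insert_of_notMem, Finset.card_insert_of_notMem,
      Finset.card_insert_of_notMem] <;> simp [*]
  have hsub : insert a (insert b (insert c (insert d J))) ⊆ E := by
    have h1 := hχ.sub _ hu.ab
    have h2 := hχ.sub _ hu.cd
    simp only [Finset.insert_subset_iff] at h1 h2 ⊢
    tauto
  have h4 := Finset.card_le_card hsub
  obtain rfl : J = ∅ := Finset.card_eq_zero.1 (by omega)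
  obtain rfl : r = 2 := by simpa using hJ.symm
  have hE' := Finset.eq_of_subset_of_card_le hsub (by omega)
  have hmem : ∀ i, i ∈ E ↔ i = a ∨ i = b ∨ i = c ∨ i = d := fun i => by simp [← hE']
  clear hsub hcard h4
  set q := pr χ ∅ with hq
  set l := cr q a b c d with hl
  have hqa : Alt2 q := hχ.alt2 hJ
  have hl0 : l ≠ 0 := by
    simp [hl, cr, hu.ac, hu.bd, hu.ad, hu.bc]
  have hl1 : f l + 1 ≠ 0 := by
    intro h
    have h1 := hqa.cr_swap_mid hu.ad hu.bc
    have h2 : f (1 + l) = 0 := by rw [hf.map_one_add, add_comm, h]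
    rw [← hl, hf.eq_zero _ h2] at h1
    simp [cr, hu.ab, hu.cd, hu.ad, hqa.comm c b, hu.bc] at h1
  have hfl : f l ≠ 0 := fun h => hl0 (hf.eq_zero _ h)
  obtain ⟨v, hv0, hvX, hv⟩ := exists_vdet (K := K) (Finset.card_pair hab)
    (show {a, b} ⊆ E by simp [Finset.insert_subset_iff, hmem])
    (fun x y => if y = d ∧ x = a then f l else 1)
  have pψ := vdet_isPlucker v hv0
  set p := pr (vdet v) ∅ with hp
  have hpa : Alt2 p := pψ.alt2 hJ
  have ea : ({a, b} : Finset α).erase a = {b} := by ext i; simp; grind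
  have eb : ({a, b} : Finset α).erase b = {a} := by ext i; simp; grind
  have pab : p a b = 1 := by simpa [hp, pr] using hvX
  have pbc : p b c = 1 := by
    have := hv a (by simp) c (by simp [hmem]) (by simp [hac.symm, hbc.symm])
    rw [ea] at this
    rw [hpa.comm]
    simpa [hp, pr, hcd] using this
  have pac : p a c = 1 := by
    have := hv b (by simp) c (by simp [hmem]) (by simp [hac.symm, hbc.symm])
    rw [eb] at this
    rw [hpa.comm]
    simpa [hp, pr, hcd] using this
  have pbd : p b d = f l := by
    have := hv a (by simp) d (by simp [hmem]) (by simp [had.symm, hbd.symm])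
    rw [ea] at this
    rw [hpa.comm]
    simpa [hp, pr] using this
  have pad : p a d = 1 := by
    have := hv b (by simp) d (by simp [hmem]) (by simp [had.symm, hbd.symm])
    rw [eb] at this
    rw [hpa.comm]
    simpa [hp, pr, hab.symm] using this
  have pcd : p c d = f l + 1 := by
    have := hpa.three a b c d
    rw [pab, pbc, pac, pbd, pad] at this
    linear_combination this
  have hpu : U24 p a b c d := ⟨by simp [pab], by simp [pac], by simp [pad], by simp [pbc],
    by rwa [pbd], by rwa [pcd]⟩
  have hok : Ok f q p a b c d := by
    rw [Ok, ← hl, cr, pac, pbd, pad, pbc]; simp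
  refine ⟨vdet v, .of_u24 hf hχ pψ (fun I => ?_) fun J hJ a' b' c' d' hu' => ?_⟩
  · by_cases hI : I.card = 2 ∧ I ⊆ E
    · obtain ⟨i, j, hij, rfl⟩ := Finset.card_eq_two.1 hI.1
      simp only [Finset.insert_subset_iff, Finset.singleton_subset_iff] at hI
      have h1 := hqa.ne_zero_of_u24 hu ((hmem i).1 hI.2.1) ((hmem j).1 hI.2.2) hij
      have h2 := hpa.ne_zero_of_u24 hpu ((hmem i).1 hI.2.1) ((hmem j).1 hI.2.2) hij
      simp only [hp, hq, pr] at h1 h2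
      exact iff_of_false h2 h1
    · rw [not_and_or] at hI
      have h1 : χ I = 0 := by
        by_contra h
        exact hI.elim (fun h0 => h0 (hχ.card _ h)) (fun h0 => h0 (hχ.sub _ h))
      have h2 : vdet v I = 0 := by
        by_contra h
        exact hI.elim (fun h0 => h0 (pψ.card _ h)) (fun h0 => h0 (pψ.sub _ h))
      exact iff_of_true h2 h1
  · obtain rfl : J = ∅ := Finset.card_eq_zero.1 (by omega)
    have hm1 := hχ.sub _ hu'.ab
    have hm2 := hχ.sub _ hu'.cd
    simp only [Finset.insert_subset_iff, hmem] at hm1 hm2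
    have := forall_perm_four (S := fun a b c d => U24 q a b c d ∧ U24 p a b c d ∧ Ok f q p a b c d)
      (fun _ _ _ _ h => ⟨h.1.swap_left hqa, h.2.1.swap_left hpa, h.2.2.swap_left hf⟩)
      (fun _ _ _ _ h => ⟨h.1.swap_mid hqa, h.2.1.swap_mid hpa,
        h.2.2.swap_mid hf hqa hpa h.1.ad h.1.bc h.2.1.ad h.2.1.bc⟩)
      (fun _ _ _ _ h => ⟨h.1.swap_right hqa, h.2.1.swap_right hpa, h.2.2.swap_right hf⟩)
      ⟨hu, hpu, hok⟩ hm1.1 hm1.2.1 hm2.1 hm2.2.1 (pr_ne hχ.card hJ hu'.ab).1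
      (pr_ne hχ.card hJ hu'.ac).1 (pr_ne hχ.card hJ hu'.ad).1 (pr_ne hχ.card hJ hu'.bc).1
      (pr_ne hχ.card hJ hu'.bd).1 (pr_ne hχ.card hJ hu'.cd).1
    exact this.2.2

end Small

section Graph

variable {α : Type*} {A : α → α → Prop} {e g w x y z : α}

/-- The neighbours of `e` are connected in the graph `A` without `e` and `g`. -/
def Good (A : α → α → Prop) (e g : α) : Prop :=
  ∀ x x', A e x → A e x' →
    Relation.EqvGen (fun a b => A a b ∧ (a ≠ e ∧ a ≠ g) ∧ b ≠ e ∧ b ≠ g) x x'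

lemma good_of_subsingleton (h : ∀ x x', A e x → A e x' → x = x') : Good A e g :=
  fun x x' hx hx' => h x x' hx hx' ▸ .refl _

/-- A bipartite graph with a vertex of degree three has two good vertices in the same class. -/
lemma exists_good_of_three [DecidableEq α] {E X : Finset α} (hs : ∀ a b, A a b → A b a)
    (hE : ∀ a b, A a b → a ∈ E) (hX : ∀ a b, A a b → (a ∈ X ↔ b ∉ X)) (hx : A w x) (hy : A w y)
    (hz : A w z) (hxy : x ≠ y) (hxz : x ≠ z) (hyz : y ≠ z) :
    ∃ e ∈ E, ∃ g ∈ E, e ≠ g ∧ (e ∈ X ↔ g ∈ X) ∧ Good A e g := by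
  classical
  set N : Finset α → Finset α := fun T => E.filter fun u => u ∉ T ∧ ∃ t ∈ T, A t u with hN
  have memN : ∀ T u, u ∈ N T ↔ u ∈ E ∧ u ∉ T ∧ ∃ t ∈ T, A t u := fun T u => by simp [hN]
  set P : Finset α → Prop := fun T => w ∈ T ∧
    (∀ t ∈ T, Relation.EqvGen (fun a b => A a b ∧ a ∈ T ∧ b ∈ T) w t) ∧ 3 ≤ (N T).card with hP
  have hwN : ∀ u, A w u → u ∈ N {w} := fun u hu => by
    rw [memN]
    refine ⟨hE _ _ (hs _ _ hu), ?_, w, by simp, hu⟩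
    simp only [Finset.mem_singleton]
    rintro rfl
    have := hX _ _ hu
    tauto
  have hPw : {w} ∈ E.powerset.filter P := by
    simp only [Finset.mem_filter, Finset.mem_powerset, Finset.singleton_subset_iff, hP,
      Finset.mem_singleton, forall_eq, true_and]
    refine ⟨hE _ _ hx, .refl _, ?_⟩
    rw [← Finset.card_eq_three.2 ⟨x, y, z, hxy, hxz, hyz, rfl⟩]
    apply Finset.card_le_card
    simp [Finset.insert_subset_iff, hwN, hx, hy, hz]
  obtain ⟨T, hT, hmax⟩ := Finset.exists_max_image _ Finset.card ⟨_, hPw⟩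
  simp only [Finset.mem_filter, Finset.mem_powerset] at hT hmax
  obtain ⟨hTE, hwT, hconn, h3⟩ := hT
  have hins : ∀ u ∈ N T, N (insert u T) = (N T).erase u := fun u hu => by
    obtain ⟨huE, huT, t, ht, htu⟩ := (memN _ _).1 hu
    have hsub : (N T).erase u ⊆ N (insert u T) := fun v hv => by
      rw [Finset.mem_erase, memN] at hv
      rw [memN]
      obtain ⟨hvu, h1, h2, s, hs, hsv⟩ := hv
      exact ⟨h1, by simp [hvu, h2], s, by simp [hs], hsv⟩
    refine (Finset.eq_of_subset_of_card_le hsub ?_).symm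
    rw [Finset.card_erase_of_mem hu]
    by_contra! hlt
    have hmono : ∀ t ∈ T, Relation.EqvGen (fun a b => A a b ∧ a ∈ insert u T ∧ b ∈ insert u T) w t :=
      fun t ht => (hconn t ht).mono fun a b h => ⟨h.1, by simp [h.2.1], by simp [h.2.2]⟩
    have := hmax (insert u T) ⟨Finset.insert_subset huE hTE, by simp [hwT], fun s hs => ?_,
      by omega⟩
    · rw [Finset.card_insert_of_notMem huT] at this
      omega
    · rcases Finset.mem_insert.1 hs with rfl | hs
      · exact .trans _ _ _ (hmono t ht) (.rel _ _ ⟨htu, by simp [ht], by simp⟩)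
      · exact hmono s hs
  obtain ⟨U, hU, hU3⟩ := Finset.exists_subset_card_eq h3
  obtain ⟨e, he, g, hg, hne, hcl⟩ : ∃ e ∈ N T, ∃ g ∈ N T, e ≠ g ∧ (e ∈ X ↔ g ∈ X) := by
    obtain ⟨a, b, c, hab, hac, hbc, rfl⟩ := Finset.card_eq_three.1 hU3
    have ha := hU (show a ∈ _ by simp)
    have hb := hU (show b ∈ _ by simp)
    have hc := hU (show c ∈ _ by simp)
    by_cases h1 : a ∈ X ↔ b ∈ X
    · exact ⟨a, ha, b, hb, hab, h1⟩
    by_cases h2 : a ∈ X ↔ c ∈ X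
    · exact ⟨a, ha, c, hc, hac, h2⟩
    · exact ⟨b, hb, c, hc, hbc, by tauto⟩
  have heT := ((memN _ _).1 he).2.1
  have hgT := ((memN _ _).1 hg).2.1
  refine ⟨e, ((memN _ _).1 he).1, g, ((memN _ _).1 hg).1, hne, hcl, ?_⟩
  have hT' : ∀ t ∈ T, t ≠ e ∧ t ≠ g := fun t ht =>
    ⟨fun h => heT (h ▸ ht), fun h => hgT (h ▸ ht)⟩
  have hwt : ∀ t ∈ T,
      Relation.EqvGen (fun a b => A a b ∧ (a ≠ e ∧ a ≠ g) ∧ b ≠ e ∧ b ≠ g) w t := fun t ht =>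
    (hconn t ht).mono fun a b h => ⟨h.1, hT' a h.2.1, hT' b h.2.2⟩
  have key : ∀ v, A e v →
      Relation.EqvGen (fun a b => A a b ∧ (a ≠ e ∧ a ≠ g) ∧ b ≠ e ∧ b ≠ g) w v := fun v hv => by
    have hcv := hX _ _ hv
    have hve : v ≠ e := by rintro rfl; tauto
    have hvg : v ≠ g := by rintro rfl; tauto
    by_cases hvT : v ∈ T
    · exact hwt v hvT
    · have : v ∈ N (insert e T) := (memN _ _).2
        ⟨hE _ _ (hs _ _ hv), by simp [hve, hvT], e, by simp, hv⟩
      rw [hins e he, Finset.mem_erase, memN] at this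
      obtain ⟨-, -, -, t, ht, htv⟩ := this
      exact .trans _ _ _ (hwt t ht) (.rel _ _ ⟨htv, hT' t ht, hve, hvg⟩)
  exact fun v v' hv hv' => .trans _ _ _ (.symm _ _ (key v hv)) (key v' hv')

end Graph

section Main

variable {α F : Type*} [DecidableEq α] [Field F] {E X : Finset α} {r : ℕ} {χ : Finset α → F}
  {e g a b : α}

/-- The symmetric fundamental graph of the base `X`. -/
def Adj (χ : Finset α → F) (X : Finset α) (a b : α) : Prop := Edge χ X a b ∨ Edge χ X b a

lemma Adj.symm (h : Adj χ X a b) : Adj χ X b a := Or.symm h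

lemma Adj.mem_iff (h : Adj χ X a b) : a ∈ X ↔ b ∉ X := by
  rcases h with h | h
  · exact iff_of_true h.1 h.2.1
  · exact iff_of_false h.2.1 (not_not.2 h.1)

lemma Adj.mem (hχ : IsPlucker E r χ) (hX : χ X ≠ 0) (h : Adj χ X a b) : a ∈ E := by
  rcases h with h | h
  · exact hχ.sub X hX h.1
  · exact hχ.sub _ h.2.2 (Finset.mem_insert_self _ _)

/-- Some base has two good elements on the same side. -/
lemma IsPlucker.exists_good (hχ : IsPlucker E r χ) (hX : χ X ≠ 0) (hE : 5 ≤ E.card) :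
    ∃ X, χ X ≠ 0 ∧ ∃ e ∈ E, ∃ g ∈ E, e ≠ g ∧ (e ∈ X ↔ g ∈ X) ∧ Good (Adj χ X) e g := by
  by_contra hno
  have hno : ∀ X, χ X ≠ 0 → ∀ e ∈ E, ∀ g ∈ E, e ≠ g → (e ∈ X ↔ g ∈ X) → Good (Adj χ X) e g →
      False := fun X h1 e h2 g h3 h4 h5 h6 => hno ⟨X, h1, e, h2, g, h3, h4, h5, h6⟩
  have hdeg : ∀ X, χ X ≠ 0 → ∀ w x y z, Adj χ X w x → Adj χ X w y → Adj χ X w z → x ≠ y → x ≠ z →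
      y ≠ z → False := fun X hX w x y z h1 h2 h3 h4 h5 h6 => by
    obtain ⟨e, he, g, hg, h⟩ := exists_good_of_three (X := X) (fun _ _ h => Adj.symm h)
      (fun _ _ h => h.mem hχ hX) (fun _ _ h => h.mem_iff) h1 h2 h3 h4 h5 h6
    exact hno X hX e he g hg h.1 h.2.1 h.2.2
  have hpartner : ∀ e ∈ E, ∃ g ∈ E, e ≠ g ∧ (e ∈ X ↔ g ∈ X) := fun e he => by
    by_contra! h
    have hc : 1 < (E.erase e).card := by rw [Finset.card_erase_of_mem he]; omega
    obtain ⟨a, ha, b, hb, hab⟩ := Finset.one_lt_card.1 hc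
    rw [Finset.mem_erase] at ha hb
    have h1 := h a ha.2 ha.1.symm
    have h2 := h b hb.2 hb.1.symm
    have key : ∀ x, Adj χ X a x → x = e := fun x hx => by
      by_contra hxe
      have h3 := h x (hx.symm.mem hχ hX) (Ne.symm hxe)
      have h4 := hx.mem_iff
      tauto
    refine hno X hX a ha.2 b hb.2 hab (by tauto) (good_of_subsingleton fun x x' hx hx' => ?_)
    rw [key x hx, key x' hx']
  have htwo : ∀ e ∈ E, ∃ x x', Adj χ X e x ∧ Adj χ X e x' ∧ x ≠ x' := fun e he => by
    by_contra! h
    obtain ⟨g, hg, hne, hcl⟩ := hpartner e he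
    exact hno X hX e he g hg hne hcl (good_of_subsingleton h)
  have hother : ∀ e ∈ E, ∀ y, ∃ x, Adj χ X e x ∧ x ≠ y := fun e he y => by
    obtain ⟨x, x', h1, h2, h3⟩ := htwo e he
    by_cases h : x = y
    · exact ⟨x', h2, fun h' => h3 (h.trans h'.symm)⟩
    · exact ⟨x, h1, h⟩
  obtain ⟨y₀, hy₀, hy₀X⟩ : ∃ y₀ ∈ E, y₀ ∉ X := by
    obtain ⟨e, he⟩ := Finset.card_pos.1 (show 0 < E.card by omega)
    by_cases heX : e ∈ X
    · obtain ⟨x, -, h, -⟩ := htwo e he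
      exact ⟨x, h.symm.mem hχ hX, h.mem_iff.1 heX⟩
    · exact ⟨e, he, heX⟩
  have hcol : ∀ {x y}, y ∉ X → Adj χ X y x → Edge χ X x y := fun hy h =>
    h.resolve_left fun h => hy h.1
  have hrow : ∀ {x y}, x ∈ X → Adj χ X x y → Edge χ X x y := fun hx h =>
    h.resolve_right fun h => h.2.1 hx
  obtain ⟨x₀, x₁, h₀, h₁, hne⟩ := htwo y₀ hy₀
  replace h₀ := hcol hy₀X h₀
  replace h₁ := hcol hy₀X h₁
  obtain ⟨y₁, h₂, hy₁⟩ := hother x₀ (hχ.sub X hX h₀.1) y₀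
  obtain ⟨y₂, h₃, hy₂⟩ := hother x₁ (hχ.sub X hX h₁.1) y₀
  replace h₂ := hrow h₀.1 h₂
  replace h₃ := hrow h₁.1 h₃
  by_cases h₄ : Edge χ X x₁ y₁
  · obtain ⟨z, hz, hzn⟩ : ∃ z ∈ E, z ∉ ({x₀, x₁, y₀, y₁} : Finset α) :=
      Finset.exists_mem_notMem_of_card_lt_card (Finset.card_le_four.trans_lt hE)
    simp only [Finset.mem_insert, Finset.mem_singleton, not_or] at hzn
    have hm : ∀ {a b}, a ∈ X → b ∉ X → a ≠ b := fun ha hb h => hb (h ▸ ha)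
    by_cases hzX : z ∈ X
    · have key : ∀ v, Adj χ X x₀ v → Relation.EqvGen (fun a b => Adj χ X a b ∧
          (a ≠ x₀ ∧ a ≠ z) ∧ b ≠ x₀ ∧ b ≠ z) x₁ v := fun v hv => by
        have hv' := hrow h₀.1 hv
        refine .rel _ _ ⟨.inl ?_, ⟨hne.symm, Ne.symm hzn.2.1⟩, (hm h₀.1 hv'.2.1).symm,
          (hm hzX hv'.2.1).symm⟩
        by_contra h
        exact hdeg X hX x₀ y₀ y₁ v (.inl h₀) (.inl h₂) hv hy₁.symm (fun h' => h (h' ▸ h₁))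
          (fun h' => h (h' ▸ h₄))
      exact hno X hX x₀ (hχ.sub X hX h₀.1) z hz (Ne.symm hzn.1) (iff_of_true h₀.1 hzX)
        fun v v' hv hv' => .trans _ _ _ (.symm _ _ (key v hv)) (key v' hv')
    · have key : ∀ v, Adj χ X y₀ v → Relation.EqvGen (fun a b => Adj χ X a b ∧
          (a ≠ y₀ ∧ a ≠ z) ∧ b ≠ y₀ ∧ b ≠ z) y₁ v := fun v hv => by
        have hv' := hcol hy₀X hv
        refine .rel _ _ ⟨.inr ?_, ⟨hy₁, Ne.symm hzn.2.2.2⟩, hm hv'.1 hy₀X, hm hv'.1 hzX⟩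
        by_contra h
        exact hdeg X hX y₀ x₀ x₁ v (.inr h₀) (.inr h₁) hv hne (fun h' => h (h' ▸ h₂))
          (fun h' => h (h' ▸ h₄))
      exact hno X hX y₀ hy₀ z hz (Ne.symm hzn.2.2.1) (iff_of_false hy₀X hzX)
        fun v v' hv hv' => .trans _ _ _ (.symm _ _ (key v hv)) (key v' hv')
  · have h12 : y₁ ≠ y₂ := fun h => h₄ (h ▸ h₃)
    have h₅ : ent χ X x₀ y₂ = 0 := by
      by_contra h
      exact hdeg X hX x₀ y₀ y₁ y₂ (.inl h₀) (.inl h₂) (.inl ⟨h₀.1, h₃.2.1, h⟩) hy₁.symm hy₂.symm h12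
    have h₆ : ent χ X x₁ y₁ = 0 := by
      by_contra h
      exact h₄ ⟨h₁.1, h₂.2.1, h⟩
    have hx : ∀ {y}, y ∉ X → x₀ ≠ y := fun hy h => hy (h ▸ h₀.1)
    exact hdeg _ h₀.2.2 x₁ x₀ y₁ y₂ (.inl (edge_pivot_col h₀.1 hne.symm h₁))
      (.inl (hχ.edge_pivot_new hX hne.symm h₀ h₆ h₁ h₂))
      (.inl (hχ.edge_pivot_old hX hne.symm h₀ hy₂ (.inr h₅) h₃)) (hx h₂.2.1) (hx h₃.2.1) h12

lemma edge_dual_iff (hX : X ⊆ E) (ha : a ∈ E) (hb : b ∈ E) :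
    Edge (dual E χ) (E \ X) b a ↔ Edge χ X a b := by
  simp only [Edge, Finset.mem_sdiff, hb, ha, true_and, not_not]
  have : b ∉ X → a ∈ X → ent (dual E χ) (E \ X) b a = ent χ X a b := fun h1 h2 => by
    rw [ent, dual, if_pos, ent]
    · congr 1
      ext i
      simp only [Finset.mem_sdiff, Finset.mem_insert, Finset.mem_erase]
      have := @hX i
      grind
    · exact Finset.insert_subset ha ((Finset.erase_subset _ _).trans Finset.sdiff_subset)
  constructor
  · rintro ⟨h1, h2, h3⟩
    exact ⟨h2, h1, this h1 h2 ▸ h3⟩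
  · rintro ⟨h1, h2, h3⟩
    exact ⟨h2, h1, (this h2 h1).symm ▸ h3⟩

end Main

section Induction

variable {α F K : Type*} [DecidableEq α] [Field F] [Field K] {E X : Finset α} {r : ℕ}
  {χ : Finset α → F} {f : F → K} {e g : α} [CharP F 2] [CharP K 2]

lemma exists_lift_of_good (hf : CrMap f) (hχ : IsPlucker E r χ) (ht : Ternary E χ) (hX : χ X ≠ 0)
    (he : e ∈ E) (hg : g ∈ E) (hne : e ≠ g) (heX : e ∉ X) (hgX : g ∉ X)
    (hgood : Good (Adj χ X) e g)
    (ih : ∀ E' : Finset α, E'.card < E.card → ∀ χ' : Finset α → F, IsPlucker E' r χ' →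
      Ternary E' χ' → χ' X ≠ 0 → ∃ ψ : Finset α → K, Lift f r χ' ψ) :
    ∃ ψ : Finset α → K, Lift f r χ ψ := by
  refine exists_lift_of_del hf hχ ht hX hne heX hgX (fun x x' hx hx' => ?_)
    (ih _ (Finset.card_erase_lt_of_mem he) _ (hχ.del e) (ht.del e) (by rwa [del_base heX]))
    (ih _ (Finset.card_erase_lt_of_mem hg) _ (hχ.del g) (ht.del g) (by rwa [del_base hgX]))
  refine eqvGen_trans_of (fun a b h => ?_) (hgood x x' (.inr hx) (.inr hx'))
  rcases h.1 with h1 | h1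
  · exact .rel _ _ ((edge_del_del_iff heX hgX).2 ⟨h1, h.2.2⟩)
  · exact .symm _ _ (.rel _ _ ((edge_del_del_iff heX hgX).2 ⟨h1, h.2.1⟩))

/-- Every ternary Plücker vector in characteristic two can be lifted along `f`. -/
theorem exists_lift (hf : CrMap f) (n : ℕ) : ∀ (E : Finset α) (r : ℕ) (χ : Finset α → F),
    E.card = n → IsPlucker E r χ → Ternary E χ → (∃ X, χ X ≠ 0) →
      ∃ ψ : Finset α → K, Lift f r χ ψ := by
  induction n using Nat.strong_induction_on with
  | _ n ih =>
    rintro E r χ rfl hχ ht ⟨X, hX⟩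
    rcases Nat.lt_or_ge E.card 5 with hE | hE
    · exact hχ.lift_of_card_le_four hf (by omega)
    obtain ⟨X, hX, e, he, g, hg, hne, hcl, hgood⟩ := hχ.exists_good hX hE
    by_cases heX : e ∈ X
    · have hgX := hcl.1 heX
      have hXE := hχ.sub X hX
      have hr : r ≤ E.card := hχ.card X hX ▸ Finset.card_le_card hXE
      have hrr : E.card - (E.card - r) = r := by omega
      have hXX : CrossRatioLift.dual E χ (E \ X) ≠ 0 := by
        rwa [CrossRatioLift.dual, if_pos Finset.sdiff_subset, Finset.sdiff_sdiff_eq_self hXE]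
      have hχd := hχ.dual hr
      have hgood' : Good (Adj (CrossRatioLift.dual E χ) (E \ X)) e g := fun x x' hx hx' => by
        have hmem : ∀ {a b}, Adj (CrossRatioLift.dual E χ) (E \ X) a b → a ∈ E :=
          fun h => h.mem hχd hXX
        have hadj : ∀ {a b}, a ∈ E → b ∈ E →
            (Adj (CrossRatioLift.dual E χ) (E \ X) a b ↔ Adj χ X a b) := fun ha hb => by
          rw [Adj, edge_dual_iff hXE hb ha, edge_dual_iff hXE ha hb, Adj, or_comm]
        refine (hgood x x' ((hadj he (hmem hx.symm)).1 hx)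
          ((hadj he (hmem hx'.symm)).1 hx')).mono fun a b h => ⟨?_, h.2⟩
        exact (hadj (h.1.mem hχ hX) (h.1.symm.mem hχ hX)).2 h.1
      obtain ⟨ψ, hψ⟩ := exists_lift_of_good (K := K) hf hχd ht.dual hXX he hg hne
        (by simp [heX]) (by simp [hgX]) hgood'
        fun E' hE' χ' h1 h2 h3 => ih _ hE' E' _ χ' rfl h1 h2 ⟨_, h3⟩
      have := hψ.dual hf hχd (Nat.sub_le _ _)
      rw [hrr, dual_dual hχ.sub] at this
      exact ⟨_, this⟩
    · exact exists_lift_of_good hf hχ ht hX he hg hne heX (fun h => heX (hcl.2 h)) hgood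
        fun E' hE' χ' h1 h2 h3 => ih _ hE' E' _ χ' rfl h1 h2 ⟨_, h3⟩

end Induction

section CrossRatioMap

/-- A map on cross ratios exists as soon as the target has a primitive third root of unity. -/
lemma exists_crMap {F K : Type*} [Field F] [Field K] [Algebra (ZMod 2) F] [CharP F 2] [CharP K 2]
    {ω : K} (hω : ω ^ 2 + ω + 1 = 0) : ∃ f : F → K, CrMap f := by
  classical
  obtain ⟨l, hl⟩ : ∃ l : F →ₗ[ZMod 2] ZMod 2, l 1 = 1 := by
    by_contra! h
    have h2 : ∀ x : ZMod 2, x ≠ 1 → x = 0 := by decide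
    exact one_ne_zero ((Module.forall_dual_apply_eq_zero_iff (ZMod 2) (1 : F)).1
      fun l => h2 _ (h l))
  have t2 : (2 : F) = 0 := CharTwo.two_eq_zero
  have k2 : (2 : K) = 0 := CharTwo.two_eq_zero
  set s : F → F := fun p => p + 1 / (1 + p) + (1 + p) / p with hs
  set j : ZMod 2 →+* K := ZMod.castHom dvd_rfl K with hj
  set f : F → K := fun p => if p = 0 then 0 else if p = 1 then 1 else ω + j (l (s p)) with hf
  have hne : ∀ {p : F}, p ≠ 1 → 1 + p ≠ 0 := fun h h' => h (by linear_combination h' - t2)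
  have hgen : ∀ p, p ≠ 0 → p ≠ 1 → f p = ω + j (l (s p)) := fun p h0 h1 => by
    simp [hf, h0, h1]
  have f0 : f 0 = 0 := by simp [hf]
  have f1 : f 1 = 1 := by simp [hf]
  have hshift : ∀ p p', p ≠ 0 → p ≠ 1 → p' ≠ 0 → p' ≠ 1 → s p' = s p + 1 → f p' = 1 + f p := by
    intro p p' h0 h1 h0' h1' h
    rw [hgen p h0 h1, hgen p' h0' h1', h, map_add, hl, map_add, map_one]
    ring
  have hval : ∀ p, p ≠ 0 → p ≠ 1 → f p * (1 + f p) = 1 := by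
    intro p h0 h1
    rw [hgen p h0 h1]
    have hj2 : ∀ x : ZMod 2, x = 0 ∨ x = 1 := by decide
    rcases hj2 (l (s p)) with h | h <;> rw [h]
    · rw [map_zero]; linear_combination hω - k2
    · rw [map_one]; linear_combination hω + ω * k2
  have h11 : (1 : F) + 1 = 0 := by linear_combination t2
  refine ⟨f, f0, f1, fun p => ?_, fun p => ?_, fun p hp => ?_⟩
  · by_cases h0 : p = 0
    · simp [h0, f0, f1]
    by_cases h1 : p = 1
    · rw [h1, h11, f0, f1]; linear_combination -k2
    refine hshift p (1 + p) h0 h1 (hne h1) (by simpa using h0) ?_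
    have h2 : 1 + (1 + p) = p := by linear_combination t2
    have := hne h1
    simp only [hs, h2]
    field_simp
    linear_combination (-p) * t2
  · by_cases h0 : p = 0
    · simp [h0, f0]
    by_cases h1 : p = 1
    · simp [h1, f1]
    have h3 : f p⁻¹ = 1 + f p := by
      refine hshift p p⁻¹ h0 h1 (inv_ne_zero h0) (by simpa using h1) ?_
      have h4 := hne h1
      have h5 : p + 1 ≠ 0 := by rwa [add_comm]
      have h6 : 1 + p⁻¹ ≠ 0 := by
        rw [show 1 + p⁻¹ = (p + 1) / p by field_simp]; exact div_ne_zero h5 h0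
      simp only [hs]
      field_simp
      linear_combination (-(1 : F)) * t2 * (p ^ 2 + p)
    rw [h3]
    exact (inv_eq_of_mul_eq_one_right (hval p h0 h1)).symm
  · by_contra h0
    by_cases h1 : p = 1
    · rw [h1, f1] at hp; exact one_ne_zero hp
    · have := hval p h0 h1
      rw [hp] at this; simp at this

lemma exists_cube_root (r : ℕ) (hr : 2 ≤ r) (h : Even r) :
    ∃ ω : GaloisField 2 r, ω ^ 2 + ω + 1 = 0 := by
  classical
  have hr0 : r ≠ 0 := by omega
  have hc := GaloisField.card 2 r hr0
  have : Finite (GaloisField 2 r) := Nat.finite_of_card_ne_zero (by rw [hc]; positivity)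
  have hu : Nat.card (GaloisField 2 r)ˣ = 2 ^ r - 1 := by rw [Nat.card_units, hc]
  have : Fact (Nat.Prime 3) := ⟨by norm_num⟩
  obtain ⟨u, hu3⟩ := exists_prime_orderOf_dvd_card' (G := (GaloisField 2 r)ˣ) 3 (by
    rw [hu]
    obtain ⟨k, rfl⟩ := h
    rw [← two_mul, pow_mul]
    simpa using Nat.sub_dvd_pow_sub_pow 4 1 k)
  have h1 : (u : GaloisField 2 r) ^ 3 = 1 := by
    rw [← Units.val_pow_eq_pow_val, ← hu3, pow_orderOf_eq_one, Units.val_one]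
  have h2 : (u : GaloisField 2 r) - 1 ≠ 0 := fun h => by
    have : u = 1 := Units.ext (by simpa using sub_eq_zero.1 h)
    rw [this, orderOf_one] at hu3
    omega
  exact ⟨u, mul_left_cancel₀ h2 (by linear_combination h1)⟩

end CrossRatioMap

section FiniteRep

variable {α : Type*} [DecidableEq α]

/-- Over any field, exchanging part of a base is governed by minors of the coordinate matrix. -/
lemma linearIndepOn_exchange {L V : Type*} [Field L] [AddCommGroup V] [Module L V] (φ : α → V)
    {X : Finset α} (hX : LinearIndepOn L φ (X : Set α)) (N : α → α → L) {k : ℕ} (x y : Fin k → α)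
    (hx : Function.Injective x) (hy : Function.Injective y) (hxX : ∀ i, x i ∈ X)
    (hyX : ∀ i, y i ∉ X) (hN : ∀ j, φ (y j) = ∑ i ∈ X, N i (y j) • φ i) :
    LinearIndepOn L φ (((X \ Finset.univ.image x) ∪ Finset.univ.image y : Finset α) : Set α) ↔
      (Matrix.of fun i j => N (x i) (y j)).det ≠ 0 := by
  classical
  set A : Finset α := X \ Finset.univ.image x with hA
  have hAX : (A : Set α) ∪ Set.range x = X := by
    ext i
    simp only [hA, Finset.coe_sdiff, Finset.coe_image, Finset.coe_univ, Set.image_univ,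
      Set.mem_union, Set.mem_sdiff, Finset.mem_coe, Set.mem_range]
    constructor
    · rintro (h | ⟨i, rfl⟩)
      · exact h.1
      · exact hxX i
    · tauto
  have hAx : Disjoint (A : Set α) (Set.range x) := by
    rw [Set.disjoint_left]
    rintro i hi ⟨k, rfl⟩
    simp [hA] at hi
  have hAy : Disjoint (A : Set α) (Set.range y) := by
    rw [Set.disjoint_left]
    rintro i hi ⟨k, rfl⟩
    simp [hA, hyX] at hi
  have hAi : LinearIndepOn L φ (A : Set α) := hX.mono (by rw [← hAX]; exact Set.subset_union_left)
  set U := Submodule.span L (φ '' A)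
  have hb : LinearIndependent L fun i => U.mkQ (φ (x i)) := by
    rw [← hAX, ← hAi.quotient_iff_union hAx] at hX
    exact (linearIndepOn_range_iff hx _).1 hX
  rw [Finset.coe_union, Finset.coe_image, Finset.coe_univ, Set.image_univ,
    ← hAi.quotient_iff_union hAy, linearIndepOn_range_iff hy]
  have hw : (U.mkQ ∘ φ) ∘ y =
      Fintype.linearCombination L (fun i => U.mkQ (φ (x i))) ∘
        (Matrix.of fun i j => N (x i) (y j)).col := by
    funext j
    have hsub : Finset.univ.image x ⊆ X := fun i hi => by
      obtain ⟨k, -, rfl⟩ := Finset.mem_image.1 hi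
      exact hxX k
    simp only [Function.comp_apply, Fintype.linearCombination_apply, Matrix.col_apply,
      Matrix.of_apply]
    rw [hN, map_sum, ← Finset.sum_sdiff hsub, Finset.sum_eq_zero, zero_add,
      Finset.sum_image fun a _ b _ h => hx h]
    · simp only [map_smul]
    · intro i hi
      rw [Submodule.mkQ_apply, Submodule.Quotient.mk_eq_zero]
      exact Submodule.smul_mem _ _ (Submodule.subset_span ⟨i, by simpa [hA] using hi, rfl⟩)
  have hker : LinearMap.ker (Fintype.linearCombination L fun i => U.mkQ (φ (x i))) = ⊥ :=
    LinearMap.ker_eq_bot.2 (linearIndependent_iff_injective_fintypeLinearCombination.1 hb)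
  rw [hw, LinearMap.linearIndependent_iff _ hker, Matrix.linearIndependent_cols_iff_isUnit,
    Matrix.isUnit_iff_isUnit_det, isUnit_iff_ne_zero]

lemma finrank_span_image {L V : Type*} [Field L] [AddCommGroup V] [Module L V] {φ : α → V}
    {Z : Finset α} (h : LinearIndepOn L φ (Z : Set α)) :
    Module.finrank L (Submodule.span L (φ '' Z)) = Z.card := by
  have := finrank_span_eq_card (R := L) (b := fun i : (Z : Set α) => φ i) h
  rw [← Set.image_eq_range] at this
  simpa using this

/-- A linearly independent subset of a spanning finite set extends to a base. -/
lemma exists_vdet_ne_zero {L : Type*} [Field L] [CharP L 2] {r : ℕ} {v : α → Fin r → L}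
    {S X I : Finset α} (hX : vdet v X ≠ 0) (hXS : X ⊆ S) (hIS : I ⊆ S)
    (hI : LinearIndepOn L v (I : Set α)) : ∃ Z, I ⊆ Z ∧ Z ⊆ S ∧ vdet v Z ≠ 0 := by
  obtain ⟨b, hbS, hIb, hb, hbi⟩ := exists_linearIndepOn_extension hI (Finset.coe_subset.2 hIS)
  lift b to Finset α using S.finite_toSet.subset hbS
  refine ⟨b, Finset.coe_subset.1 hIb, Finset.coe_subset.1 hbS,
    (vdet_ne_zero_iff v b).2 ⟨le_antisymm ?_ ?_, hbi⟩⟩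
  · simpa using hbi.fintype_card_le_finrank
  · obtain ⟨hc, hXi⟩ := (vdet_ne_zero_iff v X).1 hX
    have hXi : LinearIndepOn L v (X : Set α) := hXi
    rw [← hc, ← finrank_span_image hXi, ← finrank_span_image hbi]
    refine Submodule.finrank_mono (Submodule.span_le.2 ?_)
    exact (Set.image_mono (Finset.coe_subset.2 hXS)).trans hb

/-- The vectors of a finite configuration written in coordinates of their span. -/
lemma exists_coordinates {L V : Type*} [Field L] [CharP L 2] [AddCommGroup V] [Module L V]
    (φ : α → V) (S : Finset α) : ∃ (r : ℕ) (u : α → Fin r → L), (∀ a ∉ S, u a = 0) ∧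
      (∀ I ⊆ S, LinearIndepOn L u (I : Set α) ↔ LinearIndepOn L φ (I : Set α)) ∧
      ∃ X ⊆ S, vdet u X ≠ 0 := by
  classical
  set W := Submodule.span L (φ '' S) with hW
  have hfin : FiniteDimensional L W :=
    FiniteDimensional.span_of_finite L (S.finite_toSet.image φ)
  set e := (Module.finBasis L W).equivFun
  set u : α → Fin (Module.finrank L W) → L := fun a =>
    if h : a ∈ S then e ⟨φ a, Submodule.subset_span ⟨a, h, rfl⟩⟩ else 0 with hu
  have hiff : ∀ I ⊆ S, LinearIndepOn L u (I : Set α) ↔ LinearIndepOn L φ (I : Set α) := by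
    intro I hI
    have hcomp : (fun i : (I : Set α) => φ i) =
        (W.subtype ∘ₗ e.symm.toLinearMap) ∘ fun i : (I : Set α) => u i := by
      funext i
      simp [hu, hI i.2]
    have hker : LinearMap.ker (W.subtype ∘ₗ e.symm.toLinearMap) = ⊥ :=
      LinearMap.ker_eq_bot.2 (W.subtype_injective.comp e.symm.injective)
    change LinearIndependent L _ ↔ LinearIndependent L fun i : (I : Set α) => φ i
    rw [hcomp, LinearMap.linearIndependent_iff _ hker]
  refine ⟨_, u, fun a ha => dif_neg ha, hiff, ?_⟩
  obtain ⟨b, hbS, -, hb, hbi⟩ :=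
    exists_linearIndepOn_extension (linearIndepOn_empty L φ) (Set.empty_subset (S : Set α))
  lift b to Finset α using S.finite_toSet.subset hbS
  have hbS := Finset.coe_subset.1 hbS
  refine ⟨b, hbS, (vdet_ne_zero_iff u b).2 ⟨?_, (hiff b hbS).2 hbi⟩⟩
  rw [← finrank_span_image hbi, hW, le_antisymm
    (Submodule.span_mono (Set.image_mono (Finset.coe_subset.2 hbS))) (Submodule.span_le.2 hb)]

lemma ternary_vdet {F V : Type*} [Field F] [CharP F 2] [AddCommGroup V] [Module (ZMod 3) V]
    {r : ℕ} {u : α → Fin r → F} {S : Finset α} (φ : α → V)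
    (h : ∀ I ⊆ S, LinearIndepOn F u (I : Set α) ↔ LinearIndepOn (ZMod 3) φ (I : Set α))
    (hu : ∀ a ∉ S, u a = 0) : Ternary S (vdet u) := by
  intro X hX
  have hXS := (vdet_isPlucker u hu).sub X hX
  obtain ⟨hc, hXi⟩ := (vdet_ne_zero_iff u X).1 hX
  have hX3 := (h X hXS).1 hXi
  have hspan : ∀ y, ∃ c : α → ZMod 3, y ∈ S → y ∉ X → φ y = ∑ i ∈ X, c i • φ i := by
    intro y
    by_cases hy : y ∈ S ∧ y ∉ X
    · have h1 : φ y ∈ Submodule.span (ZMod 3) (φ '' X) := by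
        by_contra hn
        have h2 := hX3.insert hn
        rw [← Finset.coe_insert, ← h _ (Finset.insert_subset hy.1 hXS)] at h2
        have h3 : (insert y X).card ≤ r := by simpa using h2.fintype_card_le_finrank
        rw [Finset.card_insert_of_notMem hy.2] at h3
        omega
      obtain ⟨c, hc⟩ := (Submodule.mem_span_image_finset_iff_exists_fun' (ZMod 3)).1 h1
      exact ⟨c, fun _ _ => hc.symm⟩
    · exact ⟨0, fun h1 h2 => (hy ⟨h1, h2⟩).elim⟩
  choose c hc' using hspan
  refine ⟨fun i y => c y i, fun k x y hx hy hxX hyX => ?_⟩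
  rw [← linearIndepOn_exchange φ hX3 (fun i y => c y i) x y hx hy hxX (fun i => (hyX i).2)
    (fun j => hc' _ (hyX j).1 (hyX j).2), ← h, vdet_ne_zero_iff]
  · refine and_iff_right ?_
    rw [Finset.card_union_of_disjoint, Finset.card_sdiff_of_subset,
      Finset.card_image_of_injective _ hx, Finset.card_image_of_injective _ hy, hc]
    · have : (Finset.univ.image x).card ≤ X.card := Finset.card_le_card fun i hi => by
        obtain ⟨j, -, rfl⟩ := Finset.mem_image.1 hi
        exact hxX j
      rw [Finset.card_image_of_injective _ hx, hc] at this
      omega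
    · intro i hi
      obtain ⟨j, -, rfl⟩ := Finset.mem_image.1 hi
      exact hxX j
    · rw [Finset.disjoint_left]
      intro i hi hi'
      obtain ⟨j, -, rfl⟩ := Finset.mem_image.1 hi'
      exact (hyX j).2 (Finset.mem_sdiff.1 hi).1
  · refine Finset.union_subset (Finset.sdiff_subset.trans hXS) fun i hi => ?_
    obtain ⟨j, -, rfl⟩ := Finset.mem_image.1 hi
    exact (hyX j).1

/-- A finite configuration over `F` that is also ternary has a copy over `K`. -/
theorem exists_finite_rep {F K V V' : Type*} [Field F] [Field K] [CharP F 2] [CharP K 2]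
    [AddCommGroup V] [Module F V] [AddCommGroup V'] [Module (ZMod 3) V'] {f : F → K}
    (hf : CrMap f) (φ : α → V) (φ' : α → V') (S : Finset α)
    (h : ∀ I ⊆ S, LinearIndepOn F φ (I : Set α) ↔ LinearIndepOn (ZMod 3) φ' (I : Set α)) :
    ∃ (r : ℕ) (v : α → Fin r → K),
      ∀ I ⊆ S, LinearIndepOn K v (I : Set α) ↔ LinearIndepOn F φ (I : Set α) := by
  obtain ⟨r, u, hu0, hu, X, hXS, hX⟩ := exists_coordinates (L := F) φ S
  have pu := vdet_isPlucker u hu0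
  obtain ⟨ψ, hψ⟩ := exists_lift (K := K) hf _ S r (vdet u) rfl pu
    (ternary_vdet φ' (fun I hI => (hu I hI).trans (h I hI)) hu0) ⟨X, hX⟩
  have pψ := hψ.isPlucker hf pu
  have eψ := (vdet_exch u).congr hψ.supp
  have hψX : ψ X ≠ 0 := mt (hψ.supp X).1 hX
  obtain ⟨v, hv0, hvX, hv⟩ := exists_vdet (pu.card X hX) hXS
    (fun x y => ψ (insert y (X.erase x)) / ψ X)
  have hφ : ∀ I, gauge (ψ X) (fun _ => 1) (vdet v) I = ψ X * vdet v I := fun I => by simp [gauge]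
  have hfin : gauge (ψ X) (fun _ => 1) (vdet v) = ψ := by
    refine ((Lift.refl.gauge (vdet_isPlucker v hv0) hψX (t := fun _ => 1)
      (by simp)).isPlucker crMap_id (vdet_isPlucker v hv0)).eq_of_entries pψ
      ((vdet_exch v).gauge hψX (by simp)) eψ (X := X) ?_ ?_ ?_
    · rw [hφ, hvX, mul_one]; exact hψX
    · rw [hφ, hvX, mul_one]
    · intro x hx y hy hyX
      rw [hφ, hv x hx y hy hyX]
      field_simp
  have hsupp : ∀ I, vdet v I ≠ 0 ↔ vdet u I ≠ 0 := fun I => by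
    rw [ne_eq, ne_eq, ← hψ.supp, ← hfin, hφ, mul_eq_zero, or_iff_right hψX]
  refine ⟨r, v, fun I hI => (?_ : _ ↔ _).trans (hu I hI)⟩
  constructor
  · intro hIv
    obtain ⟨Z, hIZ, -, hZ⟩ := exists_vdet_ne_zero ((hsupp X).2 hX) hXS hI hIv
    exact LinearIndepOn.mono ((vdet_ne_zero_iff u Z).1 ((hsupp Z).1 hZ)).2
      (Finset.coe_subset.2 hIZ)
  · intro hIu
    obtain ⟨Z, hIZ, -, hZ⟩ := exists_vdet_ne_zero hX hXS hI hIu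
    exact LinearIndepOn.mono ((vdet_ne_zero_iff v Z).1 ((hsupp Z).2 hZ)).2
      (Finset.coe_subset.2 hIZ)

end FiniteRep

section Compactness

/-- Over a finite field, representability is determined by finite restrictions. -/
lemma exists_rep_of_finite {α : Type u} {K : Type v} [Field K] [Finite K] (M : Matroid α)
    (hM : ∀ I ⊆ M.E, ¬ M.Indep I → ∃ J : Finset α, (J : Set α) ⊆ I ∧ ¬ M.Indep J)
    (h : ∀ S : Finset α, (S : Set α) ⊆ M.E → ∃ (r : ℕ) (v : α → Fin r → K),
      ∀ I ⊆ S, LinearIndepOn K v (I : Set α) ↔ M.Indep I) :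
    ∃ W : Submodule K (α →₀ K), ∀ I ⊆ M.E,
      (M.Indep I ↔ LinearIndepOn K (fun a => W.mkQ (Finsupp.single a 1)) I) := by
  classical
  choose r v hv using fun S : Finset α => h (S.filter (· ∈ M.E))
    fun a ha => (Finset.mem_filter.1 ha).2
  replace hv : ∀ (S I : Finset α), I ⊆ S → (I : Set α) ⊆ M.E →
      (LinearIndepOn K (v S) (I : Set α) ↔ M.Indep I) := fun S I h1 h2 =>
    hv S I fun a ha => Finset.mem_filter.2 ⟨h1 ha, h2 ha⟩
  set U : Ultrafilter (Finset α) := Ultrafilter.of Filter.atTop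
  have hU : ∀ J : Finset α, ∀ᶠ S in (U : Filter (Finset α)), J ⊆ S := fun J =>
    Ultrafilter.of_le _ (Filter.eventually_ge_atTop J)
  set Z : Finset α → Submodule K (α →₀ K) := fun S =>
    LinearMap.ker (Finsupp.linearCombination K (v S)) with hZ
  set W : Submodule K (α →₀ K) :=
    { carrier := {w | ∀ᶠ S in (U : Filter (Finset α)), w ∈ Z S}
      add_mem' := fun ha hb => by
        filter_upwards [ha, hb] with S h1 h2 using add_mem h1 h2
      zero_mem' := Filter.Eventually.of_forall fun S => zero_mem _
      smul_mem' := fun c w hw => by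
        filter_upwards [hw] with S h1 using Submodule.smul_mem _ c h1 } with hW
  have hmem : ∀ w, w ∈ W ↔ ∀ᶠ S in (U : Filter (Finset α)), w ∈ Z S := fun w => Iff.rfl
  have hlc : Finsupp.linearCombination K (fun a => W.mkQ (Finsupp.single a 1)) = W.mkQ := by
    ext a
    simp
  have hZd : ∀ (S I : Finset α), I ⊆ S → (I : Set α) ⊆ M.E →
      (Disjoint (Finsupp.supported K K (I : Set α)) (Z S) ↔ M.Indep I) := fun S I h1 h2 => by
    rw [← hv S I h1 h2, linearIndepOn_iff_disjoint]
  refine ⟨W, fun I hI => ?_⟩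
  rw [linearIndepOn_iff_disjoint, hlc, Submodule.ker_mkQ]
  constructor
  · intro hIi
    rw [Submodule.disjoint_def]
    intro l hl hlW
    have hlI : (l.support : Set α) ⊆ I := (Finsupp.mem_supported K l).1 hl
    obtain ⟨S, hS1, hS2⟩ := (((hmem l).1 hlW).and (hU l.support)).exists
    exact Submodule.disjoint_def.1 ((hZd S l.support hS2 (hlI.trans hI)).2 (hIi.subset hlI)) l
      (Finsupp.mem_supported_support K l) hS1
  · intro hd
    by_contra hn
    obtain ⟨J, hJI, hJ⟩ := hM I hI hn
    have hfin : ((Finsupp.supported K K (J : Set α) : Set (α →₀ K)) \ {0}).Finite := by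
      refine Set.Finite.sdiff ?_
      have : Finite ((J : Set α) →₀ K) := Finite.of_equiv _ Finsupp.equivFunOnFinite.symm
      have := Finite.of_equiv _ (Finsupp.supportedEquivFinsupp (M := K) (R := K)
        (J : Set α)).toEquiv.symm
      exact Set.toFinite _
    have hev : ∀ᶠ S in (U : Filter (Finset α)),
        ∃ l ∈ (Finsupp.supported K K (J : Set α) : Set (α →₀ K)) \ {0}, l ∈ Z S := by
      filter_upwards [hU J] with S hS
      have := mt (hZd S J hS (hJI.trans hI)).1 hJ
      rw [Submodule.disjoint_def] at this
      push Not at this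
      obtain ⟨l, h1, h2, h3⟩ := this
      exact ⟨l, ⟨h1, h3⟩, h2⟩
    obtain ⟨l, ⟨h1, h2⟩, h3⟩ := (Ultrafilter.eventually_exists_mem_iff hfin).1 hev
    exact h2 (Submodule.disjoint_def.1 hd l (Finsupp.supported_mono hJI h1) h3)

end Compactness

section Transfer

/-- Representations over `F` of a ternary matroid can be moved along a map of cross ratios. -/
theorem exists_rep_transfer {α : Type u} {F K V V' : Type*} [Field F] [Field K] [Finite K]
    [CharP F 2] [CharP K 2] [AddCommGroup V] [Module F V] [AddCommGroup V'] [Module (ZMod 3) V']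
    {f : F → K} (hf : CrMap f) (M : Matroid α) (φ : α → V) (φ' : α → V')
    (h : ∀ I ⊆ M.E, M.Indep I ↔ LinearIndepOn F φ I)
    (h' : ∀ I ⊆ M.E, M.Indep I ↔ LinearIndepOn (ZMod 3) φ' I) :
    ∃ W : Submodule K (α →₀ K), ∀ I ⊆ M.E,
      (M.Indep I ↔ LinearIndepOn K (fun a => W.mkQ (Finsupp.single a 1)) I) := by
  classical
  refine exists_rep_of_finite M (fun I hI hn => ?_) fun S hS => ?_
  · by_contra! hJ
    refine hn ((h I hI).2 (linearIndepOn_of_finite I fun t ht hfin => ?_))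
    lift t to Finset α using hfin
    exact (h t (ht.trans hI)).1 (hJ t ht)
  · have hI : ∀ I ⊆ S, (I : Set α) ⊆ M.E := fun I h => (Finset.coe_subset.2 h).trans hS
    obtain ⟨r, v, hv⟩ := exists_finite_rep hf φ φ' S
      fun I hIS => (h I (hI I hIS)).symm.trans (h' I (hI I hIS))
    exact ⟨r, v, fun I hIS => (hv I hIS).trans (h I (hI I hIS)).symm⟩

end Transfer

/-- Representability over two finite fields of even degree over `𝔽₂` agrees for ternary
matroids. -/
lemma representable_galoisField_of_ternary {α : Type u} (M : Matroid α) {m n : ℕ} (hn : 2 ≤ n)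
    (hne : Even n) (h : Paper.Representable M (GaloisField 2 m))
    (h' : Paper.Representable M (ZMod 3)) : Paper.Representable M (GaloisField 2 n) := by
  obtain ⟨ω, hω⟩ := exists_cube_root n hn hne
  obtain ⟨f, hf⟩ := exists_crMap (F := GaloisField 2 m) hω
  have : Finite (GaloisField 2 n) := Nat.finite_of_card_ne_zero (by
    rw [GaloisField.card 2 n (by omega)]; positivity)
  obtain ⟨V, _, _, φ, hφ⟩ := h
  obtain ⟨V', _, _, φ', hφ'⟩ := h'
  obtain ⟨W, hW⟩ := exists_rep_transfer hf M φ φ' hφ hφ'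
  exact ⟨_, inferInstance, inferInstance, fun a => W.mkQ (Finsupp.single a 1), hW⟩

end CrossRatioLift

/-- Let `M` be a matroid without large uniform minors and let `r ≥ 2` be
an even integer. Then `M` is representable over both the finite field `𝔽_{2^r}` and `𝔽₃`
if and only if `M` is representable over both `𝔽₄` and `𝔽₃`. -/
theorem representable_F2r_even_and_F3_iff_hexagonal
    {α : Type u} (M : Matroid α) (hM : Paper.NoLargeUniformMinors M)
    (r : ℕ) (hr : 2 ≤ r) (heven : Even r) :
    (Paper.Representable M (GaloisField 2 r) ∧ Paper.Representable M (ZMod 3)) ↔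
      (Paper.Representable M (GaloisField 2 2) ∧ Paper.Representable M (ZMod 3)) := by
  exact ⟨fun h => ⟨CrossRatioLift.representable_galoisField_of_ternary M le_rfl even_two h.1 h.2, h.2⟩,
    fun h => ⟨CrossRatioLift.representable_galoisField_of_ternary M hr heven h.1 h.2, h.2⟩⟩
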